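/- Let n̂ ∈ C⁰(P̂) and let n̂_I ∈ C⁰(P̂) be a representative map having the same edge orientations, kink numbers, and wrapping numbers as n̂ (constructed as in the paper). Then n̂ is homotopic in C⁰(P̂) to a map n̂' ∈ C⁰(P̂) such that n̂' = n̂_I at every point of the boundary ∂P̂. -/

import Mathlib

open Matrix Set MeasureTheory
open scoped Classical

noncomputable section

/-- Points of `ℝ³`. -/
abbrev V3 := Fin 3 → ℝ

/-- The unit sphere `S² ⊂ ℝ³`. -/
def sphereS : Set V3 := {x | x ⬝ᵥ x = 1}

/-- Rodrigues rotation of `v` by angle `θ` about the unit axis `F`. -/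
def rot3 (F : V3) (θ : ℝ) (v : V3) : V3 :=
  Real.cos θ • v + Real.sin θ • (crossProduct F v) + ((1 - Real.cos θ) * (F ⬝ᵥ v)) • F

/-- The point at fraction `ρ` of arclength along the shortest geodesic on the
unit sphere from `p` to `a` (for `a ≠ -p`). -/
def geo (p a : V3) (ρ : ℝ) : V3 :=
  if p = a then p
  else (Real.sin ((1 - ρ) * Real.arccos (p ⬝ᵥ a)) / Real.sin (Real.arccos (p ⬝ᵥ a))) • p +
       (Real.sin (ρ * Real.arccos (p ⬝ᵥ a)) / Real.sin (Real.arccos (p ⬝ᵥ a))) • a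

/-- `ξ` is the continuous angle lift of the tangent field `n` along the path `z`
(defined on `[0,1]`), `η ∈ (-π,π)` the smallest-magnitude angle between the endpoint
values, and `κ` the resulting kink number: `2πκ = ξ(1) - η`. -/
def IsKinkAlong (Fn : V3) (n : V3 → V3) (z : ℝ → V3) (κ : ℤ) : Prop :=
  ∃ ξ : ℝ → ℝ, ContinuousOn ξ (Set.Icc 0 1) ∧ ξ 0 = 0 ∧
    (∀ t ∈ Set.Icc (0:ℝ) 1, n (z t) = rot3 Fn (ξ t) (n (z 0))) ∧
    ∃ η : ℝ, η ∈ Set.Ioo (-Real.pi) Real.pi ∧ n (z 1) = rot3 Fn η (n (z 0)) ∧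
      2 * Real.pi * (κ : ℝ) = ξ 1 - η

/-- `z` is a `2π`-periodic parameterization of a loop around the centre `ctr`, lying in the
plane through `ctr` with normal `N`, positively oriented with respect to `N` (the angle
`θ` increases by `2π` over a period). -/
def PosLoopParam (N ctr : V3) (z : ℝ → V3) : Prop :=
  Continuous z ∧ (∀ φ, z (φ + 2 * Real.pi) = z φ) ∧
  ∃ e₁ e₂ : V3, e₁ ⬝ᵥ e₁ = 1 ∧ e₂ ⬝ᵥ e₂ = 1 ∧ e₁ ⬝ᵥ e₂ = 0 ∧ crossProduct e₁ e₂ = N ∧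
    ∃ θ r : ℝ → ℝ, Continuous θ ∧ Monotone θ ∧ (∀ φ, θ (φ + 2 * Real.pi) = θ φ + 2 * Real.pi) ∧
      (∀ φ, 0 < r φ) ∧
      ∀ φ, z φ = ctr + r φ • (Real.cos (θ φ) • e₁ + Real.sin (θ φ) • e₂)

/-- The map `S² → S²` obtained by gluing, along the equator, the map
`ν(ρ,φ) = n(ρ z(φ) + (1-ρ) ctr)` (on the upper hemisphere) with the map
`ν₀(ρ,φ) = g_ρ(-s, n(z(φ)))` (on the lower hemisphere), where `(ρ,φ)` are the polar
coordinates of the first two coordinates. -/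
def wrapMap (n : V3 → V3) (z : ℝ → V3) (ctr s : V3) : V3 → V3 := fun x =>
  if 0 ≤ x 2 then
    n ((Real.sqrt ((x 0) ^ 2 + (x 1) ^ 2)) • z (Complex.arg ((x 0 : ℂ) + (x 1 : ℂ) * Complex.I))
      + (1 - Real.sqrt ((x 0) ^ 2 + (x 1) ^ 2)) • ctr)
  else
    geo (-s) (n (z (Complex.arg ((x 0 : ℂ) + (x 1 : ℂ) * Complex.I))))
      (Real.sqrt ((x 0) ^ 2 + (x 1) ^ 2))

/-- Homotopy of maps of the unit sphere `S²` to itself. -/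
def SphHomotopic (f g : V3 → V3) : Prop :=
  ∃ H : ℝ → V3 → V3,
    ContinuousOn (fun q : ℝ × V3 => H q.1 q.2) (Set.Icc (0:ℝ) 1 ×ˢ sphereS) ∧
    (∀ t ∈ Set.Icc (0:ℝ) 1, Set.MapsTo (H t) sphereS sphereS) ∧
    (∀ x ∈ sphereS, H 0 x = f x) ∧ (∀ x ∈ sphereS, H 1 x = g x)

/-- The standard degree-`k` self-map of `S²`: in cylindrical coordinates it multiplies
the azimuthal angle by `k`, fixing the vertical coordinate. -/
def powMap (k : ℤ) : V3 → V3 := fun x =>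
  if ((x 0 : ℂ) + (x 1 : ℂ) * Complex.I) = 0 then x
  else
    ![‖(x 0 : ℂ) + (x 1 : ℂ) * Complex.I‖ *
        ((((x 0 : ℂ) + (x 1 : ℂ) * Complex.I) /
          (‖(x 0 : ℂ) + (x 1 : ℂ) * Complex.I‖ : ℂ)) ^ k).re,
      ‖(x 0 : ℂ) + (x 1 : ℂ) * Complex.I‖ *
        ((((x 0 : ℂ) + (x 1 : ℂ) * Complex.I) /
          (‖(x 0 : ℂ) + (x 1 : ℂ) * Complex.I‖ : ℂ)) ^ k).im,
      x 2]

/-- `deg` is a Brouwer degree for self-maps of `S²`: it is invariant under homotopy of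
continuous self-maps of the sphere, and assigns degree `k` to the standard map `powMap k`.
(These axioms determine `deg` uniquely on continuous self-maps of `S²`, by Hopf's theorem.) -/
def DegreeTheory (deg : (V3 → V3) → ℤ) : Prop :=
  (∀ f g : V3 → V3, ContinuousOn f sphereS → Set.MapsTo f sphereS sphereS →
      ContinuousOn g sphereS → Set.MapsTo g sphereS sphereS →
      SphHomotopic f g → deg f = deg g) ∧
  (∀ k : ℤ, deg (powMap k) = k)

/-- The pullback under `u : ℝ² → S²` of the (normalized) area 2-form of `S²`,
evaluated on the standard basis of `ℝ²`: `u ⋅ (∂₁ u × ∂₂ u)`. -/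
def pullA (u : ℝ × ℝ → V3) (p : ℝ × ℝ) : ℝ :=
  u p ⬝ᵥ crossProduct (fderiv ℝ u p (1, 0)) (fderiv ℝ u p (0, 1))

/-- The integral `∫_A n*ω` of the pullback under `n` of the area form `ω` of `S²`, over a
planar region `A` lying in the plane through `o` spanned by the orthonormal pair `e₁, e₂`
(the pair orienting the plane). -/
def faceInt (n : V3 → V3) (o e₁ e₂ : V3) (A : Set V3) : ℝ :=
  ∫ p : ℝ × ℝ in {q : ℝ × ℝ | o + q.1 • e₁ + q.2 • e₂ ∈ A},
    pullA (fun q : ℝ × ℝ => n (o + q.1 • e₁ + q.2 • e₂)) p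

/-- The 1-form `γ = (1 - cos α) dβ` on `S² - {s}` (where `(α,β)` are spherical polar
coordinates with south pole at `s`, and `e₁, e₂` is an orthonormal azimuthal frame with
`e₁ ×₃ e₂ = -s`), evaluated at the point `v` on the tangent vector `w`. -/
def gammaForm (s e₁ e₂ : V3) (v w : V3) : ℝ :=
  if (v ⬝ᵥ e₁) ^ 2 + (v ⬝ᵥ e₂) ^ 2 = 0 then 0
  else (1 + v ⬝ᵥ s) *
    (((v ⬝ᵥ e₁) * (w ⬝ᵥ e₂) - (v ⬝ᵥ e₂) * (w ⬝ᵥ e₁)) / ((v ⬝ᵥ e₁) ^ 2 + (v ⬝ᵥ e₂) ^ 2))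

/-- The closed spherical geodesic triangle with vertices `a`, `b`, `c` (pairwise
non-antipodal): the radial projection to the sphere of the planar triangle with these
vertices. Its sides are the shortest geodesic arcs joining consecutive vertices. -/
def sphTri (a b c : V3) : Set V3 :=
  {x | ∃ α β γ : ℝ, 0 ≤ α ∧ 0 ≤ β ∧ 0 ≤ γ ∧ α • a + β • b + γ • c ≠ 0 ∧
    x = (Real.sqrt ((α • a + β • b + γ • c) ⬝ᵥ (α • a + β • b + γ • c)))⁻¹ •
      (α • a + β • b + γ • c)}

/-- The shortest geodesic arc on the sphere from `a` to `b` (for `a ≠ -b`). -/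
def sphArc (a b : V3) : Set V3 :=
  {x | ∃ α β : ℝ, 0 ≤ α ∧ 0 ≤ β ∧ α • a + β • b ≠ 0 ∧
    x = (Real.sqrt ((α • a + β • b) ⬝ᵥ (α • a + β • b)))⁻¹ • (α • a + β • b)}

/-- The oriented area `A(a,b,c)` of the spherical geodesic triangle with vertices
`a`, `b`, `c`: `A = 2 arg((1 + a⋅b + b⋅c + c⋅a) + i (a×b)⋅c)`, with `arg ∈ (-π, π]`. -/
def sphA (a b c : V3) : ℝ :=
  2 * Complex.arg (((1 + a ⬝ᵥ b + b ⬝ᵥ c + c ⬝ᵥ a : ℝ) : ℂ) +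
    ((crossProduct a b ⬝ᵥ c : ℝ) : ℂ) * Complex.I)

/-- `σ(a,b,c)` relative to the point `s`: equal to `sgn((a×b)⋅s)` if `s` lies in the
spherical triangle with vertices `a`, `b`, `c`, and `0` otherwise. -/
def sphSigma (s a b c : V3) : ℝ :=
  if s ∈ sphTri a b c then Real.sign (crossProduct a b ⬝ᵥ s) else 0

/-- A compact convex polyhedron `P̄ ⊂ ℝ³` with nonempty interior: its vertices `vert`,
faces `face` (with outward unit normals `Fnormal` and supporting planes
`{x | x ⋅ Fnormal c = foffset c}`), edges `edge` (segments between vertices), together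
with the truncation data: for each vertex `a` a plane through `cpt a` with outward unit
normal `Cnormal a` separating `vert a` from the other vertices, the planes being pairwise
disjoint within `P̄`.  The combinatorial data records, for each face `c`, its `m c`
vertices `fvert c 0, fvert c 1, …` and edges `fedge c i` (from `fvert c i` to
`fvert c (i+1)`) in cyclic order, positively oriented with respect to the outward normal;
and, for each vertex `a`, its `vm a` incident edges `vedge a i` and faces `vface a i`
(with `vface a i` containing the consecutive edges `vedge a i` and `vedge a (i+1)`) in
cyclic order, positively oriented with respect to the outward normal of the cleaved face. -/
structure PolyCtx where
  nv : ℕ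
  ne : ℕ
  nf : ℕ
  Pbar : Set V3
  vert : Fin nv → V3
  face : Fin nf → Set V3
  Fnormal : Fin nf → V3
  foffset : Fin nf → ℝ
  edge : Fin ne → Set V3
  esrc : Fin ne → Fin nv
  etgt : Fin ne → Fin nv
  edgeDir : Fin ne → V3
  cpt : Fin nv → V3
  Cnormal : Fin nv → V3
  m : Fin nf → ℕ
  fvert : Fin nf → ℕ → Fin nv
  fedge : Fin nf → ℕ → Fin ne
  vm : Fin nv → ℕ
  vedge : Fin nv → ℕ → Fin ne
  vface : Fin nv → ℕ → Fin nf
  compact : IsCompact Pbar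
  convex : Convex ℝ Pbar
  int_nonempty : (interior Pbar).Nonempty
  hull : Pbar = convexHull ℝ (Set.range vert)
  vert_extreme : ∀ a, vert a ∉ convexHull ℝ (Set.range vert \ {vert a})
  vert_inj : Function.Injective vert
  Fnormal_unit : ∀ c, Fnormal c ⬝ᵥ Fnormal c = 1
  face_def : ∀ c, face c = {x ∈ Pbar | x ⬝ᵥ Fnormal c = foffset c}
  face_supp : ∀ c, ∀ x ∈ Pbar, x ⬝ᵥ Fnormal c ≤ foffset c
  frontier_eq : frontier Pbar = ⋃ c, face c
  edge_def : ∀ b, edge b = segment ℝ (vert (esrc b)) (vert (etgt b))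
  edge_proper : ∀ b, esrc b ≠ etgt b
  edgeDir_unit : ∀ b, edgeDir b ⬝ᵥ edgeDir b = 1
  edgeDir_dir : ∀ b, ∃ lam : ℝ, 0 < lam ∧ vert (etgt b) - vert (esrc b) = lam • edgeDir b
  edge_two_faces : ∀ b, ∃ c c', edge b ⊆ face c ∧ edge b ⊆ face c' ∧
    crossProduct (Fnormal c) (Fnormal c') ≠ 0
  Cnormal_unit : ∀ a, Cnormal a ⬝ᵥ Cnormal a = 1
  sep_vert : ∀ a, 0 < (vert a - cpt a) ⬝ᵥ Cnormal a
  sep_other : ∀ a a', a' ≠ a → (vert a' - cpt a) ⬝ᵥ Cnormal a < 0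
  cleave_sub : ∀ a a' : Fin nv, ∀ x ∈ Pbar, (x - cpt a) ⬝ᵥ Cnormal a = 0 →
    (x - cpt a') ⬝ᵥ Cnormal a' ≤ 0
  m_ge : ∀ c, 3 ≤ m c
  fvert_per : ∀ c i, fvert c (i + m c) = fvert c i
  fedge_per : ∀ c i, fedge c (i + m c) = fedge c i
  fvert_inj : ∀ c, ∀ i j : ℕ, i < j → j < m c → fvert c i ≠ fvert c j
  fedge_seg : ∀ c i, edge (fedge c i) = segment ℝ (vert (fvert c i)) (vert (fvert c (i + 1)))
  fedge_sub : ∀ c i, edge (fedge c i) ⊆ face c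
  vm_ge : ∀ a, 3 ≤ vm a
  vedge_per : ∀ a i, vedge a (i + vm a) = vedge a i
  vface_per : ∀ a i, vface a (i + vm a) = vface a i
  vedge_inj : ∀ a, ∀ i j : ℕ, i < j → j < vm a → vedge a i ≠ vedge a j
  vedge_mem : ∀ a i, vert a ∈ edge (vedge a i)
  vface_between : ∀ a i, edge (vedge a i) ⊆ face (vface a i) ∧
    edge (vedge a (i + 1)) ⊆ face (vface a i)

namespace PolyCtx

variable (P : PolyCtx)

/-- `P`: the polyhedron `P̄` with its vertices removed. -/
def Pset : Set V3 := P.Pbar \ Set.range P.vert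

/-- The closed half-space `R^a` cut off by the cleaving plane at the vertex `a`. -/
def Rhalf (a : Fin P.nv) : Set V3 := {x | (x - P.cpt a) ⬝ᵥ P.Cnormal a ≤ 0}

/-- The intersection of all the half-spaces `R^a`. -/
def Rall : Set V3 := ⋂ a, P.Rhalf a

/-- The truncated polyhedron `P̂ = P ∩ ⋂ₐ R^a`. -/
def PhatSet : Set V3 := P.Pset ∩ P.Rall

/-- The cleaved face `Ĉ^a = C^a ∩ P`. -/
def Chat (a : Fin P.nv) : Set V3 := {x | (x - P.cpt a) ⬝ᵥ P.Cnormal a = 0} ∩ P.Pset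

/-- The truncated face `F̂^c = F^c ∩ ⋂ₐ R^a`. -/
def Fhat (c : Fin P.nf) : Set V3 := P.face c ∩ P.Rall

/-- The cleaved edge `B̂^{ac} = Ĉ^a ∩ F̂^c`. -/
def Bhat (a : Fin P.nv) (c : Fin P.nf) : Set V3 := P.Chat a ∩ P.Fhat c

/-- The truncated edge `Ê^b = E^b ∩ ⋂ₐ R^a`. -/
def Ehat (b : Fin P.ne) : Set V3 := P.edge b ∩ P.Rall

/-- The boundary `∂Ĉ^a` of the cleaved face: the union of its cleaved edges. -/
def bdChat (a : Fin P.nv) : Set V3 := ⋃ c, P.Bhat a c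

/-- The boundary `∂F̂^c` of the truncated face: its truncated edges and cleaved edges. -/
def bdFhat (c : Fin P.nf) : Set V3 :=
  (⋃ i ∈ Finset.range (P.m c), P.Ehat (P.fedge c i)) ∪
    ⋃ i ∈ Finset.range (P.m c), P.Bhat (P.fvert c i) c

/-- The boundary `∂P̂` of the truncated polyhedron: cleaved faces and truncated faces. -/
def bdPhat : Set V3 := (⋃ a, P.Chat a) ∪ ⋃ c, P.Fhat c

/-- `n ∈ C⁰(P)`: a continuous unit-vector field on `P`, tangent to each face. -/
def MemC0P (n : V3 → V3) : Prop :=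
  ContinuousOn n P.Pset ∧ (∀ x ∈ P.Pset, n x ∈ sphereS) ∧
  ∀ c, ∀ x ∈ P.face c ∩ P.Pset, n x ⬝ᵥ P.Fnormal c = 0

/-- `n ∈ C⁰(P̂)`: a continuous unit-vector field on `P̂`, tangent to each truncated
face `F̂^c` (but not necessarily to the cleaved faces). -/
def MemC0Phat (n : V3 → V3) : Prop :=
  ContinuousOn n P.PhatSet ∧ (∀ x ∈ P.PhatSet, n x ∈ sphereS) ∧
  ∀ c, ∀ x ∈ P.Fhat c, n x ⬝ᵥ P.Fnormal c = 0

/-- Homotopy in `C⁰(P)`. -/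
def HomotopicP (n n' : V3 → V3) : Prop :=
  ∃ H : ℝ → V3 → V3,
    ContinuousOn (fun q : ℝ × V3 => H q.1 q.2) (Set.Icc (0:ℝ) 1 ×ˢ P.Pset) ∧
    (∀ t ∈ Set.Icc (0:ℝ) 1, P.MemC0P (H t)) ∧
    (∀ x ∈ P.Pset, H 0 x = n x) ∧ (∀ x ∈ P.Pset, H 1 x = n' x)

/-- Homotopy in `C⁰(P̂)`. -/
def HomotopicPhat (n n' : V3 → V3) : Prop :=
  ∃ H : ℝ → V3 → V3,
    ContinuousOn (fun q : ℝ × V3 => H q.1 q.2) (Set.Icc (0:ℝ) 1 ×ˢ P.PhatSet) ∧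
    (∀ t ∈ Set.Icc (0:ℝ) 1, P.MemC0Phat (H t)) ∧
    (∀ x ∈ P.PhatSet, H 0 x = n x) ∧ (∀ x ∈ P.PhatSet, H 1 x = n' x)

/-- The edge orientation `e^b(n) = ε`: `n` has the constant value `ε` on `Ê^b`. -/
def IsEdgeOrient (b : Fin P.ne) (n : V3 → V3) (ε : V3) : Prop :=
  ∀ x ∈ P.Ehat b, n x = ε

/-- `z : [0,1] → ℝ³` is a continuous injective parameterization of the cleaved edge
`B̂^{ac}`, positively oriented with respect to the outward normal `F^c` (the face
`F̂^c` lies on the positive side of `F^c × (z 1 - z 0)`). -/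
def IsPosParamSeg (a : Fin P.nv) (c : Fin P.nf) (z : ℝ → V3) : Prop :=
  ContinuousOn z (Set.Icc 0 1) ∧ z '' Set.Icc 0 1 = P.Bhat a c ∧
  Set.InjOn z (Set.Icc 0 1) ∧
  ∀ x ∈ P.Fhat c, 0 ≤ (x - z 0) ⬝ᵥ crossProduct (P.Fnormal c) (z 1 - z 0)

/-- The kink number `k^{ac}(n) = κ`. -/
def HasKink (a : Fin P.nv) (c : Fin P.nf) (n : V3 → V3) (κ : ℤ) : Prop :=
  ∃ z : ℝ → V3, P.IsPosParamSeg a c z ∧ IsKinkAlong (P.Fnormal c) n z κ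

/-- `s ∈ S²` is admissible: not orthogonal to any face normal. -/
def AdmissibleS (s : V3) : Prop := s ∈ sphereS ∧ ∀ c, s ⬝ᵥ P.Fnormal c ≠ 0

/-- The wrapping number `w^a(n) = w`, computed (relative to a Brouwer degree `deg` and
an admissible reference point `s`) as the degree of the map `S² → S²` glued from the
restriction of `n` to the cleaved face `Ĉ^a` and the geodesic contraction of its boundary
values to `-s`, using an interior point `ctr` of `Ĉ^a` and a positively oriented
`2π`-periodic parameterization `z` of `∂Ĉ^a`. -/
def HasWrap (deg : (V3 → V3) → ℤ) (s : V3) (a : Fin P.nv) (n : V3 → V3) (w : ℤ) : Prop :=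
  ∃ ctr z, ctr ∈ P.Chat a ∧ ctr ∉ P.bdChat a ∧
    PosLoopParam (P.Cnormal a) ctr z ∧ Set.range z = P.bdChat a ∧
    deg (wrapMap n z ctr s) = w

/-- `n` and `n'` have the same invariants: equal edge orientations, kink numbers and
wrapping numbers. -/
def SameInv (deg : (V3 → V3) → ℤ) (s : V3) (n n' : V3 → V3) : Prop :=
  (∀ b : Fin P.ne, Set.EqOn n n' (P.Ehat b)) ∧
  (∀ a c, ∀ κ : ℤ, P.HasKink a c n κ ↔ P.HasKink a c n' κ) ∧
  (∀ a, ∀ w : ℤ, P.HasWrap deg s a n w ↔ P.HasWrap deg s a n' w)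

end PolyCtx

noncomputable section
open Matrix Set MeasureTheory
open scoped Classical Quaternion

theorem tietzeOn {E Y : Type} [TopologicalSpace E] [NormalSpace E] [TopologicalSpace Y]
    [TietzeExtension.{0, 0} Y] {A : Set E} (hA : IsClosed A) {f : E → Y} (hf : ContinuousOn f A) :
    ∃ g : E → Y, Continuous g ∧ EqOn g f A := by
  obtain ⟨g, hg⟩ := ContinuousMap.exists_restrict_eq hA (⟨A.domRestrict f, hf.domRestrict⟩ : C(A, Y))
  refine ⟨g, g.continuous, fun x hx => ?_⟩
  have := congrArg (fun k : C(A, Y) => k ⟨x, hx⟩) hg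
  simpa using this

/-- Borsuk homotopy extension with values in `Y \ {0}`. -/
theorem hepNZ {E Y : Type} [MetricSpace E] [NormedAddCommGroup Y]
    [TietzeExtension.{0, 0} Y] {X A : Set E} (hX : IsCompact X) (hA : IsClosed A) (_hAX : A ⊆ X)
    {f : E → Y} (hf : ContinuousOn f X) (f0 : ∀ x ∈ X, f x ≠ 0)
    {h : ℝ × E → Y} (hh : ContinuousOn h (Icc (0:ℝ) 1 ×ˢ A))
    (h0 : ∀ t ∈ Icc (0:ℝ) 1, ∀ x ∈ A, h (t, x) ≠ 0) (hhf : ∀ x ∈ A, h (0, x) = f x) :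
    ∃ H : ℝ × E → Y, ContinuousOn H (Icc (0:ℝ) 1 ×ˢ X) ∧
      (∀ t ∈ Icc (0:ℝ) 1, ∀ x ∈ X, H (t, x) ≠ 0) ∧
      (∀ t ∈ Icc (0:ℝ) 1, ∀ x ∈ A, H (t, x) = h (t, x)) ∧ ∀ x ∈ X, H (0, x) = f x := by
  set B1 : Set (ℝ × E) := Icc (0:ℝ) 1 ×ˢ A
  set B2 : Set (ℝ × E) := {(0:ℝ)} ×ˢ X
  have hB1 : IsClosed B1 := isClosed_Icc.prod hA
  have hB2 : IsClosed B2 := isClosed_singleton.prod hX.isClosed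
  set b : ℝ × E → Y := fun p => if p.2 ∈ A then h p else f p.2
  have hb1 : EqOn b h B1 := fun p hp => by simp [b, hp.2]
  have hb2 : EqOn b (fun p => f p.2) B2 := fun p hp => by
    simp only [b]
    split_ifs with hpA
    · have : p.1 = 0 := hp.1
      rw [← hhf p.2 hpA, ← this]
    · rfl
  have hbc : ContinuousOn b (B1 ∪ B2) := by
    refine ContinuousOn.union_of_isClosed (hh.congr hb1) ?_ hB1 hB2
    refine ContinuousOn.congr ?_ hb2
    exact hf.comp continuousOn_snd fun p hp => hp.2
  obtain ⟨G, hG, hGb⟩ := tietzeOn (hB1.union hB2) hbc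
  set bad : Set E := Prod.snd '' ((Icc (0:ℝ) 1 ×ˢ X) ∩ {p | G p = 0})
  have hbad : IsClosed bad := by
    refine (IsCompact.image ?_ continuous_snd).isClosed
    exact (isCompact_Icc.prod hX).inter_right (isClosed_singleton.preimage hG)
  have hdis : Disjoint bad A := by
    rw [Set.disjoint_left]
    rintro x ⟨⟨t, y⟩, ⟨ht, hz⟩, rfl⟩ hxA
    have h1 : (t, y) ∈ B1 := ⟨ht.1, hxA⟩
    have := hGb (Or.inl h1)
    rw [hb1 h1] at this
    exact h0 t ht.1 y hxA (this ▸ hz)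
  obtain ⟨u, hu0, hu1, hu⟩ := exists_continuous_zero_one_of_isClosed hbad hA hdis
  have hG0 : ∀ x ∈ X, G (0, x) = f x := fun x hx => by
    have h2 : ((0:ℝ), x) ∈ B2 := ⟨rfl, hx⟩
    rw [hGb (Or.inr h2), hb2 h2]
  refine ⟨fun p => G (p.1 * u p.2, p.2), ?_, ?_, ?_, ?_⟩
  · exact (hG.comp (by fun_prop)).continuousOn
  · intro t ht x hx hz
    by_cases hxb : x ∈ bad
    · have : u x = 0 := hu0 hxb
      simp only [this, mul_zero] at hz
      rw [hG0 x hx] at hz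
      exact f0 x hx hz
    · apply hxb
      refine ⟨(t * u x, x), ⟨⟨⟨mul_nonneg ht.1 (hu x).1, ?_⟩, hx⟩, hz⟩, rfl⟩
      exact mul_le_one₀ ht.2 (hu x).1 (hu x).2
  · intro t ht x hx
    have : u x = 1 := hu1 hx
    simp only [this, mul_one]
    have h1 : (t, x) ∈ B1 := ⟨ht, hx⟩
    rw [hGb (Or.inl h1), hb1 h1]
  · intro x hx
    simp [hG0 x hx]

theorem dot_self_pos' {v : V3} (hv : v ≠ 0) : 0 < v ⬝ᵥ v := by
  have h0 : 0 ≤ v ⬝ᵥ v := by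
    simp only [dotProduct]; exact Finset.sum_nonneg fun i _ => mul_self_nonneg _
  refine lt_of_le_of_ne h0 fun h => hv ?_
  exact dotProduct_self_eq_zero.mp h.symm

theorem normalize_mem {v : V3} (hv : v ≠ 0) : (Real.sqrt (v ⬝ᵥ v))⁻¹ • v ∈ sphereS := by
  have h := dot_self_pos' hv
  have h2 := Real.sq_sqrt h.le
  have h3 : Real.sqrt (v ⬝ᵥ v) ≠ 0 := (Real.sqrt_pos.2 h).ne'
  simp only [sphereS, mem_ofPred_eq, smul_dotProduct, dotProduct_smul, smul_eq_mul]
  field_simp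
  linarith

theorem sphere_ne_zero {v : V3} (hv : v ∈ sphereS) : v ≠ 0 := by
  rintro rfl
  simp [sphereS] at hv

theorem continuous_dot : Continuous fun p : V3 × V3 => p.1 ⬝ᵥ p.2 := by
  simp only [dotProduct]
  fun_prop

theorem ContinuousOn.dot3 {E : Type*} [TopologicalSpace E] {f g : E → V3} {s : Set E}
    (hf : ContinuousOn f s) (hg : ContinuousOn g s) :
    ContinuousOn (fun x => f x ⬝ᵥ g x) s :=
  continuous_dot.comp_continuousOn (hf.prodMk hg)

/-- Homotopy extension for sphere-valued maps. -/
theorem hepS {E : Type} [MetricSpace E] {X A : Set E} (hX : IsCompact X)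
    (hA : IsClosed A) (_hAX : A ⊆ X)
    {f : E → V3} (hf : ContinuousOn f X) (f0 : ∀ x ∈ X, f x ∈ sphereS)
    {h : ℝ × E → V3} (hh : ContinuousOn h (Icc (0:ℝ) 1 ×ˢ A))
    (h0 : ∀ t ∈ Icc (0:ℝ) 1, ∀ x ∈ A, h (t, x) ∈ sphereS) (hhf : ∀ x ∈ A, h (0, x) = f x) :
    ∃ H : ℝ × E → V3, ContinuousOn H (Icc (0:ℝ) 1 ×ˢ X) ∧
      (∀ t ∈ Icc (0:ℝ) 1, ∀ x ∈ X, H (t, x) ∈ sphereS) ∧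
      (∀ t ∈ Icc (0:ℝ) 1, ∀ x ∈ A, H (t, x) = h (t, x)) ∧ ∀ x ∈ X, H (0, x) = f x := by
  obtain ⟨H, hc, hn, hA', hf'⟩ := hepNZ hX hA _hAX hf (fun x hx => sphere_ne_zero (f0 x hx)) hh
    (fun t ht x hx => sphere_ne_zero (h0 t ht x hx)) hhf
  have key : ∀ v ∈ sphereS, (Real.sqrt (v ⬝ᵥ v))⁻¹ • v = v := by
    intro v hv
    have : v ⬝ᵥ v = 1 := hv
    simp [this]
  refine ⟨fun p => (Real.sqrt (H p ⬝ᵥ H p))⁻¹ • H p, ?_, ?_, ?_, ?_⟩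
  · refine ContinuousOn.smul (f := fun p => (Real.sqrt (H p ⬝ᵥ H p))⁻¹)
      (ContinuousOn.inv₀ (f := fun p => Real.sqrt (H p ⬝ᵥ H p)) ?_ ?_) hc
    · exact Real.continuous_sqrt.comp_continuousOn (hc.dot3 hc)
    · intro p hp
      exact (Real.sqrt_pos.2 (dot_self_pos' (hn p.1 hp.1 p.2 hp.2))).ne'
  · intro t ht x hx
    exact normalize_mem (hn t ht x hx)
  · intro t ht x hx
    simp only [hA' t ht x hx]
    exact key _ (h0 t ht x hx)
  · intro x hx
    simp only [hf' x hx]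
    exact key _ (f0 x hx)

/-- Continuity can be tested after a compact parameterization. -/
theorem contOn_image_of_comp {K E Y : Type*} [TopologicalSpace K] [TopologicalSpace E]
    [T2Space E] [TopologicalSpace Y] {S : Set K} (hS : IsCompact S) {q : K → E}
    (hq : ContinuousOn q S) {f : E → Y} {g : K → Y} (hg : ContinuousOn g S)
    (hfg : ∀ k ∈ S, f (q k) = g k) : ContinuousOn f (q '' S) := by
  rw [continuousOn_iff_isClosed]
  intro t ht
  obtain ⟨u, hu, hu'⟩ := (continuousOn_iff_isClosed.1 hg) t ht
  refine ⟨q '' (u ∩ S), ?_, ?_⟩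
  · exact ((hS.inter_left hu).image_of_continuousOn (hq.mono inter_subset_right)).isClosed
  · rw [← hu']
    ext y
    constructor
    · rintro ⟨hy, ⟨k, hk, rfl⟩⟩
      refine ⟨⟨k, ⟨?_, hk⟩, rfl⟩, ⟨k, hk, rfl⟩⟩
      simpa [← hfg k hk] using hy
    · rintro ⟨⟨k, ⟨hk1, hk⟩, rfl⟩, h2⟩
      refine ⟨?_, h2⟩
      simpa [hfg k hk] using hk1

end

noncomputable section
open Matrix Set MeasureTheory
open scoped Classical Quaternion

theorem exists_step {E Y : Type} [NormedAddCommGroup E] [NormedSpace ℝ E] [NormedAddCommGroup Y]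
    {X : Set E} (hX : IsCompact X) (hc : Convex ℝ X) {x0 : E} (hx0 : x0 ∈ X)
    {f : E → Y} (hf : ContinuousOn f X) {ε : ℝ} (hε : 0 < ε) :
    ∃ N : ℕ, 0 < N ∧ ∀ x ∈ X, ∀ j < N,
      ‖f (x0 + ((j + 1 : ℕ) / N : ℝ) • (x - x0)) - f (x0 + ((j : ℕ) / N : ℝ) • (x - x0))‖ < ε := by
  have hu := hX.uniformContinuousOn_of_continuous hf
  rw [Metric.uniformContinuousOn_iff] at hu
  obtain ⟨d, hd, hu⟩ := hu ε hε
  obtain ⟨R, hR0, hR⟩ := hX.isBounded.subset_closedBall_lt 0 x0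
  obtain ⟨N, hN⟩ := exists_nat_gt (R / d)
  have hNpos : (0:ℝ) < N := lt_of_le_of_lt (by positivity) hN
  refine ⟨N, by exact_mod_cast hNpos, fun x hx j hj => ?_⟩
  have mem : ∀ k : ℕ, k ≤ N → x0 + ((k : ℕ) / N : ℝ) • (x - x0) ∈ X := by
    intro k hk
    have hk' : (k:ℝ) ≤ N := by exact_mod_cast hk
    exact hc.add_smul_sub_mem hx0 hx ⟨by positivity, by rw [div_le_one hNpos]; exact hk'⟩
  rw [← dist_eq_norm]
  apply hu _ (mem (j+1) hj) _ (mem j hj.le)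
  rw [dist_eq_norm, add_sub_add_left_eq_sub, ← sub_smul, norm_smul]
  have h1 : ((j + 1 : ℕ) / N : ℝ) - (j : ℕ) / N = 1 / N := by push_cast; field_simp; ring
  rw [h1, Real.norm_of_nonneg (by positivity)]
  have h2 : ‖x - x0‖ ≤ R := by rw [← dist_eq_norm]; exact hR hx
  calc 1 / (N:ℝ) * ‖x - x0‖ ≤ 1 / N * R := by gcongr
    _ < d := by rw [div_lt_iff₀ hd] at hN; rw [one_div, inv_mul_lt_iff₀ hNpos]; exact hN

theorem contOn_step {E Y : Type} [NormedAddCommGroup E] [NormedSpace ℝ E] [NormedAddCommGroup Y]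
    {X : Set E} (hc : Convex ℝ X) {x0 : E} (hx0 : x0 ∈ X)
    {f : E → Y} (hf : ContinuousOn f X) {r : ℝ} (hr : r ∈ Icc (0:ℝ) 1) :
    ContinuousOn (fun x => f (x0 + r • (x - x0))) X := by
  refine hf.comp (by fun_prop) fun x hx => hc.add_smul_sub_mem hx0 hx hr

/-- Continuous logarithm on compact convex sets. -/
theorem exists_log {E : Type} [NormedAddCommGroup E] [NormedSpace ℝ E]
    {X : Set E} (hX : IsCompact X) (hc : Convex ℝ X)
    {f : E → ℂ} (hf : ContinuousOn f X) (f0 : ∀ x ∈ X, f x ≠ 0) :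
    ∃ g : E → ℂ, ContinuousOn g X ∧ ∀ x ∈ X, Complex.exp (g x) = f x := by
  rcases X.eq_empty_or_nonempty with rfl | ⟨x0, hx0⟩
  · exact ⟨0, by simp, by simp⟩
  obtain ⟨xm, hxm, hmin⟩ := hX.exists_isMinOn ⟨x0, hx0⟩ hf.norm
  have hm : 0 < ‖f xm‖ := norm_pos_iff.2 (f0 xm hxm)
  obtain ⟨N, hN, hstep⟩ := exists_step hX hc hx0 hf hm
  have hN' : (0:ℝ) < N := by exact_mod_cast hN
  have hr : ∀ k : ℕ, k ≤ N → (k / N : ℝ) ∈ Icc (0:ℝ) 1 := fun k hk =>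
    ⟨by positivity, by rw [div_le_one hN']; exact_mod_cast hk⟩
  have mem : ∀ k : ℕ, k ≤ N → ∀ x ∈ X, x0 + (k / N : ℝ) • (x - x0) ∈ X := fun k hk x hx =>
    hc.add_smul_sub_mem hx0 hx (hr k hk)
  have key : ∀ k : ℕ, k ≤ N → ∃ g : E → ℂ, ContinuousOn g X ∧
      ∀ x ∈ X, Complex.exp (g x) = f (x0 + (k / N : ℝ) • (x - x0)) := by
    intro k
    induction k with
    | zero =>
      intro _
      refine ⟨fun _ => Complex.log (f x0), continuousOn_const, fun x hx => ?_⟩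
      simp [Complex.exp_log (f0 x0 hx0)]
    | succ k ih =>
      intro hk
      obtain ⟨g, hg, hge⟩ := ih (by omega)
      have nz : ∀ x ∈ X, f (x0 + (k / N : ℝ) • (x - x0)) ≠ 0 := fun x hx =>
        f0 _ (mem k (by omega) x hx)
      set q : E → ℂ := fun x => f (x0 + ((k+1:ℕ) / N : ℝ) • (x - x0)) /
        f (x0 + (k / N : ℝ) • (x - x0)) with hq
      have hqc : ContinuousOn q X := by
        exact (contOn_step hc hx0 hf (hr _ hk)).div (contOn_step hc hx0 hf (hr k (by omega))) nz
      have hqs : ∀ x ∈ X, q x ∈ Complex.slitPlane := by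
        intro x hx
        have h1 := hstep x hx k (by omega)
        have h2 : ‖f xm‖ ≤ ‖f (x0 + (k / N : ℝ) • (x - x0))‖ := hmin (mem k (by omega) x hx)
        have h3 : ‖q x - 1‖ < 1 := by
          have : q x - 1 = (f (x0 + ((k+1:ℕ) / N : ℝ) • (x - x0)) -
            f (x0 + (k / N : ℝ) • (x - x0))) / f (x0 + (k / N : ℝ) • (x - x0)) := by
            simp only [hq]; rw [sub_div, div_self (nz x hx)]
          rw [this, norm_div, div_lt_one (norm_pos_iff.2 (nz x hx))]
          exact h1.trans_le h2
        left
        have h4 := (Complex.abs_re_le_norm (q x - 1)).trans_lt h3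
        rw [Complex.sub_re, Complex.one_re, abs_lt] at h4
        linarith [h4.1]
      refine ⟨fun x => g x + Complex.log (q x), hg.add (hqc.clog hqs), fun x hx => ?_⟩
      rw [Complex.exp_add, hge x hx, Complex.exp_log (Complex.slitPlane_ne_zero (hqs x hx))]
      simp only [hq]
      rw [mul_div_cancel₀ _ (nz x hx)]
  obtain ⟨g, hg, hge⟩ := key N le_rfl
  refine ⟨g, hg, fun x hx => ?_⟩
  rw [hge x hx, div_self hN'.ne', one_smul, add_sub_cancel]

/-- The quaternion unit `i`. -/
def qI : ℍ[ℝ] := ⟨0, 1, 0, 0⟩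
def qJ : ℍ[ℝ] := ⟨0, 0, 1, 0⟩

@[simp] theorem qI_re : qI.re = 0 := rfl
@[simp] theorem qI_imI : qI.imI = 1 := rfl
@[simp] theorem qI_imJ : qI.imJ = 0 := rfl
@[simp] theorem qI_imK : qI.imK = 0 := rfl
@[simp] theorem qJ_re : qJ.re = 0 := rfl
@[simp] theorem qJ_imI : qJ.imI = 0 := rfl
@[simp] theorem qJ_imJ : qJ.imJ = 1 := rfl
@[simp] theorem qJ_imK : qJ.imK = 0 := rfl

theorem qI_sq : qI * qI = -1 := by
  ext <;> simp

theorem qJ_ne : qJ ≠ 0 := fun h => by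
  have := congrArg (fun q : ℍ[ℝ] => q.imJ) h
  simp at this

theorem qstep {p q U : ℍ[ℝ]} (hp : p * p = -1) (hq : q * q = -1) (hU : p * U = U * qI) :
    q * ((1 - q * p) * U) = ((1 - q * p) * U) * qI := by
  have h1 : q * (1 - q * p) = (1 - q * p) * p := by
    rw [mul_sub, sub_mul, mul_one, one_mul, ← mul_assoc, hq, mul_assoc, hp]
    simp [add_comm]
  rw [← mul_assoc, h1, mul_assoc, hU, ← mul_assoc]

theorem norm_of_sq {p : ℍ[ℝ]} (hp : p * p = -1) : ‖p‖ = 1 := by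
  have : ‖p‖ * ‖p‖ = 1 := by rw [← norm_mul, hp, norm_neg, norm_one]
  nlinarith [norm_nonneg p]

theorem qstep_ne {p q : ℍ[ℝ]} (hp : p * p = -1) (h : ‖q - p‖ < 2) :
    (1 - q * p) ≠ 0 := by
  intro h0
  have h1 : q * p = 1 := (sub_eq_zero.1 h0).symm
  have h2 : q = -p := by
    have : q * p * p = p := by rw [h1, one_mul]
    rw [mul_assoc, hp] at this
    rw [← this]; simp
  rw [h2] at h
  have : ‖-p - p‖ = 2 := by
    have : -p - p = (-2 : ℝ) • p := by rw [neg_smul, two_smul]; abel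
    rw [this, norm_smul, norm_of_sq hp]; norm_num
  linarith

/-- Lifting of `S²`-valued maps through the Hopf map. -/
theorem exists_hopf {E : Type} [NormedAddCommGroup E] [NormedSpace ℝ E]
    {X : Set E} (hX : IsCompact X) (hc : Convex ℝ X)
    {f : E → ℍ[ℝ]} (hf : ContinuousOn f X) (f0 : ∀ x ∈ X, f x * f x = -1) :
    ∃ U : E → ℍ[ℝ], ContinuousOn U X ∧ ∀ x ∈ X, U x ≠ 0 ∧ f x * U x = U x * qI := by
  rcases X.eq_empty_or_nonempty with rfl | ⟨x0, hx0⟩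
  · exact ⟨0, by simp, by simp⟩
  obtain ⟨N, hN, hstep⟩ := exists_step hX hc hx0 hf (ε := 2) (by norm_num)
  have hN' : (0:ℝ) < N := by exact_mod_cast hN
  have hr : ∀ k : ℕ, k ≤ N → (k / N : ℝ) ∈ Icc (0:ℝ) 1 := fun k hk =>
    ⟨by positivity, by rw [div_le_one hN']; exact_mod_cast hk⟩
  have mem : ∀ k : ℕ, k ≤ N → ∀ x ∈ X, x0 + (k / N : ℝ) • (x - x0) ∈ X := fun k hk x hx =>
    hc.add_smul_sub_mem hx0 hx (hr k hk)
  have base : ∃ c : ℍ[ℝ], c ≠ 0 ∧ f x0 * c = c * qI := by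
    by_cases h : 1 - f x0 * qI = 0
    · have h1 : f x0 * qI = 1 := (sub_eq_zero.1 h).symm
      have h2 : f x0 = -qI := by
        have : f x0 * qI * qI = qI := by rw [h1, one_mul]
        rw [mul_assoc, qI_sq] at this
        rw [← this]; simp
      refine ⟨qJ, ?_, ?_⟩
      · exact qJ_ne
      · rw [h2]
        ext <;> simp
    · refine ⟨1 - f x0 * qI, h, ?_⟩
      have := qstep (p := qI) (q := f x0) (U := 1) qI_sq (f0 x0 hx0) (by simp)
      simpa using this
  have key : ∀ k : ℕ, k ≤ N → ∃ U : E → ℍ[ℝ], ContinuousOn U X ∧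
      ∀ x ∈ X, U x ≠ 0 ∧ f (x0 + (k / N : ℝ) • (x - x0)) * U x = U x * qI := by
    intro k
    induction k with
    | zero =>
      intro _
      obtain ⟨c, hc0, hc1⟩ := base
      refine ⟨fun _ => c, continuousOn_const, fun x hx => ⟨hc0, ?_⟩⟩
      simpa using hc1
    | succ k ih =>
      intro hk
      obtain ⟨g, hg, hge⟩ := ih (by omega)
      refine ⟨fun x => (1 - f (x0 + ((k+1:ℕ) / N : ℝ) • (x - x0)) *
        f (x0 + (k / N : ℝ) • (x - x0))) * g x, ?_, fun x hx => ⟨?_, ?_⟩⟩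
      · refine (continuousOn_const.sub ?_).mul hg
        exact (contOn_step hc hx0 hf (hr _ hk)).mul (contOn_step hc hx0 hf (hr k (by omega)))
      · refine mul_ne_zero ?_ (hge x hx).1
        exact qstep_ne (f0 _ (mem k (by omega) x hx)) (hstep x hx k (by omega))
      · exact qstep (f0 _ (mem k (by omega) x hx)) (f0 _ (mem (k+1) hk x hx)) (hge x hx).2
  obtain ⟨g, hg, hge⟩ := key N le_rfl
  refine ⟨g, hg, fun x hx => ?_⟩
  have := hge x hx
  rwa [div_self hN'.ne', one_smul, add_sub_cancel] at this

instance : TietzeExtension.{0, 0} ℍ[ℝ] := TietzeExtension.of_tvs ℝ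

/-- A nowhere zero quaternion-valued map on a compact null set of `ℝ × ℂ` extends. -/
theorem extend_null {A X : Set (ℝ × ℂ)} (hA : IsCompact A) (hX : IsCompact X) (hAX : A ⊆ X)
    (hnull : volume A = 0) {φ : ℝ × ℂ → ℍ[ℝ]} (hφ : ContinuousOn φ A)
    (φ0 : ∀ x ∈ A, φ x ≠ 0) :
    ∃ Φ : ℝ × ℂ → ℍ[ℝ], ContinuousOn Φ X ∧ (∀ x ∈ X, Φ x ≠ 0) ∧ EqOn Φ φ A := by
  rcases A.eq_empty_or_nonempty with rfl | hne
  · exact ⟨fun _ => 1, continuousOn_const, by simp, by simp⟩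
  obtain ⟨xm, hxm, hmin⟩ := hA.exists_isMinOn hne hφ.norm
  have hm : 0 < ‖φ xm‖ := norm_pos_iff.2 (φ0 xm hxm)
  obtain ⟨φ', hφ', hφe⟩ := tietzeOn hA.isClosed hφ
  obtain ⟨ψ, hψ, hψd, -⟩ := hφ'.exists_contDiff_approx 1 (ε := fun _ => ‖φ xm‖)
    continuous_const (fun _ => hm)
  have hclose : ∀ x ∈ A, ‖ψ x - φ x‖ < ‖φ x‖ := fun x hx => by
    have := hψd x
    rw [hφe hx, dist_eq_norm] at this
    exact this.trans_le (hmin hx)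
  have hseg : ∀ x ∈ A, ∀ t ∈ Icc (0:ℝ) 1, φ x + t • (ψ x - φ x) ≠ 0 := by
    intro x hx t ht h0
    have h1 : φ x = -(t • (ψ x - φ x)) := eq_neg_of_add_eq_zero_left h0
    have h2 : ‖φ x‖ = t * ‖ψ x - φ x‖ := by
      conv_lhs => rw [h1]
      rw [norm_neg, norm_smul, Real.norm_of_nonneg ht.1]
    have := hclose x hx
    nlinarith [ht.1, ht.2, norm_nonneg (ψ x - φ x)]
  -- a ray missed by `ψ`
  have hfr : Module.finrank ℝ ℍ[ℝ] = Module.finrank ℝ (ℝ × (ℝ × ℂ)) := by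
    simp [Quaternion.finrank_eq_four]
  set e : ℍ[ℝ] ≃L[ℝ] (ℝ × (ℝ × ℂ)) := ContinuousLinearEquiv.ofFinrankEq hfr
  set Ψ : ℝ × (ℝ × ℂ) → ℝ × (ℝ × ℂ) := fun p => e (p.1 • ψ p.2)
  have hΨ : Differentiable ℝ Ψ := by
    have : Differentiable ℝ ψ := hψ.differentiable (by simp)
    exact e.differentiable.comp (by fun_prop)
  have hS : volume ((univ : Set ℝ) ×ˢ A) = 0 := by
    rw [Measure.volume_eq_prod, Measure.prod_prod, hnull, mul_zero]
  have h2 : (volume : Measure (ℝ × ℂ)).IsAddHaarMeasure :=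
    Measure.prod.instIsAddHaarMeasure volume volume
  have h3 : (volume : Measure (ℝ × (ℝ × ℂ))).IsAddHaarMeasure :=
    Measure.prod.instIsAddHaarMeasure volume volume
  have himg := addHaar_image_eq_zero_of_differentiableOn_of_addHaar_eq_zero volume
    hΨ.differentiableOn hS
  obtain ⟨y', hy'⟩ : ∃ y', y' ∉ Ψ '' ((univ : Set ℝ) ×ˢ A) := by
    by_contra! hall
    rw [eq_univ_of_forall hall] at himg
    exact (Measure.measure_univ_pos.2 (NeZero.ne _)).ne' himg
  set y := e.symm y'
  have hy : ∀ x ∈ A, ∀ r : ℝ, y ≠ r • ψ x := by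
    intro x hx r h
    apply hy'
    exact ⟨(r, x), ⟨mem_univ _, hx⟩, by simp only [Ψ]; rw [← h]; simp [y]⟩
  have hy0 : y ≠ 0 := by
    obtain ⟨x, hx⟩ := hne
    simpa using hy x hx 0
  have hψc := hψ.continuous
  obtain ⟨H, hH, hH0, hHA, -⟩ := hepNZ (f := fun _ => -y) hX hA.isClosed hAX continuousOn_const
    (fun _ _ => neg_ne_zero.2 hy0) (h := fun p => -y + p.1 • (ψ p.2 + y))
    (by fun_prop) (by
      intro t ht x hx h0
      rcases eq_or_ne t 0 with rfl | ht0
      · simp [hy0] at h0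
      rcases eq_or_ne t 1 with rfl | ht1
      · simp only [one_smul, neg_add_cancel_comm_assoc] at h0
        exact hseg x hx 1 (by simp) (by simp [h0])
      have h1t : (1 - t) ≠ 0 := sub_ne_zero.2 ht1.symm
      apply hy x hx (t / (1 - t))
      have : (1 - t) • y = t • ψ x := by
        rw [smul_add] at h0
        have h0' : t • ψ x - (1 - t) • y = 0 := by rw [← h0, sub_smul, one_smul]; abel
        exact (sub_eq_zero.1 h0').symm
      rw [div_eq_inv_mul, mul_smul, ← this, smul_smul, inv_mul_cancel₀ h1t, one_smul])
    (fun x hx => by simp)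
  obtain ⟨G, hG, hG0, hGA, -⟩ := hepNZ (f := fun x => H (1, x)) hX hA.isClosed hAX
    (hH.comp (by fun_prop) fun x hx => ⟨by simp, hx⟩) (fun x hx => hH0 1 (by simp) x hx)
    (h := fun p => φ p.2 + (1 - p.1) • (ψ p.2 - φ p.2))
    (by
      have : ContinuousOn (fun p : ℝ × (ℝ × ℂ) => φ p.2) (Icc (0:ℝ) 1 ×ˢ A) :=
        hφ.comp continuousOn_snd fun p hp => hp.2
      fun_prop)
    (by
      intro t ht x hx
      exact hseg x hx (1 - t) ⟨by linarith [ht.2], by linarith [ht.1]⟩)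
    (by
      intro x hx
      rw [hHA 1 (by simp) x hx]
      simp)
  refine ⟨fun x => G (1, x), hG.comp (by fun_prop) fun x hx => ⟨by simp, hx⟩,
    fun x hx => hG0 1 (by simp) x hx, fun x hx => ?_⟩
  simp [hGA 1 (by simp) x hx]

end

noncomputable section
open Matrix Set MeasureTheory
open scoped Classical Quaternion

def qK : ℍ[ℝ] := ⟨0, 0, 0, 1⟩
@[simp] theorem qK_re : qK.re = 0 := rfl
@[simp] theorem qK_imI : qK.imI = 0 := rfl
@[simp] theorem qK_imJ : qK.imJ = 0 := rfl
@[simp] theorem qK_imK : qK.imK = 1 := rfl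

/-- Vectors as imaginary quaternions. -/
def qv (x : V3) : ℍ[ℝ] := x 2 • qI + x 0 • qJ + x 1 • qK
@[simp] theorem qv_re (x : V3) : (qv x).re = 0 := by simp [qv]
@[simp] theorem qv_imI (x : V3) : (qv x).imI = x 2 := by simp [qv]
@[simp] theorem qv_imJ (x : V3) : (qv x).imJ = x 0 := by simp [qv]
@[simp] theorem qv_imK (x : V3) : (qv x).imK = x 1 := by simp [qv]

def vq (q : ℍ[ℝ]) : V3 := ![q.imJ, q.imK, q.imI]

theorem continuous_qv : Continuous qv := by unfold qv; fun_prop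

theorem continuous_vq : Continuous vq := by
  unfold vq
  refine continuous_pi fun i => ?_
  fin_cases i
  · exact Quaternion.continuous_imJ
  · exact Quaternion.continuous_imK
  · exact Quaternion.continuous_imI

theorem vq_qv (x : V3) : vq (qv x) = x := by
  ext i; fin_cases i <;> simp [vq]

theorem qv_vq {q : ℍ[ℝ]} (h : q.re = 0) : qv (vq q) = q := by
  ext <;> simp [vq, h]

theorem mem_sphereS {x : V3} : x ∈ sphereS ↔ x 0 ^ 2 + x 1 ^ 2 + x 2 ^ 2 = 1 := by
  simp only [sphereS, mem_ofPred_eq, dotProduct, Fin.sum_univ_three, sq]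

theorem qv_sq {x : V3} (hx : x ∈ sphereS) : qv x * qv x = -1 := by
  rw [mem_sphereS] at hx
  ext <;> simp
  · linarith
  · ring
  · ring
  · ring

theorem re_zero_of_sq {q : ℍ[ℝ]} (h : q * q = -1) : q.re = 0 := by
  have h0 := congrArg (fun q : ℍ[ℝ] => q.re) h
  have h1 := congrArg (fun q : ℍ[ℝ] => q.imI) h
  have h2 := congrArg (fun q : ℍ[ℝ] => q.imJ) h
  have h3 := congrArg (fun q : ℍ[ℝ] => q.imK) h
  simp at h0 h1 h2 h3
  by_contra hr
  have e1 : q.imI = 0 := by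
    have : q.re * q.imI = 0 := by linarith
    simpa [hr] using this
  have e2 : q.imJ = 0 := by
    have : q.re * q.imJ = 0 := by linarith
    simpa [hr] using this
  have e3 : q.imK = 0 := by
    have : q.re * q.imK = 0 := by linarith
    simpa [hr] using this
  rw [e1, e2, e3] at h0
  nlinarith [sq_nonneg q.re]

/-- The Hopf action `U ↦ U i U⁻¹`. -/
def act (U : ℍ[ℝ]) : V3 := vq (U * qI * U⁻¹)

theorem conj_sq {U : ℍ[ℝ]} (hU : U ≠ 0) : (U * qI * U⁻¹) * (U * qI * U⁻¹) = -1 := by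
  have : (U * qI * U⁻¹) * (U * qI * U⁻¹) = U * (qI * (U⁻¹ * U) * qI) * U⁻¹ := by
    simp only [mul_assoc]
  rw [this, inv_mul_cancel₀ hU, mul_one, qI_sq]
  simp [hU]

theorem act_mem {U : ℍ[ℝ]} (hU : U ≠ 0) : act U ∈ sphereS := by
  have h := conj_sq hU
  have hr := re_zero_of_sq h
  have h0 := congrArg (fun q : ℍ[ℝ] => q.re) h
  simp only [Quaternion.re_mul, hr, Quaternion.re_neg, Quaternion.re_one] at h0
  rw [mem_sphereS]
  simp only [act, vq]
  simp only [Matrix.cons_val_zero, Matrix.cons_val_one, Matrix.cons_val]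
  linarith

theorem act_of {U : ℍ[ℝ]} {x : V3} (hU : U ≠ 0) (h : qv x * U = U * qI) : act U = x := by
  rw [act, ← h, mul_assoc, mul_inv_cancel₀ hU, mul_one, vq_qv]

theorem qv_act {U : ℍ[ℝ]} (hU : U ≠ 0) : qv (act U) = U * qI * U⁻¹ :=
  qv_vq (re_zero_of_sq (conj_sq hU))

theorem ContinuousOn.act {E : Type*} [TopologicalSpace E] {s : Set E} {U : E → ℍ[ℝ]}
    (hU : ContinuousOn U s) (h0 : ∀ x ∈ s, U x ≠ 0) : ContinuousOn (fun x => act (U x)) s := by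
  unfold _root_.act
  exact continuous_vq.comp_continuousOn ((hU.mul continuousOn_const).mul (hU.inv₀ h0))

def zc (q : ℍ[ℝ]) : ℂ := ⟨q.re, q.imI⟩
def cz (c : ℂ) : ℍ[ℝ] := c.re • 1 + c.im • qI
@[simp] theorem cz_re (x : ℂ) : (cz x).re = x.re := by simp [cz]
@[simp] theorem cz_imI (x : ℂ) : (cz x).imI = x.im := by simp [cz]
@[simp] theorem cz_imJ (x : ℂ) : (cz x).imJ = 0 := by simp [cz]
@[simp] theorem cz_imK (x : ℂ) : (cz x).imK = 0 := by simp [cz]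
theorem zc_cz (c : ℂ) : zc (cz c) = c := by simp [zc]
theorem cz_mul (a b : ℂ) : cz (a * b) = cz a * cz b := by
  ext <;> simp
theorem cz_one : cz 1 = 1 := by ext <;> simp
theorem cz_ne {a : ℂ} (ha : a ≠ 0) : cz a ≠ 0 := fun h => ha (by rw [← zc_cz a, h]; rfl)
theorem continuous_cz : Continuous cz := by
  unfold cz
  fun_prop
theorem continuous_zc : Continuous zc := by
  have : zc = fun q => (q.re : ℂ) + q.imI * Complex.I := by
    ext q; simp [zc, Complex.ext_iff]
  rw [this]
  have h1 := Quaternion.continuous_re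
  have h2 := Quaternion.continuous_imI
  fun_prop

theorem cz_comm (a : ℂ) : cz a * qI = qI * cz a := by ext <;> simp

theorem act_mul_cz {U : ℍ[ℝ]} (hU : U ≠ 0) {a : ℂ} (ha : a ≠ 0) : act (U * cz a) = act U := by
  apply act_of (mul_ne_zero hU (cz_ne ha))
  rw [qv_act hU]
  simp only [mul_assoc]
  rw [cz_comm, inv_mul_cancel_left₀ hU]

theorem eq_mul_cz {U U' : ℍ[ℝ]} (hU : U ≠ 0) (hU' : U' ≠ 0) (h : act U = act U') :
    zc (U⁻¹ * U') ≠ 0 ∧ U' = U * cz (zc (U⁻¹ * U')) := by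
  have h1 : U * qI * U⁻¹ = U' * qI * U'⁻¹ := by rw [← qv_act hU, ← qv_act hU', h]
  set q := U⁻¹ * U' with hq
  have hc : q * qI = qI * q := by
    have h2 : U⁻¹ * (U * qI * U⁻¹) * U' = U⁻¹ * (U' * qI * U'⁻¹) * U' := by rw [h1]
    simp only [mul_assoc] at h2
    rw [inv_mul_cancel_left₀ hU, inv_mul_cancel₀ hU', mul_one] at h2
    rw [hq, mul_assoc, h2]
  have hJ : q.imJ = 0 := by
    have := congrArg (fun q : ℍ[ℝ] => q.imK) hc
    simp at this
    linarith
  have hK : q.imK = 0 := by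
    have := congrArg (fun q : ℍ[ℝ] => q.imJ) hc
    simp at this
    linarith
  have hcz : cz (zc q) = q := by ext <;> simp [zc, hJ, hK]
  refine ⟨fun h0 => ?_, ?_⟩
  · rw [h0] at hcz
    have : q = 0 := by rw [← hcz]; ext <;> simp
    exact mul_ne_zero (inv_ne_zero hU) hU' this
  · rw [hcz, hq, mul_inv_cancel_left₀ hU]

/-! ### Winding numbers on the circle -/

def HasWind (lam : ℂ → ℂ) (k : ℤ) : Prop :=
  ∃ g : ℝ → ℂ, ContinuousOn g (Icc 0 (2 * Real.pi)) ∧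
    (∀ φ ∈ Icc 0 (2 * Real.pi), Complex.exp (g φ) = lam (Complex.exp (φ * Complex.I))) ∧
    g (2 * Real.pi) = g 0 + k * (2 * Real.pi * Complex.I)

theorem exp_mem_circle (φ : ℝ) : Complex.exp (φ * Complex.I) ∈ Metric.sphere (0:ℂ) 1 := by
  simp [Complex.norm_exp_ofReal_mul_I]

theorem wind_exists {lam : ℂ → ℂ} (hl : ContinuousOn lam (Metric.sphere 0 1))
    (h0 : ∀ w ∈ Metric.sphere (0:ℂ) 1, lam w ≠ 0) : ∃ k, HasWind lam k := by
  obtain ⟨g, hg, hge⟩ := exists_log (isCompact_Icc (a := (0:ℝ)) (b := 2 * Real.pi))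
    (convex_Icc _ _) (f := fun φ : ℝ => lam (Complex.exp (φ * Complex.I)))
    (hl.comp (by fun_prop) fun φ _ => exp_mem_circle φ) (fun φ _ => h0 _ (exp_mem_circle φ))
  have hpi := Real.pi_pos
  have h1 : Complex.exp (g (2 * Real.pi)) = Complex.exp (g 0) := by
    rw [hge _ ⟨by positivity, le_rfl⟩, hge _ ⟨le_rfl, by positivity⟩]
    have : Complex.exp (((2 * Real.pi : ℝ) : ℂ) * Complex.I) = 1 := by
      push_cast; exact Complex.exp_two_pi_mul_I
    rw [this]; simp
  obtain ⟨k, hk⟩ := Complex.exp_eq_exp_iff_exists_int.1 h1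
  exact ⟨k, g, hg, hge, hk⟩

theorem wind_div {a b : ℂ → ℂ} {k l : ℤ} (ha : HasWind a k) (hb : HasWind b l) :
    HasWind (fun w => a w / b w) (k - l) := by
  obtain ⟨g, hg, hge, hk⟩ := ha
  obtain ⟨g', hg', hge', hk'⟩ := hb
  refine ⟨fun φ => g φ - g' φ, hg.sub hg', fun φ hφ => ?_, ?_⟩
  · rw [Complex.exp_sub, hge φ hφ, hge' φ hφ]
  · simp only [hk, hk']; push_cast; ring

theorem circle_eq_image :
    Metric.sphere (0:ℂ) 1 = (fun φ : ℝ => Complex.exp (φ * Complex.I)) ''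
      Icc 0 (2 * Real.pi) := by
  have hpi := Real.pi_pos
  ext w
  constructor
  · intro hw
    have hn : ‖w‖ = 1 := by simpa using hw
    have h1 : Complex.exp (w.arg * Complex.I) = w := by
      have := Complex.norm_mul_exp_arg_mul_I w
      rwa [hn, Complex.ofReal_one, one_mul] at this
    rcases lt_or_ge w.arg 0 with h | h
    · refine ⟨w.arg + 2 * Real.pi, ⟨by linarith [Complex.neg_pi_lt_arg w], by linarith⟩, ?_⟩
      push_cast
      rw [add_mul, Complex.exp_add, h1, Complex.exp_two_pi_mul_I, mul_one]
    · exact ⟨w.arg, ⟨h, by linarith [Complex.arg_le_pi w]⟩, h1⟩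
  · rintro ⟨φ, -, rfl⟩
    exact exp_mem_circle φ

theorem wind_zero_log {lam : ℂ → ℂ} (h : HasWind lam 0) :
    ∃ m : ℂ → ℂ, ContinuousOn m (Metric.sphere 0 1) ∧
      ∀ w ∈ Metric.sphere (0:ℂ) 1, Complex.exp (m w) = lam w := by
  obtain ⟨g, hg, hge, hk⟩ := h
  have hpi := Real.pi_pos
  have hk' : g (2 * Real.pi) = g 0 := by simpa using hk
  have hex : ∀ w ∈ Metric.sphere (0:ℂ) 1, ∃ φ ∈ Icc 0 (2 * Real.pi),
      Complex.exp (φ * Complex.I) = w := fun w hw => by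
    rw [circle_eq_image] at hw; exact hw
  have hinj : ∀ φ ∈ Icc 0 (2 * Real.pi), ∀ φ' ∈ Icc 0 (2 * Real.pi),
      Complex.exp (φ * Complex.I) = Complex.exp (φ' * Complex.I) → g φ = g φ' := by
    intro φ hφ φ' hφ' he
    obtain ⟨j, hj⟩ := Complex.exp_eq_exp_iff_exists_int.1 he
    have hj' : φ = φ' + j * (2 * Real.pi) := by
      have := congrArg Complex.im hj
      simpa using this
    have h1 : (j:ℝ) ≤ 1 := by
      by_contra hc; push Not at hc
      nlinarith [hφ.2, hφ'.1]
    have h2 : (-1:ℝ) ≤ j := by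
      by_contra hc; push Not at hc
      nlinarith [hφ.1, hφ'.2]
    have h1' : j ≤ 1 := by exact_mod_cast h1
    have h2' : -1 ≤ j := by exact_mod_cast h2
    have h3 : j = 0 ∨ j = 1 ∨ j = -1 := by omega
    rcases h3 with rfl | rfl | rfl
    · simp at hj'; rw [hj']
    · have e1 : φ = 2 * Real.pi := by push_cast at hj'; linarith [hφ.2, hφ'.1]
      have e2 : φ' = 0 := by push_cast at hj'; linarith [hφ.2, hφ'.1]
      rw [e1, e2, hk']
    · have e1 : φ' = 2 * Real.pi := by push_cast at hj'; linarith [hφ.1, hφ'.2]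
      have e2 : φ = 0 := by push_cast at hj'; linarith [hφ.1, hφ'.2]
      rw [e1, e2, hk']
  choose! F hF hFe using hex
  refine ⟨fun w => g (F w), ?_, fun w hw => ?_⟩
  · rw [circle_eq_image]
    refine contOn_image_of_comp isCompact_Icc (by fun_prop) hg fun φ hφ => ?_
    have := exp_mem_circle φ
    exact hinj _ (hF _ this) _ hφ (hFe _ this)
  · rw [hge _ (hF w hw), hFe w hw]

/-- The closed unit disc. -/
abbrev Dsk : Set ℂ := Metric.closedBall 0 1
abbrev Crc : Set ℂ := Metric.sphere 0 1

theorem crc_sub : Crc ⊆ Dsk := Metric.sphere_subset_closedBall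

theorem cyl {u0 u1 : ℂ → ℍ[ℝ]} (h0 : ContinuousOn u0 Dsk) (h1 : ContinuousOn u1 Dsk)
    (n0 : ∀ w ∈ Dsk, u0 w ≠ 0) (n1 : ∀ w ∈ Dsk, u1 w ≠ 0) {b : ℝ × ℂ → ℍ[ℝ]}
    (hb : ContinuousOn b (Icc (0:ℝ) 1 ×ˢ Crc))
    (nb : ∀ t ∈ Icc (0:ℝ) 1, ∀ w ∈ Crc, b (t, w) ≠ 0)
    (c0 : ∀ w ∈ Crc, b (0, w) = u0 w) (c1 : ∀ w ∈ Crc, b (1, w) = u1 w) :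
    ∃ Φ : ℝ × ℂ → ℍ[ℝ], ContinuousOn Φ (Icc (0:ℝ) 1 ×ˢ Dsk) ∧
      (∀ t ∈ Icc (0:ℝ) 1, ∀ w ∈ Dsk, Φ (t, w) ≠ 0) ∧
      (∀ w ∈ Dsk, Φ (0, w) = u0 w) ∧ (∀ w ∈ Dsk, Φ (1, w) = u1 w) ∧
      (∀ t ∈ Icc (0:ℝ) 1, ∀ w ∈ Crc, Φ (t, w) = b (t, w)) := by
  set A0 : Set (ℝ × ℂ) := {(0:ℝ)} ×ˢ Dsk
  set A1 : Set (ℝ × ℂ) := {(1:ℝ)} ×ˢ Dsk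
  set A2 : Set (ℝ × ℂ) := Icc (0:ℝ) 1 ×ˢ Crc
  have k0 : IsCompact A0 := isCompact_singleton.prod (isCompact_closedBall 0 1)
  have k1 : IsCompact A1 := isCompact_singleton.prod (isCompact_closedBall 0 1)
  have k2 : IsCompact A2 := isCompact_Icc.prod (isCompact_sphere 0 1)
  set φ : ℝ × ℂ → ℍ[ℝ] := fun p => if p.1 = 0 then u0 p.2 else if p.1 = 1 then u1 p.2 else b p
  have e0 : EqOn φ (fun p => u0 p.2) A0 := fun p hp => by
    have : p.1 = 0 := hp.1
    simp [φ, this]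
  have e1 : EqOn φ (fun p => u1 p.2) A1 := fun p hp => by
    have : p.1 = 1 := hp.1
    simp [φ, this]
  have e2 : EqOn φ b A2 := fun p hp => by
    simp only [φ]
    split_ifs with h h'
    · rw [← c0 _ hp.2, ← h]
    · rw [← c1 _ hp.2, ← h']
    · rfl
  have hφ : ContinuousOn φ (A0 ∪ A1 ∪ A2) := by
    refine ContinuousOn.union_of_isClosed (ContinuousOn.union_of_isClosed ?_ ?_ k0.isClosed
      k1.isClosed) (hb.congr e2) (k0.union k1).isClosed k2.isClosed
    · exact (h0.comp continuousOn_snd fun p hp => hp.2).congr e0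
    · exact (h1.comp continuousOn_snd fun p hp => hp.2).congr e1
  have z0 : volume A0 = 0 := by
    rw [Measure.volume_eq_prod, Measure.prod_prod]; simp
  have z1 : volume A1 = 0 := by
    rw [Measure.volume_eq_prod, Measure.prod_prod]; simp
  have z2 : volume A2 = 0 := by
    rw [Measure.volume_eq_prod, Measure.prod_prod, Measure.addHaar_sphere, mul_zero]
  obtain ⟨Φ, hΦ, hΦ0, hΦe⟩ := extend_null (X := Icc (0:ℝ) 1 ×ˢ Dsk) ((k0.union k1).union k2)
    (isCompact_Icc.prod (isCompact_closedBall 0 1)) (by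
      rintro ⟨t, w⟩ ((⟨h, h'⟩ | ⟨h, h'⟩) | ⟨h, h'⟩)
      · have : t = 0 := h
        exact ⟨by simp [this], h'⟩
      · have : t = 1 := h
        exact ⟨by simp [this], h'⟩
      · exact ⟨h, crc_sub h'⟩)
    (measure_union_null (measure_union_null z0 z1) z2) hφ (by
      rintro p ((hp | hp) | hp)
      · rw [e0 hp]; exact n0 _ hp.2
      · rw [e1 hp]; exact n1 _ hp.2
      · rw [e2 hp]; exact nb _ hp.1 _ hp.2)
  refine ⟨Φ, hΦ, fun t ht w hw => hΦ0 _ ⟨ht, hw⟩, fun w hw => ?_, fun w hw => ?_,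
    fun t ht w hw => ?_⟩
  · have : ((0:ℝ), w) ∈ A0 := ⟨rfl, hw⟩
    rw [hΦe (Or.inl (Or.inl this)), e0 this]
  · have : ((1:ℝ), w) ∈ A1 := ⟨rfl, hw⟩
    rw [hΦe (Or.inl (Or.inr this)), e1 this]
  · have : (t, w) ∈ A2 := ⟨ht, hw⟩
    rw [hΦe (Or.inr this), e2 this]

/-- Any two nowhere zero disc maps are joined by a homotopy. -/
theorem cyl0 {u0 u1 : ℂ → ℍ[ℝ]} (h0 : ContinuousOn u0 Dsk) (h1 : ContinuousOn u1 Dsk)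
    (n0 : ∀ w ∈ Dsk, u0 w ≠ 0) (n1 : ∀ w ∈ Dsk, u1 w ≠ 0) :
    ∃ Φ : ℝ × ℂ → ℍ[ℝ], ContinuousOn Φ (Icc (0:ℝ) 1 ×ˢ Dsk) ∧
      (∀ t ∈ Icc (0:ℝ) 1, ∀ w ∈ Dsk, Φ (t, w) ≠ 0) ∧
      (∀ w ∈ Dsk, Φ (0, w) = u0 w) ∧ (∀ w ∈ Dsk, Φ (1, w) = u1 w) := by
  set A0 : Set (ℝ × ℂ) := {(0:ℝ)} ×ˢ Dsk
  set A1 : Set (ℝ × ℂ) := {(1:ℝ)} ×ˢ Dsk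
  have k0 : IsCompact A0 := isCompact_singleton.prod (isCompact_closedBall 0 1)
  have k1 : IsCompact A1 := isCompact_singleton.prod (isCompact_closedBall 0 1)
  set φ : ℝ × ℂ → ℍ[ℝ] := fun p => if p.1 = 0 then u0 p.2 else u1 p.2
  have e0 : EqOn φ (fun p => u0 p.2) A0 := fun p hp => by
    have : p.1 = 0 := hp.1
    simp [φ, this]
  have e1 : EqOn φ (fun p => u1 p.2) A1 := fun p hp => by
    have : p.1 = 1 := hp.1
    simp [φ, this]
  have hφ : ContinuousOn φ (A0 ∪ A1) := by
    refine ContinuousOn.union_of_isClosed ?_ ?_ k0.isClosed k1.isClosed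
    · exact (h0.comp continuousOn_snd fun p hp => hp.2).congr e0
    · exact (h1.comp continuousOn_snd fun p hp => hp.2).congr e1
  have z0 : volume A0 = 0 := by
    rw [Measure.volume_eq_prod, Measure.prod_prod]; simp
  have z1 : volume A1 = 0 := by
    rw [Measure.volume_eq_prod, Measure.prod_prod]; simp
  obtain ⟨Φ, hΦ, hΦ0, hΦe⟩ := extend_null (X := Icc (0:ℝ) 1 ×ˢ Dsk) (k0.union k1)
    (isCompact_Icc.prod (isCompact_closedBall 0 1)) (by
      rintro ⟨t, w⟩ (⟨h, h'⟩ | ⟨h, h'⟩)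
      · have : t = 0 := h
        exact ⟨by simp [this], h'⟩
      · have : t = 1 := h
        exact ⟨by simp [this], h'⟩)
    (measure_union_null z0 z1) hφ (by
      rintro p (hp | hp)
      · rw [e0 hp]; exact n0 _ hp.2
      · rw [e1 hp]; exact n1 _ hp.2)
  refine ⟨Φ, hΦ, fun t ht w hw => hΦ0 _ ⟨ht, hw⟩, fun w hw => ?_, fun w hw => ?_⟩
  · have : ((0:ℝ), w) ∈ A0 := ⟨rfl, hw⟩
    rw [hΦe (Or.inl this), e0 this]
  · have : ((1:ℝ), w) ∈ A1 := ⟨rfl, hw⟩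
    rw [hΦe (Or.inr this), e1 this]

end

noncomputable section
open Matrix Set MeasureTheory
open scoped Classical Quaternion

def pr (x : V3) : ℂ := (x 0 : ℂ) + (x 1 : ℂ) * Complex.I

theorem pr_re (x : V3) : (pr x).re = x 0 := by simp [pr]
theorem pr_im (x : V3) : (pr x).im = x 1 := by simp [pr]
theorem continuous_pr : Continuous pr := by unfold pr; fun_prop
theorem pr_normSq (x : V3) : ‖pr x‖ ^ 2 = x 0 ^ 2 + x 1 ^ 2 := by
  rw [Complex.sq_norm, Complex.normSq_apply, pr_re, pr_im]; ring
theorem pr_norm (x : V3) : ‖pr x‖ = Real.sqrt (x 0 ^ 2 + x 1 ^ 2) := by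
  rw [← pr_normSq, Real.sqrt_sq (norm_nonneg _)]

theorem pr_mem {x : V3} (hx : x ∈ sphereS) : pr x ∈ Dsk := by
  rw [mem_sphereS] at hx
  rw [Metric.mem_closedBall, dist_zero_right]
  have := pr_normSq x
  nlinarith [sq_nonneg (x 2), norm_nonneg (pr x)]

theorem pr_mem_crc {x : V3} (hx : x ∈ sphereS) (h : x 2 = 0) : pr x ∈ Crc := by
  rw [mem_sphereS, h] at hx
  rw [mem_sphere_zero_iff_norm]
  have := pr_normSq x
  nlinarith [norm_nonneg (pr x)]

def up (w : ℂ) : V3 := ![w.re, w.im, Real.sqrt (1 - ‖w‖ ^ 2)]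
def lo (w : ℂ) : V3 := ![w.re, w.im, -Real.sqrt (1 - ‖w‖ ^ 2)]

theorem continuous_up : Continuous up := by
  unfold up
  refine continuous_pi fun i => ?_
  fin_cases i
  · exact Complex.continuous_re
  · exact Complex.continuous_im
  · exact Real.continuous_sqrt.comp (by fun_prop)

theorem continuous_lo : Continuous lo := by
  unfold lo
  refine continuous_pi fun i => ?_
  fin_cases i
  · exact Complex.continuous_re
  · exact Complex.continuous_im
  · exact (Real.continuous_sqrt.comp (by fun_prop)).neg

theorem pr_up (w : ℂ) : pr (up w) = w := by
  apply Complex.ext <;> simp [pr, up]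
theorem pr_lo (w : ℂ) : pr (lo w) = w := by
  apply Complex.ext <;> simp [pr, lo]

theorem nsq (w : ℂ) : ‖w‖ ^ 2 = w.re ^ 2 + w.im ^ 2 := by
  rw [Complex.sq_norm, Complex.normSq_apply]; ring

theorem dsk_le {w : ℂ} (hw : w ∈ Dsk) : 0 ≤ 1 - ‖w‖ ^ 2 := by
  rw [Metric.mem_closedBall, dist_zero_right] at hw
  nlinarith [norm_nonneg w]

theorem up_mem {w : ℂ} (hw : w ∈ Dsk) : up w ∈ sphereS := by
  rw [mem_sphereS]
  simp only [up, Matrix.cons_val_zero, Matrix.cons_val_one, Matrix.cons_val]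
  rw [Real.sq_sqrt (dsk_le hw), nsq]; ring

theorem lo_mem {w : ℂ} (hw : w ∈ Dsk) : lo w ∈ sphereS := by
  rw [mem_sphereS]
  simp only [lo, Matrix.cons_val_zero, Matrix.cons_val_one, Matrix.cons_val]
  rw [neg_sq, Real.sq_sqrt (dsk_le hw), nsq]; ring

theorem up_pr {x : V3} (hx : x ∈ sphereS) (h : 0 ≤ x 2) : up (pr x) = x := by
  rw [mem_sphereS] at hx
  have : Real.sqrt (1 - ‖pr x‖ ^ 2) = x 2 := by
    rw [pr_normSq, show 1 - (x 0 ^ 2 + x 1 ^ 2) = x 2 ^ 2 by linarith, Real.sqrt_sq h]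
  ext i; fin_cases i <;> simp [up, pr_re, pr_im, this]

theorem lo_pr {x : V3} (hx : x ∈ sphereS) (h : x 2 ≤ 0) : lo (pr x) = x := by
  rw [mem_sphereS] at hx
  have : Real.sqrt (1 - ‖pr x‖ ^ 2) = -x 2 := by
    rw [pr_normSq, show 1 - (x 0 ^ 2 + x 1 ^ 2) = (-x 2) ^ 2 by linarith,
      Real.sqrt_sq (by linarith)]
  ext i; fin_cases i <;> simp [lo, pr_re, pr_im, this]

def glue (fu fl : ℂ → V3) (x : V3) : V3 := if 0 ≤ x 2 then fu (pr x) else fl (pr x)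

theorem glue_cont {Hu Hl : ℝ × ℂ → V3} (hu : ContinuousOn Hu (Icc (0:ℝ) 1 ×ˢ Dsk))
    (hl : ContinuousOn Hl (Icc (0:ℝ) 1 ×ˢ Dsk))
    (he : ∀ t ∈ Icc (0:ℝ) 1, ∀ w ∈ Crc, Hu (t, w) = Hl (t, w)) :
    ContinuousOn (fun q : ℝ × V3 => if 0 ≤ q.2 2 then Hu (q.1, pr q.2) else Hl (q.1, pr q.2))
      (Icc (0:ℝ) 1 ×ˢ sphereS) := by
  have hS : IsClosed sphereS :=
    isClosed_eq (continuous_dot.comp (continuous_id.prodMk continuous_id)) continuous_const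
  have c2 : Continuous fun q : ℝ × V3 => q.2 2 := by fun_prop
  have cp : Continuous fun q : ℝ × V3 => (q.1, pr q.2) :=
    continuous_fst.prodMk (continuous_pr.comp continuous_snd)
  have hB : IsClosed (Icc (0:ℝ) 1 ×ˢ sphereS) := isClosed_Icc.prod hS
  have hA1 : IsClosed ((Icc (0:ℝ) 1 ×ˢ sphereS) ∩ {q : ℝ × V3 | 0 ≤ q.2 2}) :=
    hB.inter (isClosed_le continuous_const c2)
  have hA2 : IsClosed ((Icc (0:ℝ) 1 ×ˢ sphereS) ∩ {q : ℝ × V3 | q.2 2 ≤ 0}) :=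
    hB.inter (isClosed_le c2 continuous_const)
  have h1 : ContinuousOn (fun q : ℝ × V3 => Hu (q.1, pr q.2))
      ((Icc (0:ℝ) 1 ×ˢ sphereS) ∩ {q : ℝ × V3 | 0 ≤ q.2 2}) :=
    hu.comp cp.continuousOn fun q hq => ⟨hq.1.1, pr_mem hq.1.2⟩
  have h2 : ContinuousOn (fun q : ℝ × V3 => Hl (q.1, pr q.2))
      ((Icc (0:ℝ) 1 ×ˢ sphereS) ∩ {q : ℝ × V3 | q.2 2 ≤ 0}) :=
    hl.comp cp.continuousOn fun q hq => ⟨hq.1.1, pr_mem hq.1.2⟩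
  have := ContinuousOn.union_of_isClosed (f := fun q : ℝ × V3 =>
    if 0 ≤ q.2 2 then Hu (q.1, pr q.2) else Hl (q.1, pr q.2))
    (h1.congr fun q hq => by
      have : 0 ≤ q.2 2 := hq.2
      simp [this])
    (h2.congr fun q hq => by
      have h : q.2 2 ≤ 0 := hq.2
      by_cases h' : 0 ≤ q.2 2
      · have h0 : q.2 2 = 0 := le_antisymm h h'
        simp only [h0, le_refl, if_true]
        exact he _ hq.1.1 _ (pr_mem_crc hq.1.2 h0)
      · simp [h']) hA1 hA2
  refine this.mono fun q hq => ?_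
  rcases le_total 0 (q.2 2) with h | h
  · exact Or.inl ⟨hq, h⟩
  · exact Or.inr ⟨hq, h⟩

theorem glue_contOn {fu fl : ℂ → V3} (hu : ContinuousOn fu Dsk)
    (hl : ContinuousOn fl Dsk) (he : ∀ w ∈ Crc, fu w = fl w) :
    ContinuousOn (glue fu fl) sphereS := by
  have := glue_cont (Hu := fun p => fu p.2) (Hl := fun p => fl p.2)
    (hu.comp continuousOn_snd fun p hp => hp.2) (hl.comp continuousOn_snd fun p hp => hp.2)
    (fun t _ w hw => he w hw)
  exact this.comp (f := fun x : V3 => ((0:ℝ), x)) (by fun_prop)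
    (fun x hx => ⟨by simp, hx⟩)

theorem glue_maps {fu fl : ℂ → V3} (hu : ∀ w ∈ Dsk, fu w ∈ sphereS)
    (hl : ∀ w ∈ Dsk, fl w ∈ sphereS) : MapsTo (glue fu fl) sphereS sphereS := by
  intro x hx
  unfold glue
  split_ifs
  · exact hu _ (pr_mem hx)
  · exact hl _ (pr_mem hx)

/-- `U` is a Hopf lift of `f` on the disc. -/
structure IsLift (f : ℂ → V3) (U : ℂ → ℍ[ℝ]) : Prop where
  cont : ContinuousOn U Dsk
  ne : ∀ w ∈ Dsk, U w ≠ 0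
  act : ∀ w ∈ Dsk, act (U w) = f w

theorem exists_lift {f : ℂ → V3} (hf : ContinuousOn f Dsk) (h : ∀ w ∈ Dsk, f w ∈ sphereS) :
    ∃ U, IsLift f U := by
  obtain ⟨U, hU, hU'⟩ := exists_hopf (isCompact_closedBall (0:ℂ) 1) (convex_closedBall _ _)
    (f := fun w => qv (f w)) (continuous_qv.comp_continuousOn hf) (fun w hw => qv_sq (h w hw))
  exact ⟨U, hU, fun w hw => (hU' w hw).1, fun w hw => act_of (hU' w hw).1 (hU' w hw).2⟩

theorem IsLift.contf {f U} (h : IsLift f U) : ContinuousOn f Dsk :=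
  (h.cont.act h.ne).congr fun w hw => (h.act w hw).symm
theorem IsLift.mem {f U} (h : IsLift f U) : ∀ w ∈ Dsk, f w ∈ sphereS := fun w hw => by
  rw [← h.act w hw]; exact act_mem (h.ne w hw)

/-- clutching function -/
def clu (L U : ℂ → ℍ[ℝ]) (w : ℂ) : ℂ := zc ((L w)⁻¹ * U w)

theorem clu_spec {fu fl : ℂ → V3} {U L : ℂ → ℍ[ℝ]} (hU : IsLift fu U) (hL : IsLift fl L)
    (he : ∀ w ∈ Crc, fu w = fl w) {w : ℂ} (hw : w ∈ Crc) :
    clu L U w ≠ 0 ∧ U w = L w * cz (clu L U w) :=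
  have hd := crc_sub hw
  eq_mul_cz (hL.ne w hd) (hU.ne w hd) (by rw [hU.act w hd, hL.act w hd, he w hw])

theorem clu_cont {fu fl : ℂ → V3} {U L : ℂ → ℍ[ℝ]} (hU : IsLift fu U) (hL : IsLift fl L) :
    ContinuousOn (clu L U) Crc :=
  continuous_zc.comp_continuousOn
    (((hL.cont.inv₀ hL.ne).mul hU.cont).mono crc_sub)

theorem free {fu fl gu gl : ℂ → V3} {Fu Fl Gu Gl : ℂ → ℍ[ℝ]} (hFu : IsLift fu Fu)
    (hFl : IsLift fl Fl) (hGu : IsLift gu Gu) (hGl : IsLift gl Gl)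
    (hf : ∀ w ∈ Crc, fu w = fl w) (hg : ∀ w ∈ Crc, gu w = gl w) {k : ℤ}
    (h1 : HasWind (clu Fl Fu) k) (h2 : HasWind (clu Gl Gu) k) :
    SphHomotopic (glue fu fl) (glue gu gl) := by
  obtain ⟨L, hL, hL0, hLa, hLb⟩ := cyl0 hFl.cont hGl.cont hFl.ne hGl.ne
  have hw := wind_div h2 h1
  rw [sub_self] at hw
  obtain ⟨m, hm, hme⟩ := wind_zero_log hw
  obtain ⟨Φ, hΦ, hΦ0, hΦa, hΦb, hΦc⟩ := cyl hFu.cont hGu.cont hFu.ne hGu.ne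
    (b := fun p => L p * cz (clu Fl Fu p.2 * Complex.exp (p.1 * m p.2)))
    ((hL.mono (prod_mono_right crc_sub)).mul (continuous_cz.comp_continuousOn
      (((clu_cont hFu hFl).comp continuousOn_snd fun p hp => hp.2).mul
        (Complex.continuous_exp.comp_continuousOn
          ((Complex.continuous_ofReal.comp continuous_fst).continuousOn.mul
            (hm.comp continuousOn_snd fun p hp => hp.2))))))
    (fun t ht w hw => mul_ne_zero (hL0 t ht w (crc_sub hw)) (cz_ne
      (mul_ne_zero (clu_spec hFu hFl hf hw).1 (Complex.exp_ne_zero _))))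
    (fun w hw => by
      simp only [Complex.ofReal_zero, zero_mul, Complex.exp_zero, mul_one]
      rw [hLa w (crc_sub hw), ← (clu_spec hFu hFl hf hw).2])
    (fun w hw => by
      simp only [Complex.ofReal_one, one_mul]
      rw [hme w hw, hLb w (crc_sub hw), mul_div_cancel₀ _ (clu_spec hFu hFl hf hw).1,
        ← (clu_spec hGu hGl hg hw).2])
  refine ⟨fun t x => if 0 ≤ x 2 then act (Φ (t, pr x)) else act (L (t, pr x)), ?_, ?_, ?_, ?_⟩
  · refine glue_cont (Hu := fun p => act (Φ p)) (Hl := fun p => act (L p))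
      (hΦ.act fun p hp => hΦ0 _ hp.1 _ hp.2) (hL.act fun p hp => hL0 _ hp.1 _ hp.2)
      fun t ht w hw => ?_
    rw [hΦc t ht w hw, act_mul_cz (hL0 t ht w (crc_sub hw))
      (mul_ne_zero (clu_spec hFu hFl hf hw).1 (Complex.exp_ne_zero _))]
  · intro t ht x hx
    have := pr_mem hx
    simp only
    split_ifs
    · exact act_mem (hΦ0 t ht _ this)
    · exact act_mem (hL0 t ht _ this)
  · intro x hx
    have := pr_mem hx
    simp only [glue]
    rw [hΦa _ this, hLa _ this, hFu.act _ this, hFl.act _ this]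
  · intro x hx
    have := pr_mem hx
    simp only [glue]
    rw [hΦb _ this, hLb _ this, hGu.act _ this, hGl.act _ this]

/-- The radial power map. -/
def Pw (K : ℤ) (c : ℂ) : ℂ := ‖c‖ * (c / ‖c‖) ^ K

theorem Pw_norm (K : ℤ) (c : ℂ) : ‖Pw K c‖ = ‖c‖ := by
  unfold Pw
  by_cases h : c = 0
  · simp [h]
  · have : ‖c‖ ≠ 0 := norm_ne_zero_iff.2 h
    simp [div_self this]

theorem continuous_Pw (K : ℤ) : Continuous (Pw K) := by
  rw [continuous_iff_continuousAt]
  intro c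
  by_cases h : c = 0
  · subst h
    have h0 : Pw K 0 = 0 := by simp [Pw]
    rw [ContinuousAt, h0, tendsto_zero_iff_norm_tendsto_zero]
    simp only [Pw_norm]
    have := (continuous_norm (E := ℂ)).tendsto 0
    simpa using this
  · have : ((‖c‖ : ℝ) : ℂ) ≠ 0 := by exact_mod_cast norm_ne_zero_iff.2 h
    have hc : ContinuousAt (fun c : ℂ => ((‖c‖ : ℝ) : ℂ)) c := by fun_prop
    unfold Pw
    exact hc.mul ((continuousAt_id.div hc this).zpow₀ K (Or.inl (div_ne_zero h this)))

theorem powMap_eq (K : ℤ) (x : V3) : powMap K x = ![(Pw K (pr x)).re, (Pw K (pr x)).im, x 2] := by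
  unfold powMap
  split_ifs with h
  · have h' : pr x = 0 := h
    have h0 : x 0 = 0 := by rw [← pr_re x, h']; rfl
    have h1 : x 1 = 0 := by rw [← pr_im x, h']; rfl
    ext i; fin_cases i <;> simp [h', Pw, h0, h1]
  · have : ∀ (r : ℝ) (z : ℂ), ((r:ℂ) * z).re = r * z.re ∧ ((r:ℂ) * z).im = r * z.im := by
      intro r z; simp
    unfold Pw pr
    rw [(this _ _).1, (this _ _).2]

theorem powMap_cont (K : ℤ) : Continuous (powMap K) := by
  have : powMap K = fun x => ![(Pw K (pr x)).re, (Pw K (pr x)).im, x 2] :=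
    funext (powMap_eq K)
  rw [this]
  have h := (continuous_Pw K).comp continuous_pr
  refine continuous_pi fun i => ?_
  fin_cases i
  · exact Complex.continuous_re.comp h
  · exact Complex.continuous_im.comp h
  · exact continuous_apply 2

theorem powMap_mem (K : ℤ) {x : V3} (hx : x ∈ sphereS) : powMap K x ∈ sphereS := by
  rw [powMap_eq, mem_sphereS]
  simp only [Matrix.cons_val_zero, Matrix.cons_val_one, Matrix.cons_val]
  rw [← nsq, Pw_norm, pr_normSq]
  exact mem_sphereS.1 hx

def pU (K : ℤ) (w : ℂ) : ℍ[ℝ] := 1 - qv (powMap K (up w)) * qI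
def pL (K : ℤ) (w : ℂ) : ℍ[ℝ] := (1 + qv (powMap K (lo w)) * qI) * qJ

theorem pU_lift (K : ℤ) : IsLift (fun w => powMap K (up w)) (pU K) := by
  have hne : ∀ w, pU K w ≠ 0 := fun w h => by
    have := congrArg (fun q : ℍ[ℝ] => q.re) h
    simp [pU, powMap_eq, up] at this
    have h2 := Real.sqrt_nonneg (1 - ‖w‖ ^ 2)
    linarith
  refine ⟨?_, fun w _ => hne w, fun w hw => ?_⟩
  · have := continuous_qv.comp ((powMap_cont K).comp continuous_up)
    exact (continuous_const.sub (this.mul continuous_const)).continuousOn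
  · apply act_of (hne w)
    have := qstep (U := 1) qI_sq (qv_sq (powMap_mem K (up_mem hw))) (by simp)
    simpa [pU] using this

theorem pL_lift (K : ℤ) : IsLift (fun w => powMap K (lo w)) (pL K) := by
  have hne : ∀ w, pL K w ≠ 0 := fun w => by
    refine mul_ne_zero (fun h => ?_) qJ_ne
    have := congrArg (fun q : ℍ[ℝ] => q.re) h
    simp [powMap_eq, lo] at this
    have h2 := Real.sqrt_nonneg (1 - ‖w‖ ^ 2)
    linarith
  refine ⟨?_, fun w _ => hne w, fun w hw => ?_⟩
  · have := continuous_qv.comp ((powMap_cont K).comp continuous_lo)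
    exact ((continuous_const.add (this.mul continuous_const)).mul continuous_const).continuousOn
  · apply act_of (hne w)
    have := qstep (U := qJ) (p := -qI) (by simp [qI_sq]) (qv_sq (powMap_mem K (lo_mem hw)))
      (by ext <;> simp)
    simpa [pL] using this

theorem pow_eq {w : ℂ} (hw : w ∈ Crc) : up w = lo w := by
  have : ‖w‖ = 1 := by simpa using hw
  simp [up, lo, this]

theorem pow_clu (K : ℤ) {w : ℂ} (hw : w ∈ Crc) :
    clu (pL K) (pU K) w = -Complex.I * w ^ (-K) := by
  have hn : ‖w‖ = 1 := by simpa using hw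
  have hP : Pw K w = w ^ K := by simp [Pw, hn]
  have hq : qv (powMap K (up w)) = (w ^ K).re • qJ + (w ^ K).im • qK := by
    ext <;> simp [powMap_eq, pr_up, hP]
    simp [up, hn]
  have habs : (w ^ K).re ^ 2 + (w ^ K).im ^ 2 = 1 := by
    rw [← nsq, norm_zpow, hn]; simp
  have hinv : w ^ (-K) = (starRingEnd ℂ) (w ^ K) := by
    rw [_root_.zpow_neg, Complex.inv_def, Complex.normSq_eq_norm_sq, norm_zpow, hn]; simp
  have key : pU K w = pL K w * cz (-Complex.I * w ^ (-K)) := by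
    rw [pU, pL, ← pow_eq hw, hq, hinv]
    generalize w ^ K = z at *
    ext <;> simp
    · linarith
    · ring
  rw [clu, key, inv_mul_cancel_left₀ ((pL_lift K).ne w (crc_sub hw)), zc_cz]

theorem pow_wind (K : ℤ) : HasWind (clu (pL K) (pU K)) (-K) := by
  refine ⟨fun φ => -(Real.pi / 2 * Complex.I) + ((-K : ℤ) : ℂ) * (φ * Complex.I),
    by fun_prop, fun φ _ => ?_, ?_⟩
  · rw [pow_clu K (exp_mem_circle φ), Complex.exp_add, Complex.exp_int_mul]
    congr 1
    rw [Complex.exp_neg, Complex.exp_pi_div_two_mul_I]; simp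
  · push_cast; ring

/-- The degree of a glued map is minus the winding number of its clutching function. -/
theorem deg_glue {deg : (V3 → V3) → ℤ} (hdeg : DegreeTheory deg) {fu fl : ℂ → V3}
    {U L : ℂ → ℍ[ℝ]} (hU : IsLift fu U) (hL : IsLift fl L)
    (he : ∀ w ∈ Crc, fu w = fl w) {k : ℤ} (hk : HasWind (clu L U) k) :
    deg (glue fu fl) = -k := by
  have h2 : HasWind (clu (pL (-k)) (pU (-k))) k := by simpa using pow_wind (-k)
  obtain ⟨H, h1, h3, h4, h5⟩ := free hU hL (pU_lift (-k)) (pL_lift (-k)) he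
    (fun w hw => by rw [pow_eq hw]) hk h2
  rw [← hdeg.2 (-k)]
  refine hdeg.1 _ _ (glue_contOn hU.contf hL.contf he) (glue_maps hU.mem hL.mem)
    (powMap_cont _).continuousOn (fun x hx => powMap_mem _ hx) ⟨H, h1, h3, h4, fun x hx => ?_⟩
  rw [h5 x hx, glue]
  split_ifs with h
  · simp only [up_pr hx h]
  · simp only [lo_pr hx (not_le.1 h).le]

theorem disc_homotopy {deg : (V3 → V3) → ℤ} (hdeg : DegreeTheory deg) {f f' l : ℂ → V3}
    (hf : ContinuousOn f Dsk) (hf' : ContinuousOn f' Dsk) (hl : ContinuousOn l Dsk)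
    (mf : ∀ w ∈ Dsk, f w ∈ sphereS) (mf' : ∀ w ∈ Dsk, f' w ∈ sphereS)
    (ml : ∀ w ∈ Dsk, l w ∈ sphereS) (e : ∀ w ∈ Crc, f w = l w) (e' : ∀ w ∈ Crc, f' w = l w)
    (hd : deg (glue f l) = deg (glue f' l)) :
    ∃ h : ℝ × ℂ → V3, ContinuousOn h (Icc (0:ℝ) 1 ×ˢ Dsk) ∧
      (∀ t ∈ Icc (0:ℝ) 1, ∀ w ∈ Dsk, h (t, w) ∈ sphereS) ∧
      (∀ w ∈ Dsk, h (0, w) = f w) ∧ (∀ w ∈ Dsk, h (1, w) = f' w) ∧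
      (∀ t ∈ Icc (0:ℝ) 1, ∀ w ∈ Crc, h (t, w) = f w) := by
  obtain ⟨U, hU⟩ := exists_lift hf mf
  obtain ⟨U', hU'⟩ := exists_lift hf' mf'
  obtain ⟨L, hL⟩ := exists_lift hl ml
  obtain ⟨k, hk⟩ := wind_exists (clu_cont hU hL) (fun w hw => (clu_spec hU hL e hw).1)
  obtain ⟨k', hk'⟩ := wind_exists (clu_cont hU' hL) (fun w hw => (clu_spec hU' hL e' hw).1)
  rw [deg_glue hdeg hU hL e hk, deg_glue hdeg hU' hL e' hk', neg_inj] at hd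
  subst hd
  have hw := wind_div hk' hk
  rw [sub_self] at hw
  obtain ⟨m, hm, hme⟩ := wind_zero_log hw
  obtain ⟨Φ, hΦ, hΦ0, hΦa, hΦb, hΦc⟩ := cyl hU.cont hU'.cont hU.ne hU'.ne
    (b := fun p => U p.2 * cz (Complex.exp (p.1 * m p.2)))
    ((hU.cont.comp continuousOn_snd fun p hp => crc_sub hp.2).mul
      (continuous_cz.comp_continuousOn
        (Complex.continuous_exp.comp_continuousOn
          ((Complex.continuous_ofReal.comp continuous_fst).continuousOn.mul
            (hm.comp continuousOn_snd fun p hp => hp.2)))))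
    (fun t ht w hw => mul_ne_zero (hU.ne w (crc_sub hw)) (cz_ne (Complex.exp_ne_zero _)))
    (fun w hw => by
      simp only [Complex.ofReal_zero, zero_mul, Complex.exp_zero, cz_one, mul_one])
    (fun w hw => by
      simp only [Complex.ofReal_one, one_mul]
      rw [hme w hw, (clu_spec hU hL e hw).2, mul_assoc, ← cz_mul,
        mul_div_cancel₀ _ (clu_spec hU hL e hw).1, ← (clu_spec hU' hL e' hw).2])
  refine ⟨fun p => act (Φ p), hΦ.act fun p hp => hΦ0 _ hp.1 _ hp.2,
    fun t ht w hw => act_mem (hΦ0 t ht w hw), fun w hw => ?_, fun w hw => ?_,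
    fun t ht w hw => ?_⟩
  · simp only [hΦa w hw, hU.act w hw]
  · simp only [hΦb w hw, hU'.act w hw]
  · simp only [hΦc t ht w hw]
    rw [act_mul_cz (hU.ne w (crc_sub hw)) (Complex.exp_ne_zero _), hU.act w (crc_sub hw)]

end

noncomputable section
open Matrix Set MeasureTheory
open scoped Classical Quaternion

namespace PolyCtx
variable (P : PolyCtx)

theorem mem_Rall {x : V3} : x ∈ P.Rall ↔ ∀ a, (x - P.cpt a) ⬝ᵥ P.Cnormal a ≤ 0 := by
  simp [Rall, Rhalf]

theorem vert_not_Rall (a : Fin P.nv) : P.vert a ∉ P.Rall := fun h => by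
  have := P.mem_Rall.1 h a
  linarith [P.sep_vert a]

theorem Phat_eq : P.PhatSet = P.Pbar ∩ P.Rall := by
  ext x
  constructor
  · rintro ⟨⟨h1, -⟩, h2⟩; exact ⟨h1, h2⟩
  · rintro ⟨h1, h2⟩
    refine ⟨⟨h1, ?_⟩, h2⟩
    rintro ⟨a, rfl⟩
    exact P.vert_not_Rall a h2

theorem dot_sub_cont (p N : V3) : Continuous fun x : V3 => (x - p) ⬝ᵥ N :=
  continuous_dot.comp ((continuous_id.sub continuous_const).prodMk continuous_const)

theorem Rall_closed : IsClosed P.Rall := by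
  unfold Rall Rhalf
  exact isClosed_iInter fun a => isClosed_le (dot_sub_cont _ _) continuous_const

theorem dot_combo (p N x y : V3) {s t : ℝ} (h : s + t = 1) :
    (s • x + t • y - p) ⬝ᵥ N = s * ((x - p) ⬝ᵥ N) + t * ((y - p) ⬝ᵥ N) := by
  have : s = 1 - t := by linarith
  subst this
  simp only [sub_dotProduct, add_dotProduct, smul_dotProduct, smul_eq_mul]
  ring

theorem Rall_convex : Convex ℝ P.Rall := by
  intro x hx y hy s t hs ht hst
  rw [mem_Rall] at *
  intro a
  rw [dot_combo _ _ _ _ hst]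
  nlinarith [hx a, hy a]

theorem Phat_compact : IsCompact P.PhatSet := by
  rw [Phat_eq]; exact P.compact.inter_right P.Rall_closed

theorem Chat_eq (a : Fin P.nv) :
    P.Chat a = {x | (x - P.cpt a) ⬝ᵥ P.Cnormal a = 0} ∩ P.Pbar := by
  ext x
  constructor
  · rintro ⟨h1, h2⟩; exact ⟨h1, h2.1⟩
  · rintro ⟨h1, h2⟩
    refine ⟨h1, h2, ?_⟩
    rintro ⟨b, rfl⟩
    have := P.cleave_sub a b _ h2 h1
    linarith [P.sep_vert b]

theorem mem_Chat {a : Fin P.nv} {x : V3} :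
    x ∈ P.Chat a ↔ (x - P.cpt a) ⬝ᵥ P.Cnormal a = 0 ∧ x ∈ P.Pbar := by
  rw [Chat_eq]; rfl

theorem Chat_sub (a : Fin P.nv) : P.Chat a ⊆ P.PhatSet := fun x hx => by
  have h := P.mem_Chat.1 hx
  rw [Phat_eq]
  exact ⟨h.2, P.mem_Rall.2 fun b => P.cleave_sub a b x h.2 h.1⟩

theorem Chat_compact (a : Fin P.nv) : IsCompact (P.Chat a) := by
  rw [Chat_eq]
  exact P.compact.inter_left (isClosed_eq (dot_sub_cont _ _) continuous_const)

theorem Chat_convex (a : Fin P.nv) : Convex ℝ (P.Chat a) := by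
  intro x hx y hy s t hs ht hst
  rw [mem_Chat] at *
  refine ⟨?_, P.convex hx.2 hy.2 hs ht hst⟩
  rw [dot_combo _ _ _ _ hst, hx.1, hy.1]; simp

theorem mem_face {c : Fin P.nf} {x : V3} :
    x ∈ P.face c ↔ x ∈ P.Pbar ∧ x ⬝ᵥ P.Fnormal c = P.foffset c := by
  rw [P.face_def]; rfl

theorem Fhat_sub (c : Fin P.nf) : P.Fhat c ⊆ P.PhatSet := fun x hx => by
  rw [Phat_eq]; exact ⟨(P.mem_face.1 hx.1).1, hx.2⟩

theorem face_compact (c : Fin P.nf) : IsCompact (P.face c) := by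
  rw [P.face_def]
  exact P.compact.inter_right (isClosed_eq
    (continuous_dot.comp (continuous_id.prodMk continuous_const)) continuous_const)

theorem face_convex (c : Fin P.nf) : Convex ℝ (P.face c) := by
  intro x hx y hy s t hs ht hst
  rw [mem_face] at *
  refine ⟨P.convex hx.1 hy.1 hs ht hst, ?_⟩
  simp only [add_dotProduct, smul_dotProduct, smul_eq_mul, hx.2, hy.2]
  rw [← add_mul, hst, one_mul]

theorem Fhat_compact (c : Fin P.nf) : IsCompact (P.Fhat c) :=
  (P.face_compact c).inter_right P.Rall_closed

theorem Fhat_convex (c : Fin P.nf) : Convex ℝ (P.Fhat c) :=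
  (P.face_convex c).inter P.Rall_convex

theorem bdChat_eq (a : Fin P.nv) : P.bdChat a = P.Chat a ∩ frontier P.Pbar := by
  rw [P.frontier_eq]
  ext x
  simp only [bdChat, Bhat, Fhat, mem_iUnion, mem_inter_iff]
  constructor
  · rintro ⟨c, h1, h2, -⟩; exact ⟨h1, c, h2⟩
  · rintro ⟨h1, c, h2⟩
    refine ⟨c, h1, h2, ?_⟩
    have := P.Chat_sub a h1
    rw [Phat_eq] at this
    exact this.2

theorem bdChat_sub (a : Fin P.nv) : P.bdChat a ⊆ P.Chat a := by
  rw [bdChat_eq]; exact inter_subset_left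

end PolyCtx

/-! ### Geodesic contraction -/

theorem dot_sq_lt {p a : V3} (hp : p ∈ sphereS) (ha : a ∈ sphereS) (h1 : a ≠ p) (h2 : a ≠ -p) :
    -1 < p ⬝ᵥ a ∧ p ⬝ᵥ a < 1 := by
  have hp' : p ⬝ᵥ p = 1 := hp
  have ha' : a ⬝ᵥ a = 1 := ha
  have e1 := dot_self_pos' (sub_ne_zero.2 h1)
  have e2 := dot_self_pos' (v := a + p) (fun h => h2 (eq_neg_of_add_eq_zero_left h))
  have hc : a ⬝ᵥ p = p ⬝ᵥ a := dotProduct_comm _ _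
  simp only [sub_dotProduct, dotProduct_sub, add_dotProduct, dotProduct_add] at e1 e2
  constructor <;> linarith

theorem sin_arccos_ne {x : ℝ} (h : -1 < x ∧ x < 1) : Real.sin (Real.arccos x) ≠ 0 := by
  rw [Real.sin_arccos]
  exact (Real.sqrt_pos.2 (by nlinarith [h.1, h.2])).ne'

theorem geo_zero {p a : V3} (h : -1 < p ⬝ᵥ a ∧ p ⬝ᵥ a < 1) : geo p a 0 = p := by
  unfold geo
  split_ifs
  · rfl
  · simp [div_self (sin_arccos_ne h)]

theorem geo_one {p a : V3} (h : -1 < p ⬝ᵥ a ∧ p ⬝ᵥ a < 1) : geo p a 1 = a := by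
  unfold geo
  split_ifs with he
  · exact he
  · simp [div_self (sin_arccos_ne h)]

theorem geo_mem {p a : V3} (hp : p ∈ sphereS) (ha : a ∈ sphereS)
    (h : -1 < p ⬝ᵥ a ∧ p ⬝ᵥ a < 1) (ρ : ℝ) : geo p a ρ ∈ sphereS := by
  unfold geo
  split_ifs
  · exact hp
  · have hp' : p ⬝ᵥ p = 1 := hp
    have ha' : a ⬝ᵥ a = 1 := ha
    have hc : a ⬝ᵥ p = p ⬝ᵥ a := dotProduct_comm _ _
    have hs := sin_arccos_ne h
    have hcos : p ⬝ᵥ a = Real.cos (Real.arccos (p ⬝ᵥ a)) := (Real.cos_arccos h.1.le h.2.le).symm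
    simp only [sphereS, mem_ofPred_eq, add_dotProduct, dotProduct_add, smul_dotProduct,
      dotProduct_smul, smul_eq_mul, hp', ha', hc]
    set θ := Real.arccos (p ⬝ᵥ a)
    rw [hcos]
    have e1 : θ = (1 - ρ) * θ + ρ * θ := by ring
    have e2 : Real.sin θ = Real.sin ((1 - ρ) * θ + ρ * θ) := by rw [← e1]
    have e3 : Real.cos θ = Real.cos ((1 - ρ) * θ + ρ * θ) := by rw [← e1]
    rw [Real.sin_add] at e2
    rw [Real.cos_add] at e3
    have s1 := Real.sin_sq_add_cos_sq ((1 - ρ) * θ)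
    have s2 := Real.sin_sq_add_cos_sq (ρ * θ)
    field_simp
    rw [e3, e2]
    generalize Real.sin ((1 - ρ) * θ) = A at *
    generalize Real.cos ((1 - ρ) * θ) = C at *
    generalize Real.sin (ρ * θ) = B at *
    generalize Real.cos (ρ * θ) = D at *
    have hC : C ^ 2 = 1 - A ^ 2 := by linarith
    have hD : D ^ 2 = 1 - B ^ 2 := by linarith
    ring_nf
    rw [hC, hD]; ring

theorem geo_cont {E : Type*} [TopologicalSpace E] {S : Set E} {p : V3} (hp : p ∈ sphereS)
    {f : E → V3} {ρ : E → ℝ} (hf : ContinuousOn f S) (hρ : ContinuousOn ρ S)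
    (h : ∀ x ∈ S, -1 < p ⬝ᵥ f x ∧ p ⬝ᵥ f x < 1) :
    ContinuousOn (fun x => geo p (f x) (ρ x)) S := by
  have hd : ContinuousOn (fun x => Real.arccos (p ⬝ᵥ f x)) S :=
    Real.continuous_arccos.comp_continuousOn (ContinuousOn.dot3 continuousOn_const hf)
  have hs := Real.continuous_sin.comp_continuousOn hd
  have h0 : ∀ x ∈ S, Real.sin (Real.arccos (p ⬝ᵥ f x)) ≠ 0 := fun x hx => sin_arccos_ne (h x hx)
  have : ContinuousOn (fun x => (Real.sin ((1 - ρ x) * Real.arccos (p ⬝ᵥ f x)) /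
      Real.sin (Real.arccos (p ⬝ᵥ f x))) • p + (Real.sin (ρ x * Real.arccos (p ⬝ᵥ f x)) /
      Real.sin (Real.arccos (p ⬝ᵥ f x))) • f x) S :=
    (((Real.continuous_sin.comp_continuousOn ((continuousOn_const.sub hρ).mul hd)).div hs
      h0).smul continuousOn_const).add (((Real.continuous_sin.comp_continuousOn
        (hρ.mul hd)).div hs h0).smul hf)
  refine this.congr fun x hx => ?_
  unfold geo
  rw [if_neg]
  intro he
  have h1 := (h x hx).2
  rw [← he] at h1
  have hp' : p ⬝ᵥ p = 1 := hp
  linarith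

/-! ### Polar coordinates -/

theorem arg_polar {ρ : ℝ} (hρ : 0 < ρ) (φ : ℝ) :
    ∃ k : ℤ, φ = Complex.arg (ρ * Complex.exp (φ * Complex.I)) + k * (2 * Real.pi) := by
  set w : ℂ := ρ * Complex.exp (φ * Complex.I) with hw
  have hn : ‖w‖ = ρ := by
    rw [hw, norm_mul, Complex.norm_exp_ofReal_mul_I, mul_one, Complex.norm_real,
      Real.norm_of_nonneg hρ.le]
  have h1 := Complex.norm_mul_exp_arg_mul_I w
  rw [hn] at h1
  have h2 : Complex.exp (φ * Complex.I) = Complex.exp (w.arg * Complex.I) := by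
    apply mul_left_cancel₀ (show (ρ : ℂ) ≠ 0 by exact_mod_cast hρ.ne')
    rw [h1]
  obtain ⟨k, hk⟩ := Complex.exp_eq_exp_iff_exists_int.1 h2
  refine ⟨k, ?_⟩
  have := congrArg Complex.im hk
  simpa using this

theorem polar_cont {Y : Type*} [TopologicalSpace Y] {G : ℝ → ℝ → ℝ → Y}
    (hG : ContinuousOn (fun p : ℝ × ℝ × ℝ => G p.1 p.2.1 p.2.2)
      (Icc (0:ℝ) 1 ×ˢ Icc (0:ℝ) 1 ×ˢ univ))
    (hper : ∀ t ∈ Icc (0:ℝ) 1, ∀ ρ φ, G t ρ (φ + 2 * Real.pi) = G t ρ φ)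
    (h0 : ∀ t ∈ Icc (0:ℝ) 1, ∀ φ φ', G t 0 φ = G t 0 φ') :
    ContinuousOn (fun q : ℝ × ℂ => G q.1 ‖q.2‖ (Complex.arg q.2)) (Icc (0:ℝ) 1 ×ˢ Dsk) := by
  have key := contOn_image_of_comp (S := Icc (0:ℝ) 1 ×ˢ Icc (0:ℝ) 1 ×ˢ Icc (-Real.pi) Real.pi)
    (isCompact_Icc.prod (isCompact_Icc.prod isCompact_Icc))
    (q := fun p : ℝ × ℝ × ℝ => (p.1, (p.2.1 : ℂ) * Complex.exp (p.2.2 * Complex.I)))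
    (by fun_prop) (f := fun q : ℝ × ℂ => G q.1 ‖q.2‖ (Complex.arg q.2))
    (g := fun p => G p.1 p.2.1 p.2.2)
    (hG.mono (prod_mono_right (prod_mono_right (subset_univ _)))) (by
      rintro ⟨t, ρ, φ⟩ ⟨ht, hρ, -⟩
      simp only at ht hρ ⊢
      have hn : ‖(ρ : ℂ) * Complex.exp (φ * Complex.I)‖ = ρ := by
        rw [norm_mul, Complex.norm_exp_ofReal_mul_I, mul_one, Complex.norm_real,
          Real.norm_of_nonneg hρ.1]
      rw [hn]
      rcases hρ.1.eq_or_lt with h | h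
      · rw [← h]; exact h0 t ht _ _
      · obtain ⟨k, hk⟩ := arg_polar h φ
        have hp : Function.Periodic (G t ρ) (2 * Real.pi) := fun φ => hper t ht ρ φ
        conv_rhs => rw [hk]
        exact (hp.int_mul k _).symm)
  refine key.mono ?_
  rintro ⟨t, w⟩ ⟨ht, hw⟩
  refine ⟨(t, ‖w‖, w.arg), ⟨ht, ⟨norm_nonneg _, by simpa using hw⟩,
    (Complex.neg_pi_lt_arg w).le, Complex.arg_le_pi w⟩, ?_⟩
  simp [Complex.norm_mul_exp_arg_mul_I]

def polU (n : V3 → V3) (z : ℝ → V3) (ctr : V3) (w : ℂ) : V3 :=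
  n (‖w‖ • z w.arg + (1 - ‖w‖) • ctr)
def polL (n : V3 → V3) (z : ℝ → V3) (s : V3) (w : ℂ) : V3 :=
  geo (-s) (n (z w.arg)) ‖w‖

theorem wrap_eq_glue (n z ctr s) : wrapMap n z ctr s = glue (polU n z ctr) (polL n z s) := by
  ext1 x
  unfold wrapMap glue polU polL
  rw [pr_norm]
  rfl

namespace PolyCtx
variable (P : PolyCtx)

theorem adm_dot {s : V3} (hs : P.AdmissibleS s) {n : V3 → V3} (hn : P.MemC0Phat n)
    {a : Fin P.nv} {x : V3} (hx : x ∈ P.bdChat a) :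
    -1 < (-s) ⬝ᵥ n x ∧ (-s) ⬝ᵥ n x < 1 := by
  simp only [bdChat, mem_iUnion] at hx
  obtain ⟨c, -, hc⟩ := hx
  have h1 := hn.2.2 c x hc
  have h2 := hs.2 c
  have hs1 : -s ∈ sphereS := by
    have : s ⬝ᵥ s = 1 := hs.1
    simp [sphereS, this]
  refine dot_sq_lt hs1 (hn.2.1 x (P.Fhat_sub c hc)) (fun h => h2 ?_) (fun h => h2 ?_)
  · rw [h] at h1; simpa using h1
  · rw [h] at h1; simpa using h1

theorem wrap_parts {s : V3} (hs : P.AdmissibleS s) (a : Fin P.nv) {n : ℝ → V3 → V3}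
    (hn : ContinuousOn (fun q : ℝ × V3 => n q.1 q.2) (Icc (0:ℝ) 1 ×ˢ P.PhatSet))
    (hn' : ∀ t ∈ Icc (0:ℝ) 1, P.MemC0Phat (n t)) {z : ℝ → ℝ → V3}
    (hz : ContinuousOn (fun q : ℝ × ℝ => z q.1 q.2) (Icc (0:ℝ) 1 ×ˢ univ))
    (hzp : ∀ t ∈ Icc (0:ℝ) 1, ∀ φ, z t (φ + 2 * Real.pi) = z t φ)
    (hzm : ∀ t ∈ Icc (0:ℝ) 1, ∀ φ, z t φ ∈ P.bdChat a) {ctr : ℝ → V3}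
    (hc : ContinuousOn ctr (Icc 0 1)) (hcm : ∀ t ∈ Icc (0:ℝ) 1, ctr t ∈ P.Chat a) :
    ContinuousOn (fun q : ℝ × ℂ => polU (n q.1) (z q.1) (ctr q.1) q.2) (Icc (0:ℝ) 1 ×ˢ Dsk) ∧
    ContinuousOn (fun q : ℝ × ℂ => polL (n q.1) (z q.1) s q.2) (Icc (0:ℝ) 1 ×ˢ Dsk) ∧
    (∀ t ∈ Icc (0:ℝ) 1, ∀ w ∈ Dsk, polU (n t) (z t) (ctr t) w ∈ sphereS) ∧
    (∀ t ∈ Icc (0:ℝ) 1, ∀ w ∈ Dsk, polL (n t) (z t) s w ∈ sphereS) ∧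
    (∀ t ∈ Icc (0:ℝ) 1, ∀ w ∈ Crc, polU (n t) (z t) (ctr t) w = polL (n t) (z t) s w) := by
  have hs1 : -s ∈ sphereS := by
    have : s ⬝ᵥ s = 1 := hs.1
    simp [sphereS, this]
  have hin : ∀ t ∈ Icc (0:ℝ) 1, ∀ ρ ∈ Icc (0:ℝ) 1, ∀ φ,
      ρ • z t φ + (1 - ρ) • ctr t ∈ P.PhatSet := fun t ht ρ hρ φ =>
    P.Chat_sub a (P.Chat_convex a (P.bdChat_sub a (hzm t ht φ)) (hcm t ht) hρ.1
      (by linarith [hρ.2]) (by ring))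
  have c1 : ContinuousOn (fun p : ℝ × ℝ × ℝ => z p.1 p.2.2)
      (Icc (0:ℝ) 1 ×ˢ Icc (0:ℝ) 1 ×ˢ univ) :=
    hz.comp (f := fun p : ℝ × ℝ × ℝ => (p.1, p.2.2)) (by fun_prop)
      fun p hp => ⟨hp.1, mem_univ _⟩
  have c2 : ContinuousOn (fun p : ℝ × ℝ × ℝ => ctr p.1)
      (Icc (0:ℝ) 1 ×ˢ Icc (0:ℝ) 1 ×ˢ univ) :=
    hc.comp continuousOn_fst fun p hp => hp.1
  have cf : ContinuousOn (fun p : ℝ × ℝ × ℝ => p.1) (Icc (0:ℝ) 1 ×ˢ Icc (0:ℝ) 1 ×ˢ univ) := by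
    fun_prop
  have cr : ContinuousOn (fun p : ℝ × ℝ × ℝ => p.2.1) (Icc (0:ℝ) 1 ×ˢ Icc (0:ℝ) 1 ×ˢ univ) := by
    fun_prop
  refine ⟨?_, ?_, ?_, ?_, ?_⟩
  · refine polar_cont (G := fun t ρ φ => n t (ρ • z t φ + (1 - ρ) • ctr t)) ?_ ?_ ?_
    · exact hn.comp (f := fun p : ℝ × ℝ × ℝ => (p.1, p.2.1 • z p.1 p.2.2 + (1 - p.2.1) • ctr p.1))
        (cf.prodMk ((cr.smul c1).add ((continuousOn_const.sub cr).smul c2)))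
        fun p hp => ⟨hp.1, hin _ hp.1 _ hp.2.1 _⟩
    · intro t ht ρ φ; simp only [hzp t ht]
    · intro t ht φ φ'; simp
  · refine polar_cont (G := fun t ρ φ => geo (-s) (n t (z t φ)) ρ) ?_ ?_ ?_
    · refine geo_cont hs1 (hn.comp (f := fun p : ℝ × ℝ × ℝ => (p.1, z p.1 p.2.2))
        (cf.prodMk c1) fun p hp => ⟨hp.1, P.Chat_sub a (P.bdChat_sub a (hzm _ hp.1 _))⟩) cr ?_
      intro p hp
      exact P.adm_dot hs (hn' _ hp.1) (hzm _ hp.1 _)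
    · intro t ht ρ φ; simp only [hzp t ht]
    · intro t ht φ φ'
      rw [geo_zero (P.adm_dot hs (hn' _ ht) (hzm _ ht _)),
        geo_zero (P.adm_dot hs (hn' _ ht) (hzm _ ht _))]
  · intro t ht w hw
    exact (hn' t ht).2.1 _ (hin t ht _ ⟨norm_nonneg _, by simpa using hw⟩ _)
  · intro t ht w hw
    exact geo_mem hs1 ((hn' t ht).2.1 _ (P.Chat_sub a (P.bdChat_sub a (hzm _ ht _))))
      (P.adm_dot hs (hn' _ ht) (hzm _ ht _)) _
  · intro t ht w hw
    have : ‖w‖ = 1 := by simpa using hw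
    simp only [polU, polL, this, one_smul, sub_self, zero_smul, add_zero]
    rw [geo_one (P.adm_dot hs (hn' _ ht) (hzm _ ht _))]

theorem wrap_deg_eq {deg : (V3 → V3) → ℤ} (hdeg : DegreeTheory deg)
    {s : V3} (hs : P.AdmissibleS s) (a : Fin P.nv) {n : ℝ → V3 → V3}
    (hn : ContinuousOn (fun q : ℝ × V3 => n q.1 q.2) (Icc (0:ℝ) 1 ×ˢ P.PhatSet))
    (hn' : ∀ t ∈ Icc (0:ℝ) 1, P.MemC0Phat (n t)) {z : ℝ → ℝ → V3}
    (hz : ContinuousOn (fun q : ℝ × ℝ => z q.1 q.2) (Icc (0:ℝ) 1 ×ˢ univ))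
    (hzp : ∀ t ∈ Icc (0:ℝ) 1, ∀ φ, z t (φ + 2 * Real.pi) = z t φ)
    (hzm : ∀ t ∈ Icc (0:ℝ) 1, ∀ φ, z t φ ∈ P.bdChat a) {ctr : ℝ → V3}
    (hc : ContinuousOn ctr (Icc 0 1)) (hcm : ∀ t ∈ Icc (0:ℝ) 1, ctr t ∈ P.Chat a) :
    deg (wrapMap (n 0) (z 0) (ctr 0) s) = deg (wrapMap (n 1) (z 1) (ctr 1) s) := by
  obtain ⟨h1, h2, h3, h4, h5⟩ := P.wrap_parts hs a hn hn' hz hzp hzm hc hcm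
  have hH := glue_cont h1 h2 h5
  have hco : ∀ t ∈ Icc (0:ℝ) 1, ContinuousOn (wrapMap (n t) (z t) (ctr t) s) sphereS := by
    intro t ht
    have := hH.comp (f := fun x : V3 => (t, x)) (s := sphereS) (by fun_prop)
      (fun x hx => ⟨ht, hx⟩)
    rw [wrap_eq_glue]
    exact this
  have hm : ∀ t ∈ Icc (0:ℝ) 1, MapsTo (wrapMap (n t) (z t) (ctr t) s) sphereS sphereS := by
    intro t ht
    rw [wrap_eq_glue]
    exact glue_maps (h3 t ht) (h4 t ht)
  have i0 : (0:ℝ) ∈ Icc (0:ℝ) 1 := by simp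
  have i1 : (1:ℝ) ∈ Icc (0:ℝ) 1 := by simp
  refine hdeg.1 _ _ (hco 0 i0) (hm 0 i0) (hco 1 i1) (hm 1 i1)
    ⟨fun t => wrapMap (n t) (z t) (ctr t) s, ?_, hm, fun _ _ => rfl, fun _ _ => rfl⟩
  simp only [wrap_eq_glue]
  exact hH

end PolyCtx
end

noncomputable section
open Matrix Set MeasureTheory
open scoped Classical Quaternion

/-- Oriented orthonormal frame. -/
structure Frame (N e₁ e₂ : V3) : Prop where
  h1 : e₁ ⬝ᵥ e₁ = 1
  h2 : e₂ ⬝ᵥ e₂ = 1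
  h12 : e₁ ⬝ᵥ e₂ = 0
  hc : crossProduct e₁ e₂ = N

theorem exists_frame {N : V3} (hN : N ⬝ᵥ N = 1) : ∃ e₁ e₂, Frame N e₁ e₂ := by
  obtain ⟨v, hv, hvN⟩ : ∃ v : V3, v ≠ 0 ∧ v ⬝ᵥ N = 0 := by
    by_cases h : N 0 = 0 ∧ N 1 = 0
    · refine ⟨![1, 0, 0], fun h' => ?_, by simp [dotProduct, Fin.sum_univ_three, h.1]⟩
      have := congrFun h' 0
      simp at this
    · refine ⟨![-N 1, N 0, 0], fun h' => h ?_, by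
        simp [dotProduct, Fin.sum_univ_three]; ring⟩
      have a := congrFun h' 0
      have b := congrFun h' 1
      simp at a b
      exact ⟨b, a⟩
  have he := normalize_mem hv
  set e := (Real.sqrt (v ⬝ᵥ v))⁻¹ • v with hedef
  have h1 : e ⬝ᵥ e = 1 := he
  have h2 : e ⬝ᵥ N = 0 := by rw [hedef, smul_dotProduct, hvN, smul_zero]
  refine ⟨e, crossProduct N e, h1, ?_, ?_, ?_⟩
  · rw [cross_dot_cross, hN, h1, dotProduct_comm N e, h2]; simp
  · exact dot_cross_self _ _
  · rw [cross_cross_eq_smul_sub_smul', h1, dotProduct_comm N e, h2]; simp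

def eps (e₁ e₂ : V3) (w : ℂ) : V3 := w.re • e₁ + w.im • e₂

theorem continuous_eps (e₁ e₂ : V3) : Continuous (eps e₁ e₂) := by
  unfold eps
  exact (Complex.continuous_re.smul continuous_const).add
    (Complex.continuous_im.smul continuous_const)

theorem eps_smul (e₁ e₂ : V3) (r : ℝ) (w : ℂ) : eps e₁ e₂ (r * w) = r • eps e₁ e₂ w := by
  simp [eps, smul_smul]

theorem eps_add (e₁ e₂ : V3) (w w' : ℂ) : eps e₁ e₂ (w + w') = eps e₁ e₂ w + eps e₁ e₂ w' := by
  simp [eps, add_smul]; abel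

theorem eps_zero (e₁ e₂ : V3) : eps e₁ e₂ 0 = 0 := by simp [eps]

namespace Frame
variable {N e₁ e₂ : V3}

theorem dot1 (h : Frame N e₁ e₂) (w : ℂ) : eps e₁ e₂ w ⬝ᵥ e₁ = w.re := by
  have h3 : e₂ ⬝ᵥ e₁ = 0 := by rw [dotProduct_comm, h.h12]
  simp [eps, h.h1, h3]
theorem dot2 (h : Frame N e₁ e₂) (w : ℂ) : eps e₁ e₂ w ⬝ᵥ e₂ = w.im := by
  simp [eps, h.h2, h.h12]
theorem dotN (h : Frame N e₁ e₂) (w : ℂ) : eps e₁ e₂ w ⬝ᵥ N = 0 := by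
  rw [← h.hc]
  simp [eps]
theorem inj (h : Frame N e₁ e₂) {w w' : ℂ} (he : eps e₁ e₂ w = eps e₁ e₂ w') : w = w' := by
  apply Complex.ext
  · rw [← h.dot1, he, h.dot1]
  · rw [← h.dot2, he, h.dot2]
theorem decomp (h : Frame N e₁ e₂) (hN : N ⬝ᵥ N = 1) {v : V3} (hv : v ⬝ᵥ N = 0) :
    v = eps e₁ e₂ ⟨v ⬝ᵥ e₁, v ⬝ᵥ e₂⟩ := by
  have a1 : crossProduct v N = (v ⬝ᵥ e₂) • e₁ - (v ⬝ᵥ e₁) • e₂ := by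
    rw [← h.hc, cross_cross_eq_smul_sub_smul', dotProduct_comm e₁ v]
  have a2 : crossProduct N (crossProduct v N) = v := by
    rw [cross_cross_eq_smul_sub_smul', hN, hv]; simp
  have b1 : crossProduct N e₁ = e₂ := by
    rw [← h.hc, cross_cross_eq_smul_sub_smul, h.h1, dotProduct_comm e₂, h.h12]; simp
  have b2 : crossProduct N e₂ = -e₁ := by
    rw [← h.hc, cross_cross_eq_smul_sub_smul, h.h2, h.h12]; simp
  rw [a1] at a2
  simp only [map_sub, map_smul, b1, b2] at a2
  conv_lhs => rw [← a2]
  simp [eps]; abel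
/-- Change of oriented frame is a rotation. -/
theorem change (h : Frame N e₁ e₂) (hN : N ⬝ᵥ N = 1) {f₁ f₂ : V3} (hf : Frame N f₁ f₂) :
    ∃ u : ℂ, u ≠ 0 ∧ ‖u‖ = 1 ∧ ∀ w, eps f₁ f₂ w = eps e₁ e₂ (u * w) := by
  have hf1N : f₁ ⬝ᵥ N = 0 := by rw [← hf.hc]; simp
  have e := h.decomp hN hf1N
  set u : ℂ := ⟨f₁ ⬝ᵥ e₁, f₁ ⬝ᵥ e₂⟩
  have b1 : crossProduct N e₁ = e₂ := by
    rw [← h.hc, cross_cross_eq_smul_sub_smul, h.h1, dotProduct_comm e₂, h.h12]; simp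
  have b2 : crossProduct N e₂ = -e₁ := by
    rw [← h.hc, cross_cross_eq_smul_sub_smul, h.h2, h.h12]; simp
  have b3 : crossProduct N f₁ = f₂ := by
    rw [← hf.hc, cross_cross_eq_smul_sub_smul, hf.h1, dotProduct_comm f₂, hf.h12]; simp
  have hu : u.re ^ 2 + u.im ^ 2 = 1 := by
    have := hf.h1
    rw [e] at this
    nth_rewrite 2 [eps] at this
    rw [dotProduct_add, dotProduct_smul, dotProduct_smul, h.dot1, h.dot2] at this
    simp only [smul_eq_mul] at this
    linarith
  have hn : ‖u‖ = 1 := by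
    have := nsq u
    rw [hu] at this
    nlinarith [norm_nonneg u]
  refine ⟨u, fun h0 => by simp [h0] at hn, hn, fun w => ?_⟩
  have e2 : f₂ = -u.im • e₁ + u.re • e₂ := by
    rw [← b3, e, eps, map_add, map_smul, map_smul, b1, b2]; simp; abel
  nth_rewrite 1 [eps]
  rw [e2]
  nth_rewrite 1 [e]
  simp only [eps, Complex.mul_re, Complex.mul_im]
  module
end Frame

namespace PolyCtx
variable (P : PolyCtx)

theorem other_vert (a : Fin P.nv) : ∃ a', a' ≠ a := by
  by_cases h : P.esrc (P.vedge a 0) = a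
  · exact ⟨P.etgt (P.vedge a 0), fun h' => P.edge_proper _ (h.trans h'.symm)⟩
  · exact ⟨_, h⟩

theorem vert_mem (a : Fin P.nv) : P.vert a ∈ P.Pbar := by
  rw [P.hull]; exact subset_convexHull _ _ ⟨a, rfl⟩

theorem int_near {U : Set V3} (hU : IsOpen U) {x : V3} (hx : x ∈ P.Pbar) (hxU : x ∈ U) :
    ∃ y ∈ interior P.Pbar, y ∈ U := by
  have h1 : x ∈ closure (interior P.Pbar) := by
    rw [P.convex.closure_interior_eq_closure_of_nonempty_interior P.int_nonempty]
    exact subset_closure hx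
  obtain ⟨y, hy, hy'⟩ := mem_closure_iff.1 h1 U hU hxU
  exact ⟨y, hy', hy⟩

theorem exists_ctr (a : Fin P.nv) :
    ∃ ctr ∈ interior P.Pbar, (ctr - P.cpt a) ⬝ᵥ P.Cnormal a = 0 := by
  obtain ⟨a', ha'⟩ := P.other_vert a
  have hc := dot_sub_cont (P.cpt a) (P.Cnormal a)
  obtain ⟨x, hx, hx0⟩ := P.int_near (U := {x | 0 < (x - P.cpt a) ⬝ᵥ P.Cnormal a})
    (isOpen_lt continuous_const hc) (P.vert_mem a) (P.sep_vert a)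
  obtain ⟨y, hy, hy0⟩ := P.int_near (U := {x | (x - P.cpt a) ⬝ᵥ P.Cnormal a < 0})
    (isOpen_lt hc continuous_const) (P.vert_mem a') (P.sep_other a a' ha')
  simp only [mem_ofPred_eq] at hx0 hy0
  set p := (x - P.cpt a) ⬝ᵥ P.Cnormal a with hp
  set q := (y - P.cpt a) ⬝ᵥ P.Cnormal a with hq
  have hpq : 0 < p - q := by linarith
  have hst : (-q) / (p - q) + p / (p - q) = 1 := by field_simp; ring
  refine ⟨((-q) / (p - q)) • x + (p / (p - q)) • y, P.convex.interior hx hy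
    (div_nonneg (by linarith) hpq.le) (div_nonneg hx0.le hpq.le) hst, ?_⟩
  rw [dot_combo _ _ _ _ hst, ← hp, ← hq]
  field_simp; ring

/-- Angular reparameterization data. -/
theorem exists_disc (a : Fin P.nv) : ∃ (ctr : V3) (z : ℝ → V3), ctr ∈ P.Chat a ∧
    ctr ∉ P.bdChat a ∧ PosLoopParam (P.Cnormal a) ctr z ∧ range z = P.bdChat a ∧
    (InjOn (fun w : ℂ => ‖w‖ • z w.arg + (1 - ‖w‖) • ctr) Dsk) ∧
    ((fun w : ℂ => ‖w‖ • z w.arg + (1 - ‖w‖) • ctr) '' Dsk = P.Chat a) ∧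
    (∀ w ∈ Dsk, ‖w‖ • z w.arg + (1 - ‖w‖) • ctr ∈ P.bdChat a → w ∈ Crc) ∧
    (∀ ctr' z', ctr' ∈ P.Chat a → PosLoopParam (P.Cnormal a) ctr' z' →
      range z' = P.bdChat a → ∃ ϑ : ℝ → ℝ, Continuous ϑ ∧
        (∀ φ, ϑ (φ + 2 * Real.pi) = ϑ φ + 2 * Real.pi) ∧ ∀ φ, z' φ = z (ϑ φ)) := by
  obtain ⟨ctr, hinter, hpl⟩ := P.exists_ctr a
  obtain ⟨e₁, e₂, hF⟩ := exists_frame (P.Cnormal_unit a)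
  have hN := P.Cnormal_unit a
  set N := P.Cnormal a with hNdef
  -- translated body
  set K : Set V3 := (fun x => ctr + x) ⁻¹' P.Pbar with hK
  have hKc : Convex ℝ K := P.convex.translate_preimage_right ctr
  have hK0 : K ∈ nhds (0 : V3) := by
    have : ContinuousAt (fun x => ctr + x) (0:V3) := by fun_prop
    apply this.preimage_mem_nhds
    rw [add_zero]
    exact mem_interior_iff_mem_nhds.1 hinter
  have hKfr : ∀ x, x ∈ frontier K ↔ ctr + x ∈ frontier P.Pbar := by
    intro x
    have := (Homeomorph.addLeft ctr).preimage_frontier P.Pbar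
    change x ∈ frontier ((Homeomorph.addLeft ctr) ⁻¹' P.Pbar) ↔ _
    rw [← this]; rfl
  have hKcl : IsClosed K := P.compact.isClosed.preimage (by fun_prop)
  have hKb : Bornology.IsVonNBounded ℝ K := by
    have : IsCompact K := by
      have := (Homeomorph.addLeft ctr).isCompact_preimage.2 P.compact
      exact this
    exact this.isVonNBounded ℝ
  set γ : ℂ → ℝ := fun w => gauge K (eps e₁ e₂ w) with hγ
  have hγc : Continuous γ := (continuous_gauge hKc hK0).comp (continuous_eps _ _)
  have hγpos : ∀ w, w ≠ 0 → 0 < γ w := by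
    intro w hw
    refine (gauge_pos (absorbent_nhds_zero hK0) hKb).2 fun h => hw (hF.inj ?_)
    rw [h, eps_zero]
  have hγs : ∀ (r : ℝ) (w : ℂ), 0 ≤ r → γ (r * w) = r * γ w := by
    intro r w hr
    simp only [hγ, eps_smul]
    rw [gauge_smul_of_nonneg hr, smul_eq_mul]
  have hplane : ∀ w, (ctr + eps e₁ e₂ w - P.cpt a) ⬝ᵥ N = 0 := by
    intro w
    rw [add_sub_right_comm, add_dotProduct, hpl, hF.dotN, add_zero]
  have hCh : ∀ w, ctr + eps e₁ e₂ w ∈ P.Chat a ↔ γ w ≤ 1 := by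
    intro w
    rw [mem_Chat]
    simp only [hγ]
    rw [gauge_le_one_iff_mem_closure hKc hK0, hKcl.closure_eq]
    exact ⟨fun h => h.2, fun h => ⟨hplane w, h⟩⟩
  have hbd : ∀ w, ctr + eps e₁ e₂ w ∈ P.bdChat a ↔ γ w = 1 := by
    intro w
    rw [bdChat_eq, mem_inter_iff, hCh, ← hKfr, ← gauge_eq_one_iff_mem_frontier hKc hK0]
    exact ⟨fun h => h.2, fun h => ⟨le_of_eq h, h⟩⟩
  have hcoord : ∀ x ∈ P.Chat a, ∃ w, x = ctr + eps e₁ e₂ w := by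
    intro x hx
    have h1 := (P.mem_Chat.1 hx).1
    have h2 : (x - ctr) ⬝ᵥ N = 0 := by
      have : x - ctr = (x - P.cpt a) - (ctr - P.cpt a) := by abel
      rw [this, sub_dotProduct, h1, hpl, sub_zero]
    exact ⟨_, by rw [← hF.decomp hN h2]; abel⟩
  set E : ℝ → ℂ := fun φ => Complex.exp (φ * Complex.I) with hE
  have hE0 : ∀ φ, E φ ≠ 0 := fun φ => Complex.exp_ne_zero _
  have hEc : Continuous E := by simp only [hE]; fun_prop
  have hEn : ∀ φ, ‖E φ‖ = 1 := fun φ => Complex.norm_exp_ofReal_mul_I φ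
  have hEp : ∀ φ, E (φ + 2 * Real.pi) = E φ := by
    intro φ
    simp only [hE]
    push_cast
    rw [add_mul, Complex.exp_add, Complex.exp_two_pi_mul_I, mul_one]
  have hEarg : ∀ w : ℂ, w ≠ 0 → E w.arg = ((‖w‖⁻¹ : ℝ) : ℂ) * w := by
    intro w hw
    have h1 := Complex.norm_mul_exp_arg_mul_I w
    have h2 : (‖w‖ : ℂ) ≠ 0 := by exact_mod_cast norm_ne_zero_iff.2 hw
    rw [Complex.ofReal_inv, eq_inv_mul_iff_mul_eq₀ h2]
    exact h1
  set z : ℝ → V3 := fun φ => ctr + (γ (E φ))⁻¹ • eps e₁ e₂ (E φ) with hz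
  have hzeps : ∀ φ, z φ = ctr + eps e₁ e₂ (((γ (E φ))⁻¹ : ℝ) * E φ) := by
    intro φ; rw [eps_smul]
  have hzc : Continuous z := continuous_const.add (((hγc.comp hEc).inv₀ fun φ =>
    (hγpos _ (hE0 φ)).ne').smul ((continuous_eps _ _).comp hEc))
  have hzbd : ∀ φ, z φ ∈ P.bdChat a := by
    intro φ
    have := hγpos _ (hE0 φ)
    rw [hzeps, hbd, hγs _ _ (inv_nonneg.2 this.le), inv_mul_cancel₀ this.ne']
  -- value of z at a positive multiple
  have hzray : ∀ (φ : ℝ) (ζ : ℂ), ζ ≠ 0 → E φ = ((‖ζ‖⁻¹ : ℝ) : ℂ) * ζ →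
      z φ = ctr + (γ ζ)⁻¹ • eps e₁ e₂ ζ := by
    intro φ ζ hζ he
    have h1 : 0 < ‖ζ‖ := norm_pos_iff.2 hζ
    simp only [hz]
    rw [he, hγs _ _ (inv_nonneg.2 h1.le), eps_smul, smul_smul]
    congr 2
    have := (hγpos ζ hζ).ne'
    field_simp
  have hT : ∀ w : ℂ, ‖w‖ • z w.arg + (1 - ‖w‖) • ctr =
      ctr + eps e₁ e₂ ((‖w‖ * (γ w)⁻¹ : ℝ) * w) := by
    intro w
    by_cases hw : w = 0
    · simp [hw, eps_zero]
    · rw [hzray _ w hw (hEarg w hw), eps_smul]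
      module
  have hγT : ∀ w : ℂ, γ ((‖w‖ * (γ w)⁻¹ : ℝ) * w) = ‖w‖ := by
    intro w
    by_cases hw : w = 0
    · simp [hw, hγ, eps_zero]
    · have := hγpos w hw
      rw [hγs _ _ (by positivity), mul_assoc, inv_mul_cancel₀ this.ne', mul_one]
  have hctr : ctr = ctr + eps e₁ e₂ 0 := by rw [eps_zero, add_zero]
  have hγ0 : γ 0 = 0 := by simp [hγ, eps_zero]
  refine ⟨ctr, z, ?_, ?_, ⟨hzc, ?_, e₁, e₂, hF.h1, hF.h2, hF.h12, hF.hc, id,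
    fun φ => (γ (E φ))⁻¹, continuous_id, monotone_id, fun φ => rfl, fun φ => inv_pos.2 (hγpos _ (hE0 φ)), ?_⟩, ?_, ?_, ?_, ?_, ?_⟩
  · rw [hctr, hCh, hγ0]; exact zero_le_one
  · rw [hctr, hbd, hγ0]; exact zero_ne_one
  · intro φ; simp only [hz, hEp]
  · intro φ
    simp only [hz, eps, id]
    simp only [hE]
    rw [Complex.exp_ofReal_mul_I_re, Complex.exp_ofReal_mul_I_im]
  · apply Subset.antisymm
    · rintro _ ⟨φ, rfl⟩; exact hzbd φ
    · intro x hx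
      obtain ⟨w, rfl⟩ := hcoord x (P.bdChat_sub a hx)
      have hw := (hbd w).1 hx
      have hw0 : w ≠ 0 := by rintro rfl; rw [hγ0] at hw; exact zero_ne_one hw
      exact ⟨w.arg, by rw [hzray _ w hw0 (hEarg w hw0), hw]; simp⟩
  · intro w _ w' _ he
    simp only [hT] at he
    have h1 := hF.inj (add_left_cancel he)
    have h2 : ‖w‖ = ‖w'‖ := by rw [← hγT w, h1, hγT w']
    by_cases hw : w = 0
    · rw [hw, norm_zero] at h2
      rw [hw]; exact (norm_eq_zero.1 h2.symm).symm
    · have hw' : w' ≠ 0 := fun h => hw (by rw [h, norm_zero] at h2; exact norm_eq_zero.1 h2)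
      have p1 := hγpos w hw
      have p2 := hγpos w' hw'
      have n1 : 0 < ‖w‖ := norm_pos_iff.2 hw
      have h3 : ‖w‖ * (γ w)⁻¹ * ‖w‖ = ‖w'‖ * (γ w')⁻¹ * ‖w'‖ := by
        have := congrArg norm h1
        rw [norm_mul, norm_mul, Complex.norm_real, Complex.norm_real, Real.norm_of_nonneg
          (by positivity), Real.norm_of_nonneg (by positivity)] at this
        exact this
      have h4 : ‖w‖ * (γ w)⁻¹ = ‖w'‖ * (γ w')⁻¹ := by
        rw [← h2] at h3 ⊢
        exact mul_right_cancel₀ n1.ne' h3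
      rw [h4] at h1
      refine mul_left_cancel₀ ?_ h1
      have : ‖w'‖ * (γ w')⁻¹ ≠ 0 := by rw [← h4]; positivity
      exact_mod_cast this
  · apply Subset.antisymm
    · rintro _ ⟨w, hw, rfl⟩
      simp only [hT]
      rw [hCh, hγT]
      simpa using hw
    · intro x hx
      obtain ⟨ζ, rfl⟩ := hcoord x hx
      have hζ := (hCh ζ).1 hx
      by_cases hζ0 : ζ = 0
      · exact ⟨0, by simp, by simp [hζ0, eps_zero]⟩
      · have p1 := hγpos ζ hζ0
        have n1 : 0 < ‖ζ‖ := norm_pos_iff.2 hζ0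
        have hnw : ‖((γ ζ / ‖ζ‖ : ℝ) : ℂ) * ζ‖ = γ ζ := by
          rw [norm_mul, Complex.norm_real, Real.norm_of_nonneg (by positivity)]
          field_simp
        refine ⟨((γ ζ / ‖ζ‖ : ℝ) : ℂ) * ζ, ?_, ?_⟩
        · rw [Metric.mem_closedBall, dist_zero_right, hnw]; exact hζ
        · simp only [hT]
          rw [hnw]
          rw [hγs _ _ (by positivity), ← mul_assoc, ← Complex.ofReal_mul]
          have : γ ζ * (γ ζ / ‖ζ‖ * γ ζ)⁻¹ * (γ ζ / ‖ζ‖) = 1 := by field_simp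
          rw [this]; simp
  · intro w hw h
    rw [hT, hbd, hγT] at h
    simpa using h
  · rintro ctr' z' hctr' ⟨hz'c, hz'p, f₁, f₂, g1, g2, g12, gc, θ, r, hθc, -, hθp, hr, hz'e⟩ hrange
    have hF' : Frame N f₁ f₂ := ⟨g1, g2, g12, gc⟩
    obtain ⟨u, hu0, hu1, hu⟩ := hF.change hN hF'
    obtain ⟨κ, hκ⟩ := hcoord ctr' hctr'
    set ζ' : ℝ → ℂ := fun φ => (r φ : ℂ) * (u * E (θ φ)) with hζ'
    set ζ : ℝ → ℂ := fun φ => κ + ζ' φ with hζ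
    have hz'ζ : ∀ φ, z' φ = ctr + eps e₁ e₂ (ζ φ) := by
      intro φ
      rw [hz'e, hκ, hζ, eps_add, ← add_assoc]
      congr 1
      simp only [hζ']
      rw [eps_smul, ← hu]
      simp only [eps, hE]
      rw [Complex.exp_ofReal_mul_I_re, Complex.exp_ofReal_mul_I_im]
    have hζ'0 : ∀ φ, ζ' φ ≠ 0 := fun φ =>
      mul_ne_zero (by exact_mod_cast (hr φ).ne') (mul_ne_zero hu0 (hE0 _))
    have hζγ : ∀ φ, γ (ζ φ) = 1 := by
      intro φ
      rw [← hbd, ← hz'ζ, ← hrange]; exact ⟨φ, rfl⟩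
    have hζ0 : ∀ φ, ζ φ ≠ 0 := fun φ h => by
      have := hζγ φ
      rw [h, hγ0] at this; exact zero_ne_one this
    have hζcont : Continuous ζ := by
      have : ζ = fun φ => (⟨(z' φ - ctr) ⬝ᵥ e₁, (z' φ - ctr) ⬝ᵥ e₂⟩ : ℂ) := by
        funext φ
        rw [hz'ζ, add_sub_cancel_left, hF.dot1, hF.dot2]
      rw [this]
      have h1 := (dot_sub_cont ctr e₁).comp hz'c
      have h2 := (dot_sub_cont ctr e₂).comp hz'c
      have h3 : (fun φ => (⟨(z' φ - ctr) ⬝ᵥ e₁, (z' φ - ctr) ⬝ᵥ e₂⟩ : ℂ)) =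
          fun φ => (((z' φ - ctr) ⬝ᵥ e₁ : ℝ) : ℂ) + (((z' φ - ctr) ⬝ᵥ e₂ : ℝ) : ℂ) * Complex.I := by
        funext φ; apply Complex.ext <;> simp
      rw [h3]
      exact (Complex.continuous_ofReal.comp h1).add
        ((Complex.continuous_ofReal.comp h2).mul continuous_const)
    have hζ'c : Continuous ζ' := by
      have : ζ' = fun φ => ζ φ - κ := by funext φ; simp [hζ]
      rw [this]; exact hζcont.sub continuous_const
    have hζp : ∀ φ, ζ (φ + 2 * Real.pi) = ζ φ := by
      intro φ
      apply hF.inj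
      apply add_left_cancel (a := ctr)
      rw [← hz'ζ, ← hz'ζ, hz'p]
    have hζ'p : ∀ φ, ζ' (φ + 2 * Real.pi) = ζ' φ := by
      intro φ
      have := hζp φ
      simpa [hζ] using this
    have hslit : ∀ φ, ζ φ / ζ' φ ∈ Complex.slitPlane := by
      intro φ
      rw [Complex.mem_slitPlane_iff]
      by_contra hcon
      push Not at hcon
      obtain ⟨hre, him⟩ := hcon
      set q := ζ φ / ζ' φ with hq
      set lam := -q.re with hlam
      have hq2 : ζ φ = ((-lam : ℝ) : ℂ) * ζ' φ := by
        have : q = ((-lam : ℝ) : ℂ) := by apply Complex.ext <;> simp [hlam, him]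
        rw [← this, hq, div_mul_cancel₀ _ (hζ'0 φ)]
      have hl : 0 ≤ lam := by linarith
      have hzk : ζ φ = ((lam / (1 + lam) : ℝ) : ℂ) * κ := by
        have h1 : ζ' φ = ζ φ - κ := by simp [hζ]
        rw [h1] at hq2
        have h2 : ((1 + lam : ℝ) : ℂ) ≠ 0 := by
          have : (1 + lam) ≠ 0 := by positivity
          exact_mod_cast this
        push_cast at hq2 h2 ⊢
        field_simp
        linear_combination hq2
      have hκ1 : γ κ ≤ 1 := by rw [← hCh, ← hκ]; exact hctr'
      have h1 := hζγ φ
      rw [hzk, hγs _ _ (by positivity)] at h1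
      have h2 : lam / (1 + lam) < 1 := by rw [div_lt_one (by positivity)]; linarith
      have h3 : 0 ≤ lam / (1 + lam) := by positivity
      nlinarith
    refine ⟨fun φ => θ φ + u.arg + Complex.arg (ζ φ / ζ' φ), ?_, ?_, ?_⟩
    · refine (hθc.add continuous_const).add ?_
      rw [continuous_iff_continuousAt]
      intro φ
      exact (Complex.continuousAt_arg (hslit φ)).comp (f := fun φ => ζ φ / ζ' φ)
        ((hζcont.div hζ'c hζ'0).continuousAt)
    · intro φ
      simp only [hθp, hζp, hζ'p]; ring
    · intro φ
      rw [hzray _ (ζ φ) (hζ0 φ), hζγ, inv_one, one_smul, hz'ζ]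
      have h1 : E (θ φ + u.arg + Complex.arg (ζ φ / ζ' φ)) =
          E (θ φ) * E u.arg * E (Complex.arg (ζ φ / ζ' φ)) := by
        simp only [hE]
        push_cast
        rw [add_mul, add_mul, Complex.exp_add, Complex.exp_add]
      rw [h1, hEarg u hu0, hEarg _ (div_ne_zero (hζ0 φ) (hζ'0 φ)), hu1]
      have hn' : ‖ζ' φ‖ = r φ := by
        simp only [hζ']
        rw [norm_mul, norm_mul, hu1, hEn, Complex.norm_real, Real.norm_of_nonneg (hr φ).le]; simp
      rw [norm_div, hn']
      have hrr : (r φ : ℂ) ≠ 0 := by exact_mod_cast (hr φ).ne'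
      have hzn : (‖ζ φ‖ : ℂ) ≠ 0 := by exact_mod_cast norm_ne_zero_iff.2 (hζ0 φ)
      have hE' := hE0 (θ φ)
      simp only [hζ']
      push_cast
      field_simp

end PolyCtx
end

noncomputable section
open Matrix Set MeasureTheory
open scoped Classical Quaternion

namespace PolyCtx
variable (P : PolyCtx)

theorem MemC0Phat.congr {n n' : V3 → V3} (hn : P.MemC0Phat n) (h : EqOn n' n P.PhatSet) :
    P.MemC0Phat n' := by
  refine ⟨hn.1.congr h, fun x hx => ?_, fun c x hx => ?_⟩
  · rw [h hx]; exact hn.2.1 x hx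
  · rw [h (P.Fhat_sub c hx)]; exact hn.2.2 c x hx

theorem const_contOn {n : V3 → V3} (hn : P.MemC0Phat n) :
    ContinuousOn (fun q : ℝ × V3 => n q.2) (Icc (0:ℝ) 1 ×ˢ P.PhatSet) :=
  hn.1.comp continuousOn_snd fun q hq => hq.2

theorem cleaved_homotopy {deg : (V3 → V3) → ℤ} (hdeg : DegreeTheory deg)
    {s : V3} (hs : P.AdmissibleS s) {n n1 nI : V3 → V3}
    (hn1 : P.MemC0Phat n1) (hnI : P.MemC0Phat nI)
    (hom : P.HomotopicPhat n n1) (heq : ∀ c, EqOn n1 nI (P.Fhat c)) (a : Fin P.nv)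
    (hw : ∀ w : ℤ, P.HasWrap deg s a n w ↔ P.HasWrap deg s a nI w) :
    ∃ h : ℝ × V3 → V3, ContinuousOn h (Icc (0:ℝ) 1 ×ˢ P.Chat a) ∧
      (∀ t ∈ Icc (0:ℝ) 1, ∀ x ∈ P.Chat a, h (t, x) ∈ sphereS) ∧
      (∀ x ∈ P.Chat a, h (0, x) = n1 x) ∧ (∀ x ∈ P.Chat a, h (1, x) = nI x) ∧
      (∀ t ∈ Icc (0:ℝ) 1, ∀ x ∈ P.bdChat a, h (t, x) = n1 x) := by
  obtain ⟨ctr, z, hc, hcb, hz, hzr, hinj, himg, hcrc, hind⟩ := P.exists_disc a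
  have hzm : ∀ φ, z φ ∈ P.bdChat a := fun φ => by rw [← hzr]; exact ⟨φ, rfl⟩
  have hzc : ContinuousOn (fun q : ℝ × ℝ => z q.2) (Icc (0:ℝ) 1 ×ˢ univ) :=
    (hz.1.comp continuous_snd).continuousOn
  -- n ~ n1
  have d1 : deg (wrapMap n z ctr s) = deg (wrapMap n1 z ctr s) := by
    obtain ⟨H, hH, hHm, hH0, hH1⟩ := hom
    set H' : ℝ → V3 → V3 := fun t x =>
      if x ∈ P.PhatSet then H t x else if t = 0 then n x else n1 x with hH'
    have e : ∀ t, EqOn (H' t) (H t) P.PhatSet := fun t x hx => by simp [hH', hx]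
    have e0 : H' 0 = n := by
      funext x
      by_cases hx : x ∈ P.PhatSet
      · rw [e 0 hx, hH0 x hx]
      · simp [hH', hx]
    have e1 : H' 1 = n1 := by
      funext x
      by_cases hx : x ∈ P.PhatSet
      · rw [e 1 hx, hH1 x hx]
      · simp [hH', hx]
    have := P.wrap_deg_eq hdeg hs a (n := H') (hH.congr fun q hq => e q.1 hq.2)
      (fun t ht => MemC0Phat.congr P (hHm t ht) (e t)) (z := fun _ => z) hzc
      (fun _ _ φ => hz.2.1 φ) (fun _ _ φ => hzm φ) (ctr := fun _ => ctr) continuousOn_const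
      (fun _ _ => hc)
    rwa [e0, e1] at this
  -- independence of the parameterization
  have d2 : deg (wrapMap n z ctr s) = deg (wrapMap nI z ctr s) := by
    obtain ⟨ctr', z', hc', -, hz', hzr', hd'⟩ :=
      (hw (deg (wrapMap n z ctr s))).1 ⟨ctr, z, hc, hcb, hz, hzr, rfl⟩
    rw [← hd']
    have hzm' : ∀ φ, z' φ ∈ P.bdChat a := fun φ => by rw [← hzr']; exact ⟨φ, rfl⟩
    obtain ⟨ϑ, hϑ, hϑp, hϑe⟩ := hind ctr' z' hc' hz' hzr'
    have s1 := P.wrap_deg_eq hdeg hs a (n := fun _ => nI) (P.const_contOn hnI)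
      (fun _ _ => hnI) (z := fun _ => z') (hz'.1.comp continuous_snd).continuousOn
      (fun _ _ φ => hz'.2.1 φ) (fun _ _ φ => hzm' φ)
      (ctr := fun t => (1 - t) • ctr' + t • ctr) (by fun_prop)
      (fun t ht => P.Chat_convex a hc' hc (by linarith [ht.2]) ht.1 (by ring))
    have s2 := P.wrap_deg_eq hdeg hs a (n := fun _ => nI) (P.const_contOn hnI)
      (fun _ _ => hnI) (z := fun t φ => z ((1 - t) * ϑ φ + t * φ))
      (hz.1.comp (by fun_prop)).continuousOn
      (fun t _ φ => by
        simp only [hϑp]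
        rw [← hz.2.1 ((1 - t) * ϑ φ + t * φ)]
        congr 1; ring) (fun _ _ φ => hzm _)
      (ctr := fun _ => ctr) continuousOn_const (fun _ _ => hc)
    have ez : (fun φ => z ((1 - 0) * ϑ φ + 0 * φ)) = z' := by
      funext φ; simp [hϑe φ]
    have ez1 : (fun φ => z ((1 - 1) * ϑ φ + 1 * φ)) = z := by
      funext φ; simp
    simp only [sub_zero, one_smul, zero_smul, add_zero, sub_self, zero_add] at s1
    rw [ez, ez1] at s2
    rw [s1, s2]
  have dd := d1.symm.trans d2
  have i0 : (0:ℝ) ∈ Icc (0:ℝ) 1 := by simp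
  have parts : ∀ n : V3 → V3, P.MemC0Phat n →
      ContinuousOn (polU n z ctr) Dsk ∧ ContinuousOn (polL n z s) Dsk ∧
      (∀ w ∈ Dsk, polU n z ctr w ∈ sphereS) ∧ (∀ w ∈ Dsk, polL n z s w ∈ sphereS) ∧
      ∀ w ∈ Crc, polU n z ctr w = polL n z s w := by
    intro n hn
    obtain ⟨h1, h2, h3, h4, h5⟩ := P.wrap_parts hs a (n := fun _ => n) (P.const_contOn hn)
      (fun _ _ => hn) (z := fun _ => z) hzc (fun _ _ φ => hz.2.1 φ) (fun _ _ φ => hzm φ)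
      (ctr := fun _ => ctr) continuousOn_const (fun _ _ => hc)
    exact ⟨h1.comp (f := fun w : ℂ => ((0:ℝ), w)) (by fun_prop) (fun w hw => ⟨i0, hw⟩),
      h2.comp (f := fun w : ℂ => ((0:ℝ), w)) (by fun_prop) (fun w hw => ⟨i0, hw⟩),
      h3 0 i0, h4 0 i0, h5 0 i0⟩
  obtain ⟨a1, a2, a3, a4, a5⟩ := parts n1 hn1
  obtain ⟨b1, b2, b3, b4, b5⟩ := parts nI hnI
  have hbdeq : ∀ x ∈ P.bdChat a, n1 x = nI x := by
    intro x hx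
    simp only [bdChat, mem_iUnion] at hx
    obtain ⟨c, -, hx⟩ := hx
    exact heq c hx
  have hLL : polL nI z s = polL n1 z s := by
    funext w; simp only [polL, hbdeq _ (hzm _)]
  rw [wrap_eq_glue, wrap_eq_glue, hLL] at dd
  rw [hLL] at b5
  obtain ⟨h, hh, hhm, hh0, hh1, hhb⟩ := disc_homotopy hdeg a1 b1 a2 a3 b3 a4 a5 b5 dd
  set T : ℂ → V3 := fun w => ‖w‖ • z w.arg + (1 - ‖w‖) • ctr with hT
  have hTc : ContinuousOn T Dsk := by
    have := polar_cont (G := fun _ ρ φ => ρ • z φ + (1 - ρ) • ctr)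
      (by
        have := hz.1
        fun_prop) (fun t _ ρ φ => by simp only [hz.2.1])
      (fun t _ φ φ' => by simp)
    exact this.comp (f := fun w : ℂ => ((0:ℝ), w)) (by fun_prop) (fun w hw => ⟨i0, hw⟩)
  set S := Function.invFunOn T Dsk with hS
  have hST : ∀ w ∈ Dsk, S (T w) = w := fun w hw => hinj.leftInvOn_invFunOn hw
  have hSm : ∀ x ∈ P.Chat a, S x ∈ Dsk ∧ T (S x) = x := by
    intro x hx
    rw [← himg] at hx
    obtain ⟨w, hw, rfl⟩ := hx
    change S (T w) ∈ Dsk ∧ T (S (T w)) = T w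
    rw [hST w hw]; exact ⟨hw, rfl⟩
  refine ⟨fun p => h (p.1, S p.2), ?_, fun t ht x hx => hhm t ht _ (hSm x hx).1,
    fun x hx => ?_, fun x hx => ?_, fun t ht x hx => ?_⟩
  · have key := contOn_image_of_comp (S := Icc (0:ℝ) 1 ×ˢ Dsk)
      (isCompact_Icc.prod (isCompact_closedBall 0 1)) (q := fun p => (p.1, T p.2))
      (continuousOn_fst.prodMk (hTc.comp continuousOn_snd fun p hp => hp.2))
      (f := fun p => h (p.1, S p.2)) hh (fun p hp => by simp only [hST _ hp.2])
    refine key.mono ?_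
    rintro ⟨t, x⟩ ⟨ht, hx⟩
    exact ⟨(t, S x), ⟨ht, (hSm x hx).1⟩, by simp only [(hSm x hx).2]⟩
  · change h (0, S x) = n1 x
    rw [hh0 _ (hSm x hx).1]
    change n1 (T (S x)) = _
    rw [(hSm x hx).2]
  · change h (1, S x) = nI x
    rw [hh1 _ (hSm x hx).1]
    change nI (T (S x)) = _
    rw [(hSm x hx).2]
  · have hx' := hSm x (P.bdChat_sub a hx)
    change h (t, S x) = n1 x
    rw [hhb t ht _ (hcrc _ hx'.1 (by rw [← hx'.2] at hx; exact hx))]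
    change n1 (T (S x)) = _
    rw [hx'.2]

end PolyCtx
end

noncomputable section
open Matrix Set MeasureTheory
open scoped Classical Quaternion

theorem dot3 (u v : V3) : u ⬝ᵥ v = u 0 * v 0 + u 1 * v 1 + u 2 * v 2 := by
  simp [dotProduct, Fin.sum_univ_three]

theorem ext3 {u v : V3} (h0 : u 0 = v 0) (h1 : u 1 = v 1) (h2 : u 2 = v 2) : u = v := by
  funext i; fin_cases i <;> assumption

/-- if `F` unit, `w` with `F·w = 0` and `F×w = 0` then `w=0`. -/
theorem cross_par {F w : V3} (hF : F ⬝ᵥ F = 1) (h : crossProduct F w = 0) :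
    w = (F ⬝ᵥ w) • F := by
  have h0 := congrFun h 0
  have h1 := congrFun h 1
  have h2 := congrFun h 2
  simp [cross_apply] at h0 h1 h2
  rw [dot3] at hF
  apply ext3 <;> simp only [Pi.smul_apply, smul_eq_mul, dot3]
  · linear_combination (-w 0) * hF - F 1 * h2 + F 2 * h1
  · linear_combination (-w 1) * hF - F 2 * h0 + F 0 * h2
  · linear_combination (-w 2) * hF - F 0 * h1 + F 1 * h0

theorem cross_perp {F u v : V3} (hF : F ⬝ᵥ F = 1) (hu : u ⬝ᵥ F = 0) (hv : v ⬝ᵥ F = 0) :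
    crossProduct u v = (F ⬝ᵥ crossProduct u v) • F := by
  apply cross_par hF
  rw [dot3] at hu hv
  apply ext3 <;> simp [cross_apply]
  · linear_combination u 0 * hv - v 0 * hu
  · linear_combination u 1 * hv - v 1 * hu
  · linear_combination u 2 * hv - v 2 * hu

theorem cramer2 {F u v w : V3} (hF : F ⬝ᵥ F = 1) (hu : u ⬝ᵥ F = 0) (hv : v ⬝ᵥ F = 0)
    (hw : w ⬝ᵥ F = 0) :
    (F ⬝ᵥ crossProduct u v) • w =
      (F ⬝ᵥ crossProduct w v) • u + (F ⬝ᵥ crossProduct u w) • v := by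
  have hd : w ⬝ᵥ crossProduct u v = 0 := by
    rw [cross_perp hF hu hv]; simp [hw]
  simp only [dot3] at *
  simp [cross_apply] at *
  apply ext3 <;> simp
  · linear_combination F 0 * hd
  · linear_combination F 1 * hd
  · linear_combination F 2 * hd

/-- two normals both orthogonal to independent `u v` are parallel -/
theorem normals_par {F G u v : V3} (hF : F ⬝ᵥ F = 1) (hu : u ⬝ᵥ F = 0) (hv : v ⬝ᵥ F = 0)
    (huv : crossProduct u v ≠ 0) (hu' : u ⬝ᵥ G = 0) (hv' : v ⬝ᵥ G = 0) :
    crossProduct F G = 0 := by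
  have h := cross_perp hF hu hv
  have hω : F ⬝ᵥ crossProduct u v ≠ 0 := fun h0 => by rw [h0, zero_smul] at h; exact huv h
  have : (F ⬝ᵥ crossProduct u v) • crossProduct F G = 0 := by
    have e : crossProduct (crossProduct u v) G = 0 := by
      rw [dot3] at hu' hv'
      apply ext3 <;> simp [cross_apply]
      · linear_combination (-u 0) * hv' + v 0 * hu'
      · linear_combination (-u 1) * hv' + v 1 * hu'
      · linear_combination (-u 2) * hv' + v 2 * hu'
    rw [h] at e
    simpa using e
  exact (smul_eq_zero.1 this).resolve_left hω

namespace PolyCtx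
variable (P : PolyCtx)

theorem no_between {a b c : Fin P.nv} (hb : b ≠ a) (hc : c ≠ a) {s t : ℝ} (hs : 0 ≤ s) (ht : 0 ≤ t)
    (hst : s + t = 1) : P.vert a ≠ s • P.vert b + t • P.vert c := by
  intro h
  have h1 := P.sep_vert a
  rw [h, dot_combo _ _ _ _ hst] at h1
  have h2 := P.sep_other a b hb
  have h3 := P.sep_other a c hc
  nlinarith

theorem noncollinear {a b c : Fin P.nv} (hb : b ≠ a) (hc : c ≠ a) (hbc : b ≠ c) :
    crossProduct (P.vert b - P.vert a) (P.vert c - P.vert a) ≠ 0 := by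
  intro h
  set u := P.vert b - P.vert a with hu
  set v := P.vert c - P.vert a with hv
  have hvne : v ≠ 0 := fun h => hc (P.vert_inj (sub_eq_zero.1 h))
  have hvp := dot_self_pos' hvne
  -- u = k v
  obtain ⟨k, hk⟩ : ∃ k : ℝ, u = k • v := by
    refine ⟨(u ⬝ᵥ v) / (v ⬝ᵥ v), ?_⟩
    have h0 := congrFun h 0
    have h1 := congrFun h 1
    have h2 := congrFun h 2
    simp [cross_apply] at h0 h1 h2
    rw [div_eq_inv_mul, mul_smul, eq_inv_smul_iff₀ hvp.ne']
    simp only [dot3]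
    apply ext3 <;> simp
    · linear_combination v 1 * h2 - v 2 * h1
    · linear_combination v 2 * h0 - v 0 * h2
    · linear_combination v 0 * h1 - v 1 * h0
  have eb : P.vert b = P.vert a + k • v := by rw [← hk, hu]; abel
  have ec : P.vert c = P.vert a + v := by rw [hv]; abel
  rcases le_total k 0 with hk0 | hk0
  · have : 0 < 1 - k := by linarith
    refine P.no_between hb hc (s := 1 / (1 - k)) (t := -k / (1 - k)) (by positivity)
      (div_nonneg (by linarith) this.le) (by field_simp; ring) ?_
    rw [eb, ec]
    apply ext3 <;> simp <;> field_simp <;> ring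
  · rcases le_total k 1 with hk1 | hk1
    · refine P.no_between (a := b) hb.symm hbc.symm (s := 1 - k) (t := k) (by linarith) hk0
        (by ring) ?_
      rw [eb, ec]
      apply ext3 <;> simp <;> ring
    · have : 0 < k := by linarith
      refine P.no_between (a := c) hc.symm hbc (s := 1 - 1 / k) (t := 1 / k)
        (by rw [sub_nonneg, div_le_one this]; exact hk1) (by positivity) (by ring) ?_
      rw [eb, ec]
      apply ext3 <;> simp <;> field_simp <;> ring

/-- A corner of the face `c` at the vertex `a`, with adjacent edges `b1`, `b2`. -/
structure Corner (c : Fin P.nf) (a a1 a2 : Fin P.nv) (b1 b2 : Fin P.ne) : Prop where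
  h1 : a1 ≠ a
  h2 : a2 ≠ a
  h12 : a1 ≠ a2
  e1 : P.edge b1 = segment ℝ (P.vert a) (P.vert a1)
  e2 : P.edge b2 = segment ℝ (P.vert a) (P.vert a2)
  s1 : P.edge b1 ⊆ P.face c
  s2 : P.edge b2 ⊆ P.face c

theorem fvert_mod (c : Fin P.nf) (i : ℕ) : P.fvert c (i % P.m c) = P.fvert c i := by
  have : ∀ k j, P.fvert c (j + k * P.m c) = P.fvert c j := by
    intro k
    induction k with
    | zero => simp
    | succ k ih => intro j; rw [Nat.succ_mul, ← add_assoc, P.fvert_per, ih]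
  conv_rhs => rw [← Nat.mod_add_div i (P.m c), mul_comm]
  rw [this]

theorem fvert_ne (c : Fin P.nf) (i j : ℕ) (h : i % P.m c ≠ j % P.m c) :
    P.fvert c i ≠ P.fvert c j := by
  rw [← P.fvert_mod c i, ← P.fvert_mod c j]
  have hm : 0 < P.m c := by have := P.m_ge c; omega
  rcases lt_or_gt_of_ne h with h | h
  · exact P.fvert_inj c _ _ h (Nat.mod_lt _ hm)
  · exact (P.fvert_inj c _ _ h (Nat.mod_lt _ hm)).symm

theorem mod_ne {m : ℕ} (hm : 3 ≤ m) (i k : ℕ) (hk : 0 < k) (hk' : k < 3) : i % m ≠ (i + k) % m := by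
  intro h
  have : (i + 0) ≡ (i + k) [MOD m] := h
  have := Nat.ModEq.add_left_cancel' i this
  have := (Nat.modEq_zero_iff_dvd.1 this.symm)
  have := Nat.le_of_dvd hk this
  omega

theorem corner_of (c : Fin P.nf) (i : ℕ) : P.Corner c (P.fvert c (i + 1)) (P.fvert c i)
    (P.fvert c (i + 2)) (P.fedge c i) (P.fedge c (i + 1)) where
  h1 := P.fvert_ne c _ _ (mod_ne (P.m_ge c) i 1 (by omega) (by omega))
  h2 := (P.fvert_ne c _ _ (mod_ne (P.m_ge c) (i + 1) 1 (by omega) (by omega))).symm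
  h12 := P.fvert_ne c _ _ (mod_ne (P.m_ge c) i 2 (by omega) (by omega))
  e1 := by rw [P.fedge_seg, segment_symm]
  e2 := P.fedge_seg c (i + 1)
  s1 := P.fedge_sub c i
  s2 := P.fedge_sub c (i + 1)

variable {P}
namespace Corner
variable {c : Fin P.nf} {a a1 a2 : Fin P.nv} {b1 b2 : Fin P.ne}

theorem symm (h : P.Corner c a a1 a2 b1 b2) : P.Corner c a a2 a1 b2 b1 :=
  ⟨h.h2, h.h1, h.h12.symm, h.e2, h.e1, h.s2, h.s1⟩

theorem va (h : P.Corner c a a1 a2 b1 b2) : P.vert a ∈ P.edge b1 := by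
  rw [h.e1]; exact left_mem_segment _ _ _
theorem v1 (h : P.Corner c a a1 a2 b1 b2) : P.vert a1 ∈ P.edge b1 := by
  rw [h.e1]; exact right_mem_segment _ _ _

theorem dF {c : Fin P.nf} {x y : V3} (hx : x ∈ P.face c) (hy : y ∈ P.face c) :
    (x - y) ⬝ᵥ P.Fnormal c = 0 := by
  rw [mem_face] at hx hy
  rw [sub_dotProduct, hx.2, hy.2, sub_self]

theorem d1F (h : P.Corner c a a1 a2 b1 b2) : (P.vert a1 - P.vert a) ⬝ᵥ P.Fnormal c = 0 :=
  dF (h.s1 h.v1) (h.s1 h.va)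

theorem wedge1 (h : P.Corner c a a1 a2 b1 b2) : ∃ c1, P.edge b1 ⊆ P.face c1 ∧
    (P.vert a1 - P.vert a) ⬝ᵥ P.Fnormal c1 = 0 ∧ (P.vert a2 - P.vert a) ⬝ᵥ P.Fnormal c1 < 0 := by
  obtain ⟨c', c'', h', h'', hne⟩ := P.edge_two_faces b1
  obtain ⟨c1, hc1, hp⟩ : ∃ c1, P.edge b1 ⊆ P.face c1 ∧
      crossProduct (P.Fnormal c) (P.Fnormal c1) ≠ 0 := by
    by_contra hcon
    push Not at hcon
    have e1 := cross_par (P.Fnormal_unit c) (hcon c' h')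
    have e2 := cross_par (P.Fnormal_unit c) (hcon c'' h'')
    apply hne
    rw [e1, e2]
    simp
  refine ⟨c1, hc1, dF (hc1 h.v1) (hc1 h.va), ?_⟩
  have ha := (mem_face _).1 (hc1 h.va)
  have hle : (P.vert a2 - P.vert a) ⬝ᵥ P.Fnormal c1 ≤ 0 := by
    have := P.face_supp c1 _ (P.vert_mem a2)
    rw [sub_dotProduct, ha.2]; linarith
  refine lt_of_le_of_ne hle fun h0 => hp ?_
  exact normals_par (P.Fnormal_unit c) h.d1F h.symm.d1F (P.noncollinear h.h1 h.h2 h.h12)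
    (dF (hc1 h.v1) (hc1 h.va)) h0

theorem wedge (h : P.Corner c a a1 a2 b1 b2) {x : V3} (hx : x ∈ P.face c) :
    ∃ α β : ℝ, 0 ≤ α ∧ 0 ≤ β ∧
      x = P.vert a + α • (P.vert a1 - P.vert a) + β • (P.vert a2 - P.vert a) := by
  set d1 := P.vert a1 - P.vert a
  set d2 := P.vert a2 - P.vert a
  have hx0 : (x - P.vert a) ⬝ᵥ P.Fnormal c = 0 := dF hx (h.s1 h.va)
  have hcr := cramer2 (P.Fnormal_unit c) h.d1F h.symm.d1F hx0
  have hω : P.Fnormal c ⬝ᵥ crossProduct d1 d2 ≠ 0 := fun h0 => by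
    have := cross_perp (P.Fnormal_unit c) h.d1F h.symm.d1F
    change crossProduct d1 d2 = _ at this
    rw [h0, zero_smul] at this
    exact P.noncollinear h.h1 h.h2 h.h12 this
  set ω := P.Fnormal c ⬝ᵥ crossProduct d1 d2
  obtain ⟨α, β, he⟩ : ∃ α β : ℝ, x - P.vert a = α • d1 + β • d2 := by
    refine ⟨ω⁻¹ * (P.Fnormal c ⬝ᵥ crossProduct (x - P.vert a) d2),
      ω⁻¹ * (P.Fnormal c ⬝ᵥ crossProduct d1 (x - P.vert a)), ?_⟩
    rw [mul_smul, mul_smul, ← smul_add, eq_inv_smul_iff₀ hω]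
    exact hcr
  obtain ⟨c1, hc1, k1, k2⟩ := h.wedge1
  obtain ⟨c2, hc2, k3, k4⟩ := h.symm.wedge1
  have hxP := ((mem_face _).1 hx).1
  refine ⟨α, β, ?_, ?_, ?_⟩
  · have f1 := P.face_supp c2 x hxP
    have f2 := ((mem_face _).1 (hc2 h.symm.va)).2
    have f3 : (x - P.vert a) ⬝ᵥ P.Fnormal c2 ≤ 0 := by rw [sub_dotProduct, f2]; linarith
    rw [he] at f3
    simp only [add_dotProduct, smul_dotProduct, smul_eq_mul] at f3
    change d2 ⬝ᵥ _ = 0 at k3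
    change d1 ⬝ᵥ _ < 0 at k4
    rw [k3] at f3
    by_contra hα; push Not at hα
    nlinarith
  · have f1 := P.face_supp c1 x hxP
    have f2 := ((mem_face _).1 (hc1 h.va)).2
    have f3 : (x - P.vert a) ⬝ᵥ P.Fnormal c1 ≤ 0 := by rw [sub_dotProduct, f2]; linarith
    rw [he] at f3
    simp only [add_dotProduct, smul_dotProduct, smul_eq_mul] at f3
    change d1 ⬝ᵥ _ = 0 at k1
    change d2 ⬝ᵥ _ < 0 at k2
    rw [k1] at f3
    by_contra hα; push Not at hα
    nlinarith
  · rw [add_assoc, ← he]; abel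

end Corner
variable (P)

theorem edge_or {c c' : Fin P.nf} (hp : crossProduct (P.Fnormal c) (P.Fnormal c') ≠ 0) {x : V3}
    (hx : x ∈ P.face c) (hx' : x ∈ P.face c') : ∃ i, x ∈ P.edge (P.fedge c i) := by
  have hm : (Finset.range (P.m c)).Nonempty := by
    have := P.m_ge c
    exact ⟨0, by simp; omega⟩
  set g : V3 → ℝ := fun y => y ⬝ᵥ P.Fnormal c' with hg
  obtain ⟨i0, -, hi0⟩ := Finset.exists_max_image (Finset.range (P.m c))
    (fun i => g (P.vert (P.fvert c i))) hm
  have hi0' : ∀ j, g (P.vert (P.fvert c j)) ≤ g (P.vert (P.fvert c i0)) := fun j => by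
    rw [← P.fvert_mod c j]
    exact hi0 _ (Finset.mem_range.2 (Nat.mod_lt _ (by have := P.m_ge c; omega)))
  obtain ⟨i, hi⟩ : ∃ i, ∀ j, g (P.vert (P.fvert c j)) ≤ g (P.vert (P.fvert c (i + 1))) := by
    refine ⟨i0 + P.m c - 1, fun j => ?_⟩
    have : i0 + P.m c - 1 + 1 = i0 + P.m c := by have := P.m_ge c; omega
    rw [this, P.fvert_per]; exact hi0' j
  have hc := P.corner_of c i
  have hc2 := P.corner_of c (i + 1)
  have hc0 := P.corner_of c (i + P.m c - 1)
  have em : i + P.m c - 1 + 1 = i + P.m c := by have := P.m_ge c; omega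
  have em2 : i + P.m c - 1 + 2 = i + 1 + P.m c := by have := P.m_ge c; omega
  rw [em, em2, P.fvert_per, P.fvert_per, P.fedge_per] at hc0
  set p := P.vert (P.fvert c (i + 1))
  set q1 := P.vert (P.fvert c i)
  set q2 := P.vert (P.fvert c (i + 2))
  have g1 : g q1 ≤ g p := hi _
  have g2 : g q2 ≤ g p := hi _
  obtain ⟨α, β, hα, hβ, he⟩ := hc.wedge hx
  change x = p + α • (q1 - p) + β • (q2 - p) at he
  have gx : g x = P.foffset c' := ((mem_face _).1 hx').2
  have gp : g p ≤ P.foffset c' := P.face_supp c' _ (P.vert_mem _)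
  have ge : g x = g p + α * (g q1 - g p) + β * (g q2 - g p) := by
    rw [he]; simp only [hg, add_dotProduct, smul_dotProduct, sub_dotProduct, smul_eq_mul]
  have m1 : α * (g q1 - g p) ≤ 0 := mul_nonpos_of_nonneg_of_nonpos hα (by linarith)
  have m2 : β * (g q2 - g p) ≤ 0 := mul_nonpos_of_nonneg_of_nonpos hβ (by linarith)
  have z1 : α * (g q1 - g p) = 0 := by linarith
  have z2 : β * (g q2 - g p) = 0 := by linarith
  -- ray lemma
  have ray : ∀ {a a1 a2 a3 : Fin P.nv} {b1 b2 b3 : Fin P.ne}, P.Corner c a1 a a3 b1 b3 →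
      P.Corner c a a1 a2 b1 b2 → ∀ τ : ℝ, 0 ≤ τ → x = P.vert a + τ • (P.vert a1 - P.vert a) →
      x ∈ P.edge b1 := by
    intro a a1 a2 a3 b1 b2 b3 k1 k2 τ hτ hxe
    rw [k2.e1]
    rcases le_or_gt τ 1 with h1 | h1
    · refine ⟨1 - τ, τ, by linarith, hτ, by ring, ?_⟩
      rw [hxe]; module
    · exfalso
      obtain ⟨c1, hc1, w1, w2⟩ := k1.symm.wedge1
      -- face c1 contains b3, vert a1 in it, vert a strictly negative
      have f1 := P.face_supp c1 x ((mem_face _).1 hx).1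
      have f2 := ((mem_face _).1 (hc1 k1.symm.va)).2
      rw [sub_dotProduct, f2] at w2
      rw [hxe] at f1
      simp only [add_dotProduct, smul_dotProduct, sub_dotProduct, smul_eq_mul, f2] at f1
      nlinarith
  rcases lt_or_eq_of_le g1 with l1 | l1
  · have : α = 0 := (mul_eq_zero.1 z1).resolve_right (by linarith)
    rw [this, zero_smul, add_zero] at he
    exact ⟨_, ray hc2 hc.symm β hβ he⟩
  · rcases lt_or_eq_of_le g2 with l2 | l2
    · have : β = 0 := (mul_eq_zero.1 z2).resolve_right (by linarith)
      rw [this, zero_smul, add_zero] at he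
      exact ⟨_, ray hc0.symm hc α hα he⟩
    · exfalso
      exact hp (normals_par (P.Fnormal_unit c) hc.d1F hc.symm.d1F
        (P.noncollinear hc.h1 hc.h2 hc.h12)
        (by simp only [sub_dotProduct]; exact sub_eq_zero.2 l1)
        (by simp only [sub_dotProduct]; exact sub_eq_zero.2 l2))

end PolyCtx
end

noncomputable section
open Matrix Set MeasureTheory
open scoped Classical Quaternion

def eI (θ : ℝ) : ℂ := Complex.exp (θ * Complex.I)

theorem eI_add (a b : ℝ) : eI (a + b) = eI a * eI b := by
  simp [eI, add_mul, Complex.exp_add]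
theorem eI_ne (a : ℝ) : eI a ≠ 0 := Complex.exp_ne_zero _
theorem eI_zero : eI 0 = 1 := by simp [eI]
theorem eI_eq_one {a : ℝ} : eI a = 1 ↔ ∃ k : ℤ, a = 2 * Real.pi * k := by
  rw [eI, Complex.exp_eq_one_iff]
  refine exists_congr fun k => ?_
  constructor
  · intro h
    have := congrArg Complex.im h
    simp at this
    linarith
  · rintro rfl
    push_cast; ring
theorem eI_sub {a b : ℝ} (h : eI a = eI b) : eI (a - b) = 1 := by
  have := eI_add (a - b) b
  rw [sub_add_cancel, h] at this
  exact (mul_eq_right₀ (eI_ne b)).1 this.symm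
theorem continuous_eI : Continuous eI := by unfold eI; fun_prop

theorem Frame.crossN1 {N e₁ e₂ : V3} (h : Frame N e₁ e₂) : crossProduct N e₁ = e₂ := by
  rw [← h.hc, cross_cross_eq_smul_sub_smul, h.h1, dotProduct_comm e₂, h.h12]; simp
theorem Frame.crossN2 {N e₁ e₂ : V3} (h : Frame N e₁ e₂) : crossProduct N e₂ = -e₁ := by
  rw [← h.hc, cross_cross_eq_smul_sub_smul, h.h2, h.h12]; simp

theorem rot_eps {N e₁ e₂ : V3} (h : Frame N e₁ e₂) (ψ : ℝ) (w : ℂ) :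
    rot3 N ψ (eps e₁ e₂ w) = eps e₁ e₂ (eI ψ * w) := by
  have hd : N ⬝ᵥ eps e₁ e₂ w = 0 := by rw [dotProduct_comm, h.dotN]
  have hc : crossProduct N (eps e₁ e₂ w) = w.re • e₂ - w.im • e₁ := by
    simp only [eps, map_add, map_smul, h.crossN1, h.crossN2]
    module
  have e : eI ψ = ⟨Real.cos ψ, Real.sin ψ⟩ := by
    apply Complex.ext <;> simp [eI, Complex.exp_ofReal_mul_I_re, Complex.exp_ofReal_mul_I_im]
  rw [rot3, hd, hc, e]
  simp only [eps, Complex.mul_re, Complex.mul_im]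
  module

theorem int_const {E : Type*} [TopologicalSpace E] {S : Set E} (hS : IsPreconnected S) {φ : E → ℝ}
    (hφ : ContinuousOn φ S) (h1 : ∀ x ∈ S, eI (φ x) = 1) {x y : E} (hx : x ∈ S) (hy : y ∈ S) :
    φ x = φ y := by
  by_contra hne
  wlog hlt : φ x < φ y generalizing x y
  · exact this hy hx (Ne.symm hne) (lt_of_le_of_ne (not_lt.1 hlt) (Ne.symm hne))
  obtain ⟨j, hj⟩ := eI_eq_one.1 (h1 x hx)
  obtain ⟨k, hk⟩ := eI_eq_one.1 (h1 y hy)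
  have hpi := Real.pi_pos
  have hjk : j < k := by
    rw [hj, hk] at hlt
    have := lt_of_mul_lt_mul_left hlt (by positivity)
    exact_mod_cast this
  have hjk' : (j:ℝ) + 1 ≤ k := by exact_mod_cast hjk
  have := hS.intermediate_value hx hy hφ
  obtain ⟨z, hz, hze⟩ := this (show φ x + Real.pi ∈ Icc (φ x) (φ y) from
    ⟨by linarith, by rw [hj, hk]; nlinarith⟩)
  obtain ⟨l, hl⟩ := eI_eq_one.1 (h1 z hz)
  rw [hze, hj] at hl
  have : 2 * (j:ℝ) + 1 = 2 * l := by
    have : Real.pi * (2 * (j:ℝ) + 1) = Real.pi * (2 * l) := by linarith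
    exact mul_left_cancel₀ hpi.ne' this
  have : 2 * j + 1 = 2 * l := by exact_mod_cast this
  omega

theorem kink_angle {N e₁ e₂ : V3} (h : Frame N e₁ e₂) {n : V3 → V3} {z : ℝ → V3} {θ : ℝ → ℝ}
    (hθ : ContinuousOn θ (Icc 0 1)) (hn : ∀ t ∈ Icc (0:ℝ) 1, n (z t) = eps e₁ e₂ (eI (θ t)))
    (κ : ℤ) : IsKinkAlong N n z κ ↔
      ∃ η ∈ Ioo (-Real.pi) Real.pi, eI (θ 1) = eI η * eI (θ 0) ∧
        2 * Real.pi * (κ:ℝ) = θ 1 - θ 0 - η := by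
  have i0 : (0:ℝ) ∈ Icc (0:ℝ) 1 := by simp
  have i1 : (1:ℝ) ∈ Icc (0:ℝ) 1 := by simp
  constructor
  · rintro ⟨ξ, hξ, hξ0, hξn, η, hη, hηn, hk⟩
    refine ⟨η, hη, ?_, ?_⟩
    · rw [hn 1 i1, hn 0 i0, rot_eps h] at hηn
      exact h.inj hηn
    · have hcon := int_const (S := Icc (0:ℝ) 1) isPreconnected_Icc
        (φ := fun t => ξ t + θ 0 - θ t) (by fun_prop) (fun t ht => by
          apply eI_sub
          have := hξn t ht
          rw [hn t ht, hn 0 i0, rot_eps h] at this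
          rw [eI_add]; exact (h.inj this).symm) i0 i1
      simp only [hξ0] at hcon
      linarith
  · rintro ⟨η, hη, he, hk⟩
    refine ⟨fun t => θ t - θ 0, by fun_prop, by simp, fun t ht => ?_, η, hη, ?_, hk⟩
    · rw [hn t ht, hn 0 i0, rot_eps h, ← eI_add, sub_add_cancel]
    · rw [hn 1 i1, hn 0 i0, rot_eps h, he]

theorem eta_unique {η η' : ℝ} (h : η ∈ Ioo (-Real.pi) Real.pi) (h' : η' ∈ Ioo (-Real.pi) Real.pi)
    (he : eI η = eI η') : η = η' := by
  have e1 : ∀ x ∈ Ioo (-Real.pi) Real.pi, (eI x).arg = x := fun x hx => by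
    rw [eI, Complex.arg_exp_mul_I, toIocMod_eq_self]
    exact ⟨hx.1, by linarith [hx.2]⟩
  rw [← e1 η h, he, e1 η' h']

theorem eta_exists {a b : ℝ} (h : eI a ≠ - eI b) : ∃ η ∈ Ioo (-Real.pi) Real.pi,
    ∃ κ : ℤ, eI a = eI η * eI b ∧ 2 * Real.pi * (κ:ℝ) = a - b - η := by
  set η := (eI (a - b)).arg with hη
  have hee : eI η = eI (a - b) := by
    have := Complex.norm_mul_exp_arg_mul_I (eI (a - b))
    rw [eI] at this
    rw [Complex.norm_exp_ofReal_mul_I] at this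
    simpa [hη, eI] using this
  have hab : eI a = eI η * eI b := by rw [hee, ← eI_add, sub_add_cancel]
  refine ⟨η, ⟨Complex.neg_pi_lt_arg _, lt_of_le_of_ne (Complex.arg_le_pi _) fun hp => h ?_⟩, ?_⟩
  · change η = Real.pi at hp
    rw [hab, hp]; simp [eI, Complex.exp_pi_mul_I]
  · obtain ⟨k, hk⟩ := eI_eq_one.1 (eI_sub hee.symm)
    exact ⟨k, hab, hk.symm⟩

namespace PolyCtx
variable (P : PolyCtx)

theorem face_angle {n : V3 → V3} (hn : P.MemC0Phat n) (c : Fin P.nf) {e₁ e₂ : V3}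
    (h : Frame (P.Fnormal c) e₁ e₂) : ∃ θ : V3 → ℝ, ContinuousOn θ (P.Fhat c) ∧
      ∀ x ∈ P.Fhat c, n x = eps e₁ e₂ (eI (θ x)) := by
  set f : V3 → ℂ := fun x => (((n x ⬝ᵥ e₁ : ℝ)) : ℂ) + ((n x ⬝ᵥ e₂ : ℝ) : ℂ) * Complex.I with hf
  have hnc := hn.1.mono (P.Fhat_sub c)
  have hfc : ContinuousOn f (P.Fhat c) := by
    have h1 := hnc.dot3 (continuousOn_const (c := e₁))
    have h2 := hnc.dot3 (continuousOn_const (c := e₂))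
    exact (Complex.continuous_ofReal.comp_continuousOn h1).add
      ((Complex.continuous_ofReal.comp_continuousOn h2).mul continuousOn_const)
  have hfe : ∀ x ∈ P.Fhat c, n x = eps e₁ e₂ (f x) := fun x hx => by
    have := h.decomp (P.Fnormal_unit c) (hn.2.2 c x hx)
    have e : f x = ⟨n x ⬝ᵥ e₁, n x ⬝ᵥ e₂⟩ := by apply Complex.ext <;> simp [hf]
    rw [e]; exact this
  have hfn : ∀ x ∈ P.Fhat c, ‖f x‖ = 1 := fun x hx => by
    have h1 : n x ⬝ᵥ n x = 1 := hn.2.1 x (P.Fhat_sub c hx)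
    rw [hfe x hx] at h1
    simp only [eps, add_dotProduct, dotProduct_add, smul_dotProduct, dotProduct_smul, h.h1, h.h2,
      h.h12, dotProduct_comm e₂ e₁, smul_eq_mul] at h1
    have : Complex.normSq (f x) = 1 := by rw [Complex.normSq_apply]; linarith
    rw [Complex.normSq_eq_norm_sq] at this
    nlinarith [norm_nonneg (f x)]
  obtain ⟨g, hg, hge⟩ := exists_log (P.Fhat_compact c) (P.Fhat_convex c) hfc
    (fun x hx h0 => by have := hfn x hx; rw [h0] at this; simp at this)
  refine ⟨fun x => (g x).im, Complex.continuous_im.comp_continuousOn hg, fun x hx => ?_⟩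
  rw [hfe x hx, ← hge x hx]
  have hr : (g x).re = 0 := by
    have := hfn x hx
    rw [← hge x hx, Complex.norm_exp] at this
    exact (Real.exp_eq_one_iff _).1 this
  congr 1
  rw [eI]; congr 1
  apply Complex.ext <;> simp [hr]

end PolyCtx
end

noncomputable section
open Matrix Set MeasureTheory
open scoped Classical Quaternion

theorem seg_param {y D : V3} (hD : D ≠ 0) {z : ℝ → V3} (hz : ContinuousOn z (Icc 0 1))
    (hi : InjOn z (Icc 0 1)) (him : z '' Icc 0 1 = (fun t : ℝ => y + t • D) '' Icc 0 1) :
    (z 0 = y ∧ z 1 = y + D) ∨ (z 0 = y + D ∧ z 1 = y) := by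
  have hDp := dot_self_pos' hD
  set u : ℝ → ℝ := fun t => (D ⬝ᵥ D)⁻¹ * ((z t - y) ⬝ᵥ D) with hu
  have huz : ∀ t ∈ Icc (0:ℝ) 1, u t ∈ Icc (0:ℝ) 1 ∧ z t = y + u t • D := by
    intro t ht
    obtain ⟨r, hr, hre⟩ : z t ∈ (fun t : ℝ => y + t • D) '' Icc 0 1 := him ▸ ⟨t, ht, rfl⟩
    have : u t = r := by
      simp only [hu, ← hre]
      simp
      field_simp
    rw [this]; exact ⟨hr, hre.symm⟩
  have huc : ContinuousOn u (Icc 0 1) := by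
    have := (hz.sub (continuousOn_const (c := y))).dot3 (continuousOn_const (c := D))
    exact continuousOn_const.mul this
  have hui : InjOn u (Icc 0 1) := fun s hs t ht hst => hi hs ht (by
    rw [(huz s hs).2, (huz t ht).2, hst])
  have hus : ∀ r ∈ Icc (0:ℝ) 1, ∃ t ∈ Icc (0:ℝ) 1, u t = r := by
    intro r hr
    obtain ⟨t, ht, hte⟩ : y + r • D ∈ z '' Icc 0 1 := him ▸ ⟨r, hr, rfl⟩
    refine ⟨t, ht, ?_⟩
    simp only [hu, hte]; simp; field_simp
  have i0 : (0:ℝ) ∈ Icc (0:ℝ) 1 := by simp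
  have i1 : (1:ℝ) ∈ Icc (0:ℝ) 1 := by simp
  obtain ⟨t0, ht0, e0⟩ := hus 0 i0
  obtain ⟨t1, ht1, e1⟩ := hus 1 i1
  have b0 := (huz 0 i0).1
  have b1 := (huz 1 i1).1
  rcases huc.strictMonoOn_of_injOn_Icc' zero_le_one hui with hm | hm
  · have c0 := hm.monotoneOn i0 ht0 ht0.1
    have c1 := hm.monotoneOn ht1 i1 ht1.2
    left
    have u0 : u 0 = 0 := by linarith [b0.1]
    have u1 : u 1 = 1 := by linarith [b1.2]
    refine ⟨by rw [(huz 0 i0).2, u0]; simp, by rw [(huz 1 i1).2, u1]; simp⟩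
  · have c0 := hm.antitoneOn ht0 i1 ht0.2
    have c1 := hm.antitoneOn i0 ht1 ht1.1
    right
    have u0 : u 1 = 0 := by linarith [b1.1]
    have u1 : u 0 = 1 := by linarith [b0.2]
    refine ⟨by rw [(huz 0 i0).2, u1]; simp, by rw [(huz 1 i1).2, u0]; simp⟩

namespace PolyCtx
variable {P : PolyCtx}
namespace Corner
variable {c : Fin P.nf} {a a1 a2 : Fin P.nv} {b1 b2 : Fin P.ne}

theorem cut (h : P.Corner c a a1 a2 b1 b2) : ∃ τ : ℝ, 0 < τ ∧ τ < 1 ∧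
    (P.vert a + τ • (P.vert a1 - P.vert a) - P.cpt a) ⬝ᵥ P.Cnormal a = 0 ∧
    P.vert a + τ • (P.vert a1 - P.vert a) ∈ P.Ehat b1 ∧
    P.vert a + τ • (P.vert a1 - P.vert a) ∈ P.Chat a := by
  have f0 := P.sep_vert a
  have f1 := P.sep_other a a1 h.h1
  set k := (P.vert a - P.cpt a) ⬝ᵥ P.Cnormal a
  set l := (P.vert a1 - P.cpt a) ⬝ᵥ P.Cnormal a with hl
  have hkl : 0 < k - l := by linarith
  set τ := k / (k - l) with hτ
  have t0 : 0 < τ := by positivity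
  have t1 : τ < 1 := by rw [hτ, div_lt_one hkl]; linarith
  have e : P.vert a + τ • (P.vert a1 - P.vert a) = (1 - τ) • P.vert a + τ • P.vert a1 := by module
  have hz : (P.vert a + τ • (P.vert a1 - P.vert a) - P.cpt a) ⬝ᵥ P.Cnormal a = 0 := by
    rw [e, dot_combo _ _ _ _ (by ring)]
    change (1 - τ) * k + τ * l = 0
    rw [hτ]; field_simp; ring
  have hed : P.vert a + τ • (P.vert a1 - P.vert a) ∈ P.edge b1 := by
    rw [e, h.e1]; exact ⟨1 - τ, τ, by linarith, t0.le, by ring, rfl⟩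
  have hP := ((mem_face _).1 (h.s1 hed)).1
  refine ⟨τ, t0, t1, hz, ⟨hed, ?_⟩, (mem_Chat _).2 ⟨hz, hP⟩⟩
  rw [mem_Rall]
  exact fun a' => P.cleave_sub a a' _ hP hz

theorem Ehat_Fhat (h : P.Corner c a a1 a2 b1 b2) : P.Ehat b1 ⊆ P.Fhat c :=
  fun _ hx => ⟨h.s1 hx.1, hx.2⟩

theorem kink_aux (h : P.Corner c a a1 a2 b1 b2)
    (hω : P.Fnormal c ⬝ᵥ crossProduct (P.vert a1 - P.vert a) (P.vert a2 - P.vert a) < 0)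
    (hneg : ∃ x ∈ P.Fhat c, (x - P.cpt a) ⬝ᵥ P.Cnormal a < 0)
    {n nI : V3 → V3} (hn : P.MemC0Phat n)
    (hE1 : EqOn n nI (P.Ehat b1)) (hE2 : EqOn n nI (P.Ehat b2))
    (hK : ∀ κ, P.HasKink a c n κ → P.HasKink a c nI κ)
    {e₁ e₂ : V3} (hf : Frame (P.Fnormal c) e₁ e₂) {θ θI : V3 → ℝ}
    (hθ : ContinuousOn θ (P.Fhat c)) (hθn : ∀ x ∈ P.Fhat c, n x = eps e₁ e₂ (eI (θ x)))
    (hθI : ContinuousOn θI (P.Fhat c)) (hθnI : ∀ x ∈ P.Fhat c, nI x = eps e₁ e₂ (eI (θI x))) :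
    ∃ y1 ∈ P.Ehat b1, ∃ y2 ∈ P.Ehat b2, θI y1 - θ y1 = θI y2 - θ y2 := by
  obtain ⟨τ1, t10, t11, hy1, hE_1, hC1⟩ := h.cut
  obtain ⟨τ2, t20, t21, hy2, hE_2, hC2⟩ := h.symm.cut
  have k0 := P.sep_vert a
  set F := P.Fnormal c with hF
  set p := P.vert a with hp
  set d1 := P.vert a1 - p with hd1
  set d2 := P.vert a2 - p with hd2
  set k := (p - P.cpt a) ⬝ᵥ P.Cnormal a with hk
  set ω := F ⬝ᵥ crossProduct d1 d2 with hωd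
  set y1 := p + τ1 • d1 with hy1d
  set y2 := p + τ2 • d2 with hy2d
  have g1 : k + τ1 * (d1 ⬝ᵥ P.Cnormal a) = 0 := by
    rw [← hy1, hy1d, hk]
    simp only [sub_dotProduct, add_dotProduct, smul_dotProduct, smul_eq_mul]; ring
  have g2 : k + τ2 * (d2 ⬝ᵥ P.Cnormal a) = 0 := by
    rw [← hy2, hy2d, hk]
    simp only [sub_dotProduct, add_dotProduct, smul_dotProduct, smul_eq_mul]; ring
  have hF1 := h.Ehat_Fhat hE_1
  have hF2 := h.symm.Ehat_Fhat hE_2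
  -- coordinates of face points
  have coord : ∀ x ∈ P.face c, ∃ r s : ℝ, 0 ≤ r ∧ 0 ≤ s ∧ x = p + (r * τ1) • d1 + (s * τ2) • d2 ∧
      (x - P.cpt a) ⬝ᵥ P.Cnormal a = k * (1 - r - s) := by
    intro x hx
    obtain ⟨α, β, hα, hβ, he⟩ := h.wedge hx
    refine ⟨α / τ1, β / τ2, by positivity, by positivity, ?_, ?_⟩
    · rw [div_mul_cancel₀ _ t10.ne', div_mul_cancel₀ _ t20.ne']; exact he
    · have : (x - P.cpt a) ⬝ᵥ P.Cnormal a = k + α * (d1 ⬝ᵥ P.Cnormal a)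
          + β * (d2 ⬝ᵥ P.Cnormal a) := by
        rw [he, hk]
        simp only [sub_dotProduct, add_dotProduct, smul_dotProduct, smul_eq_mul, hd1, hd2]; ring
      have q1 : d1 ⬝ᵥ P.Cnormal a = -k / τ1 := by field_simp; linarith
      have q2 : d2 ⬝ᵥ P.Cnormal a = -k / τ2 := by field_simp; linarith
      rw [this, q1, q2]; field_simp; ring
  have ori : ∀ x ∈ P.face c, (x - y1) ⬝ᵥ crossProduct F (y2 - y1) * k =
      ω * τ1 * τ2 * ((x - P.cpt a) ⬝ᵥ P.Cnormal a) := by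
    intro x hx
    obtain ⟨r, s, -, -, he, hfx⟩ := coord x hx
    rw [hfx, he, hy1d, hy2d, hωd]
    simp only [dot3, cross_apply]
    simp
    ring
  have hωτ : ω * τ1 * τ2 < 0 := by
    have := mul_pos t10 t20
    rw [mul_assoc]; exact mul_neg_of_neg_of_pos hω this
  obtain ⟨xn, hxn, hxn0⟩ := hneg
  have hposn : 0 < (xn - y1) ⬝ᵥ crossProduct F (y2 - y1) := by
    have := ori xn hxn.1
    have h2 := mul_pos_of_neg_of_neg hωτ hxn0
    rw [← this] at h2
    exact pos_of_mul_pos_left h2 k0.le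
  have hD : y2 - y1 ≠ 0 := fun h0 => by rw [h0] at hposn; simp at hposn
  have hB : P.Bhat a c = (fun t : ℝ => y1 + t • (y2 - y1)) '' Icc 0 1 := by
    rw [← segment_eq_image']
    apply Subset.antisymm
    · rintro x ⟨hx1, hx2⟩
      obtain ⟨r, s, hr, hs, he, hfx⟩ := coord x hx2.1
      rw [((mem_Chat _).1 hx1).1] at hfx
      have : 1 - r - s = 0 := (mul_eq_zero.1 hfx.symm).resolve_left k0.ne'
      refine ⟨r, s, hr, hs, by linarith, ?_⟩
      have hr' : r = 1 - s := by linarith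
      rw [he, hy1d, hy2d, hr']; module
    · intro x hx
      exact ⟨(P.Chat_convex a).segment_subset hC1 hC2 hx,
        (P.Fhat_convex c).segment_subset hF1 hF2 hx⟩
  set z : ℝ → V3 := fun t => y1 + t • (y2 - y1) with hz
  have hzpos : P.IsPosParamSeg a c z := by
    refine ⟨by fun_prop, hB.symm, ?_, ?_⟩
    · intro s _ t _ hst
      have : s • (y2 - y1) = t • (y2 - y1) := add_left_cancel hst
      exact smul_left_injective ℝ hD this
    · intro x hx
      have e0 : z 0 = y1 := by simp [hz]
      have e1 : z 1 = y2 := by simp [hz]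
      rw [e0, e1]
      have := ori x hx.1
      have h2 : 0 ≤ ω * τ1 * τ2 * ((x - P.cpt a) ⬝ᵥ P.Cnormal a) :=
        mul_nonneg_of_nonpos_of_nonpos hωτ.le ((mem_Rall _).1 hx.2 a)
      rw [← this] at h2
      exact nonneg_of_mul_nonneg_left h2 k0
  -- n at endpoints not antipodal
  have hanti : eI (θ y2) ≠ - eI (θ y1) := by
    intro hcon
    have hnn : n y1 = - n y2 := by
      rw [hθn _ hF1, hθn _ hF2, hcon]; simp [eps]; abel
    obtain ⟨c1, hc1, w1, w2⟩ := h.wedge1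
    obtain ⟨c2, hc2, w3, w4⟩ := h.symm.wedge1
    have n1 := hn.2.2 c1 y1 ⟨hc1 hE_1.1, hE_1.2⟩
    have n2 := hn.2.2 c2 y2 ⟨hc2 hE_2.1, hE_2.2⟩
    have n2' : n y1 ⬝ᵥ P.Fnormal c2 = 0 := by rw [hnn, neg_dotProduct, n2, neg_zero]
    have nF := hn.2.2 c y1 hF1
    have hcr := cramer2 (P.Fnormal_unit c) h.d1F h.symm.d1F nF
    change ω • n y1 = _ • d1 + _ • d2 at hcr
    set A := P.Fnormal c ⬝ᵥ crossProduct (n y1) (P.vert a2 - P.vert a)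
    set B := P.Fnormal c ⬝ᵥ crossProduct (P.vert a1 - P.vert a) (n y1)
    change d1 ⬝ᵥ _ = 0 at w1
    change d2 ⬝ᵥ _ < 0 at w2
    change d2 ⬝ᵥ _ = 0 at w3
    change d1 ⬝ᵥ _ < 0 at w4
    have c1' := congrArg (fun v => v ⬝ᵥ P.Fnormal c1) hcr
    have c2' := congrArg (fun v => v ⬝ᵥ P.Fnormal c2) hcr
    simp only [add_dotProduct, smul_dotProduct, smul_eq_mul, n1, n2', w1, w3, mul_zero,
      zero_add, add_zero] at c1' c2'
    have hB0 := (mul_eq_zero.1 c1'.symm).resolve_right w2.ne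
    have hA0 := (mul_eq_zero.1 c2'.symm).resolve_right w4.ne
    rw [hA0, hB0] at hcr
    simp only [zero_smul, add_zero] at hcr
    have := (smul_eq_zero.1 hcr).resolve_left hω.ne
    exact sphere_ne_zero (hn.2.1 _ (P.Fhat_sub c hF1)) this
  obtain ⟨η, hη, κ, hηe, hκ⟩ := eta_exists hanti
  have e0 : z 0 = y1 := by simp [hz]
  have e1 : z 1 = y2 := by simp [hz]
  have hzF : ∀ z : ℝ → V3, P.IsPosParamSeg a c z → ∀ t ∈ Icc (0:ℝ) 1, z t ∈ P.Fhat c := by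
    intro z hz t ht
    have : z t ∈ P.Bhat a c := by rw [← hz.2.1]; exact ⟨t, ht, rfl⟩
    exact this.2
  have hkn : P.HasKink a c n κ := by
    refine ⟨z, hzpos, ?_⟩
    rw [kink_angle hf (θ := fun t => θ (z t)) (hθ.comp hzpos.1 (hzF z hzpos))
      (fun t ht => hθn _ (hzF z hzpos t ht))]
    simp only [e0, e1]
    exact ⟨η, hη, hηe, hκ⟩
  obtain ⟨z', hz', hk'⟩ := hK κ hkn
  rw [kink_angle hf (θ := fun t => θI (z' t)) (hθI.comp hz'.1 (hzF z' hz'))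
      (fun t ht => hθnI _ (hzF z' hz' t ht))] at hk'
  obtain ⟨η', hη', hηe', hκ'⟩ := hk'
  have hends : z' 0 = y1 ∧ z' 1 = y2 := by
    rcases seg_param hD hz'.1 hz'.2.2.1 (hz'.2.1.trans hB) with hh | hh
    · exact ⟨hh.1, by rw [hh.2]; abel⟩
    · exfalso
      have q0 : z' 0 = y2 := by rw [hh.1]; abel
      have := hz'.2.2.2 xn hxn
      rw [q0, hh.2] at this
      have e : (xn - y2) ⬝ᵥ crossProduct F (y1 - y2) = -((xn - y1) ⬝ᵥ crossProduct F (y2 - y1)) := by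
        simp only [dot3, cross_apply]; simp; ring
      change 0 ≤ (xn - y2) ⬝ᵥ crossProduct F (y1 - y2) at this
      linarith
  simp only [hends.1, hends.2] at hηe' hκ'
  have q1 : eI (θI y1) = eI (θ y1) := hf.inj (by
    rw [← hθn _ hF1, ← hθnI _ hF1]; exact (hE1 hE_1).symm)
  have q2 : eI (θI y2) = eI (θ y2) := hf.inj (by
    rw [← hθn _ hF2, ← hθnI _ hF2]; exact (hE2 hE_2).symm)
  rw [q1, q2, hηe] at hηe'
  have hee := eta_unique hη hη' (mul_right_cancel₀ (eI_ne _) hηe')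
  subst hee
  exact ⟨y1, hE_1, y2, hE_2, by linarith⟩

theorem kink (h : P.Corner c a a1 a2 b1 b2)
    (hneg : ∃ x ∈ P.Fhat c, (x - P.cpt a) ⬝ᵥ P.Cnormal a < 0)
    {n nI : V3 → V3} (hn : P.MemC0Phat n)
    (hE1 : EqOn n nI (P.Ehat b1)) (hE2 : EqOn n nI (P.Ehat b2))
    (hK : ∀ κ, P.HasKink a c n κ → P.HasKink a c nI κ)
    {e₁ e₂ : V3} (hf : Frame (P.Fnormal c) e₁ e₂) {θ θI : V3 → ℝ}
    (hθ : ContinuousOn θ (P.Fhat c)) (hθn : ∀ x ∈ P.Fhat c, n x = eps e₁ e₂ (eI (θ x)))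
    (hθI : ContinuousOn θI (P.Fhat c)) (hθnI : ∀ x ∈ P.Fhat c, nI x = eps e₁ e₂ (eI (θI x))) :
    ∃ y1 ∈ P.Ehat b1, ∃ y2 ∈ P.Ehat b2, θI y1 - θ y1 = θI y2 - θ y2 := by
  rcases lt_trichotomy (P.Fnormal c ⬝ᵥ crossProduct (P.vert a1 - P.vert a)
    (P.vert a2 - P.vert a)) 0 with hω | hω | hω
  · exact h.kink_aux hω hneg hn hE1 hE2 hK hf hθ hθn hθI hθnI
  · exfalso
    have := cross_perp (P.Fnormal_unit c) h.d1F h.symm.d1F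
    rw [hω, zero_smul] at this
    exact P.noncollinear h.h1 h.h2 h.h12 this
  · obtain ⟨y1, h1, y2, h2, he⟩ := h.symm.kink_aux (by
      rw [← neg_cross]; simp only [dotProduct_neg]; linarith) hneg hn hE2 hE1 hK hf hθ hθn hθI hθnI
    exact ⟨y2, h2, y1, h1, he.symm⟩

end Corner

variable (P)

theorem Ehat_convex (b : Fin P.ne) : Convex ℝ (P.Ehat b) := by
  unfold Ehat
  rw [P.edge_def]
  exact (convex_segment _ _).inter P.Rall_convex

/-- The angle between `n` and `nI` on a face, vanishing on edges. -/
theorem face_lift {deg : (V3 → V3) → ℤ} {s : V3} {n nI : V3 → V3}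
    (hn : P.MemC0Phat n) (hnI : P.MemC0Phat nI) (hinv : P.SameInv deg s n nI) (c : Fin P.nf) :
    ∃ δ : V3 → ℝ, ContinuousOn δ (P.Fhat c) ∧
      (∀ x ∈ P.Fhat c, nI x = rot3 (P.Fnormal c) (δ x) (n x)) ∧
      ∀ c', crossProduct (P.Fnormal c) (P.Fnormal c') ≠ 0 → ∀ x ∈ P.Fhat c, x ∈ P.Fhat c' →
        δ x = 0 := by
  obtain ⟨e₁, e₂, hf⟩ := exists_frame (P.Fnormal_unit c)
  obtain ⟨θ, hθ, hθn⟩ := P.face_angle hn c hf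
  obtain ⟨θI, hθI, hθnI⟩ := P.face_angle hnI c hf
  have hEF : ∀ i, P.Ehat (P.fedge c i) ⊆ P.Fhat c := fun i => (P.corner_of c i).Ehat_Fhat
  have he1 : ∀ i, ∀ x ∈ P.Ehat (P.fedge c i), eI (θI x - θ x) = 1 := by
    intro i x hx
    apply eI_sub
    apply hf.inj
    rw [← hθn _ (hEF i hx), ← hθnI _ (hEF i hx)]
    exact (hinv.1 _ hx).symm
  have hcst : ∀ i, ∀ x ∈ P.Ehat (P.fedge c i), ∀ y ∈ P.Ehat (P.fedge c i),
      θI x - θ x = θI y - θ y := by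
    intro i x hx y hy
    exact int_const (P.Ehat_convex (P.fedge c i)).isPreconnected (φ := fun x => θI x - θ x)
      ((hθI.sub hθ).mono (hEF i)) (he1 i) hx hy
  have hstep : ∀ i, ∃ y1 ∈ P.Ehat (P.fedge c i), ∃ y2 ∈ P.Ehat (P.fedge c (i + 1)),
      θI y1 - θ y1 = θI y2 - θ y2 := by
    intro i
    refine (P.corner_of c i).kink ?_ hn (hinv.1 _) (hinv.1 _) (fun κ => (hinv.2.1 _ c κ).1) hf
      hθ hθn hθI hθnI
    obtain ⟨τ, t0, t1, -, hE, -⟩ := (P.corner_of c (i + 1)).symm.cut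
    refine ⟨_, hEF _ hE, ?_⟩
    have f1 := P.sep_other (P.fvert c (i + 1)) (P.fvert c (i + 1 + 1))
      (P.fvert_ne c _ _ (mod_ne (P.m_ge c) (i + 1) 1 (by omega) (by omega))).symm
    have f2 := P.sep_other (P.fvert c (i + 1)) (P.fvert c (i + 1 + 2))
      (P.fvert_ne c _ _ (mod_ne (P.m_ge c) (i + 1) 2 (by omega) (by omega))).symm
    have e : ∀ u v : V3, u + τ • (v - u) = (1 - τ) • u + τ • v := fun u v => by module
    rw [e, dot_combo _ _ _ _ (by ring)]
    nlinarith
  obtain ⟨x0, hx0, -⟩ := hstep 0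
  have hall : ∀ i, ∀ x ∈ P.Ehat (P.fedge c i), θI x - θ x = θI x0 - θ x0 := by
    intro i
    induction i with
    | zero => exact fun x hx => hcst 0 x hx x0 hx0
    | succ i ih =>
      intro x hx
      obtain ⟨y1, h1, y2, h2, he⟩ := hstep i
      rw [hcst (i + 1) x hx y2 h2, ← he, ih y1 h1]
  refine ⟨fun x => (θI x - θ x) - (θI x0 - θ x0), by fun_prop, ?_, ?_⟩
  · intro x hx
    rw [hθn x hx, hθnI x hx, rot_eps hf, ← eI_add]
    congr 1
    have := he1 0 x0 hx0
    have e : eI (θI x) = eI (θI x - θ x - (θI x0 - θ x0) + θ x) * eI (θI x0 - θ x0) := by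
      rw [← eI_add]; congr 1; ring
    rw [e, this, mul_one]
  · intro c' hp x hx hx'
    obtain ⟨i, hi⟩ := P.edge_or hp hx.1 hx'.1
    simp only [hall i x ⟨hi, hx.2⟩, sub_self]

end PolyCtx
end

noncomputable section
open Matrix Set MeasureTheory
open scoped Classical Quaternion

theorem glue_fin {ι E Z : Type*} [Finite ι] [TopologicalSpace E] [TopologicalSpace Z] [Nonempty Z]
    {A : ι → Set E} (hA : ∀ i, IsClosed (A i)) {h : ι → E → Z}
    (hc : ∀ i, ContinuousOn (h i) (A i))
    (agree : ∀ i j, ∀ p ∈ A i, p ∈ A j → h i p = h j p) :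
    ∃ H : E → Z, ContinuousOn H (⋃ i, A i) ∧ ∀ i, EqOn H (h i) (A i) := by
  let H : E → Z := fun p => if hp : ∃ i, p ∈ A i then h hp.choose p else Classical.arbitrary Z
  have hH : ∀ i, EqOn H (h i) (A i) := by
    intro i p hp
    have hex : ∃ i, p ∈ A i := ⟨i, hp⟩
    change (if hp : ∃ i, p ∈ A i then h hp.choose p else _) = _
    rw [dif_pos hex]
    exact agree _ _ p hex.choose_spec hp
  exact ⟨H, (locallyFinite_of_finite A).continuousOn_iUnion hA fun i => (hc i).congr (hH i), hH⟩

theorem rot3_zero (F v : V3) : rot3 F 0 v = v := by simp [rot3]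

theorem rot3_perp {F v : V3} (hv : v ⬝ᵥ F = 0) (θ : ℝ) : rot3 F θ v ⬝ᵥ F = 0 := by
  have h1 : F ⬝ᵥ v = 0 := by rw [dotProduct_comm, hv]
  have h2 : crossProduct F v ⬝ᵥ F = 0 := by rw [dotProduct_comm, dot_self_cross]
  simp [rot3, add_dotProduct, smul_dotProduct, hv, h1, h2]

theorem rot3_sphere {F v : V3} (hF : F ⬝ᵥ F = 1) (hv : v ⬝ᵥ F = 0) (hs : v ∈ sphereS) (θ : ℝ) :
    rot3 F θ v ∈ sphereS := by
  have h1 : F ⬝ᵥ v = 0 := by rw [dotProduct_comm, hv]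
  have h2 : v ⬝ᵥ crossProduct F v = 0 := dot_cross_self _ _
  have h2' : crossProduct F v ⬝ᵥ v = 0 := by rw [dotProduct_comm, h2]
  have h3 : crossProduct F v ⬝ᵥ crossProduct F v = 1 := by
    rw [cross_dot_cross, hF, h1, show v ⬝ᵥ v = 1 from hs]; simp
  change rot3 F θ v ⬝ᵥ rot3 F θ v = 1
  simp only [rot3, h1, mul_zero, zero_smul, add_zero, add_dotProduct, dotProduct_add,
    smul_dotProduct, dotProduct_smul, h2, h2', h3, show v ⬝ᵥ v = 1 from hs, smul_eq_mul]
  nlinarith [Real.sin_sq_add_cos_sq θ]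

theorem rot3_cont {E : Type*} [TopologicalSpace E] {S : Set E} (F : V3) {φ : E → ℝ} {v : E → V3}
    (hφ : ContinuousOn φ S) (hv : ContinuousOn v S) :
    ContinuousOn (fun x => rot3 F (φ x) (v x)) S := by
  have h1 : ContinuousOn (fun x => crossProduct F (v x)) S :=
    (LinearMap.continuous_of_finiteDimensional (crossProduct F)).comp_continuousOn hv
  have h2 : ContinuousOn (fun x => F ⬝ᵥ v x) S := (continuousOn_const (c := F)).dot3 hv
  have h3 := Real.continuous_cos.comp_continuousOn hφ
  have h4 := Real.continuous_sin.comp_continuousOn hφ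
  exact ((h3.smul hv).add (h4.smul h1)).add
    (((continuousOn_const.sub h3).mul h2).smul continuousOn_const)

namespace PolyCtx
variable (P : PolyCtx)

theorem HomotopicPhat.trans {n n1 n2 : V3 → V3} (h : P.HomotopicPhat n n1)
    (h' : P.HomotopicPhat n1 n2) : P.HomotopicPhat n n2 := by
  obtain ⟨H, hc, hm, h0, h1⟩ := h
  obtain ⟨K, kc, km, k0, k1⟩ := h'
  have hX := P.Phat_compact.isClosed
  refine ⟨fun t x => if t ≤ 1 / 2 then H (2 * t) x else K (2 * t - 1) x, ?_, ?_, ?_, ?_⟩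
  · obtain ⟨G, hG, hGe⟩ := glue_fin (ι := Bool) (E := ℝ × V3)
      (A := fun b => bif b then Icc (0:ℝ) (1 / 2) ×ˢ P.PhatSet else Icc (1 / 2 : ℝ) 1 ×ˢ P.PhatSet)
      (h := fun b q => bif b then H (2 * q.1) q.2 else K (2 * q.1 - 1) q.2)
      (by rintro (_ | _) <;> exact isClosed_Icc.prod hX)
      (by
        rintro (_ | _)
        · exact kc.comp (f := fun q : ℝ × V3 => (2 * q.1 - 1, q.2)) (by fun_prop)
            (fun q hq => ⟨⟨by linarith [hq.1.1], by linarith [hq.1.2]⟩, hq.2⟩)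
        · exact hc.comp (f := fun q : ℝ × V3 => (2 * q.1, q.2)) (by fun_prop)
            (fun q hq => ⟨⟨by linarith [hq.1.1], by linarith [hq.1.2]⟩, hq.2⟩))
      (by
        have key : ∀ q : ℝ × V3, q ∈ Icc (0:ℝ) (1 / 2) ×ˢ P.PhatSet →
            q ∈ Icc (1 / 2 : ℝ) 1 ×ˢ P.PhatSet → H (2 * q.1) q.2 = K (2 * q.1 - 1) q.2 := by
          intro q hq hq'
          have : q.1 = 1 / 2 := le_antisymm hq.1.2 hq'.1.1
          rw [this]; norm_num
          rw [h1 _ hq.2, k0 _ hq.2]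
        rintro (_ | _) (_ | _) p hp hp'
        · rfl
        · exact (key p hp' hp).symm
        · exact key p hp hp'
        · rfl)
    refine (hG.mono ?_).congr ?_
    · rintro ⟨t, x⟩ ⟨ht, hx⟩
      rcases le_total t (1 / 2) with h | h
      · exact mem_iUnion.2 ⟨true, ⟨ht.1, h⟩, hx⟩
      · exact mem_iUnion.2 ⟨false, ⟨h, ht.2⟩, hx⟩
    · rintro ⟨t, x⟩ ⟨ht, hx⟩
      by_cases h : t ≤ 1 / 2
      · rw [hGe true (show (t, x) ∈ Icc (0:ℝ) (1 / 2) ×ˢ P.PhatSet from ⟨⟨ht.1, h⟩, hx⟩)]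
        simp only [if_pos h, cond_true]
      · rw [hGe false (show (t, x) ∈ Icc (1 / 2 : ℝ) 1 ×ˢ P.PhatSet from
          ⟨⟨(not_le.1 h).le, ht.2⟩, hx⟩)]
        simp only [if_neg h, cond_false]
  · intro t ht
    by_cases h : t ≤ 1 / 2
    · simp only [if_pos h]; exact hm _ ⟨by linarith [ht.1], by linarith⟩
    · simp only [if_neg h]; exact km _ ⟨by linarith, by linarith [ht.2]⟩
  · intro x hx
    change (if (0:ℝ) ≤ 1 / 2 then H (2 * 0) x else K (2 * 0 - 1) x) = n x
    rw [if_pos (by norm_num)]; simpa using h0 x hx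
  · intro x hx
    change (if (1:ℝ) ≤ 1 / 2 then H (2 * 1) x else K (2 * 1 - 1) x) = n2 x
    rw [if_neg (by norm_num)]; norm_num; exact k1 x hx

theorem normals_opp {c c' : Fin P.nf} {x : V3} (hx : x ∈ P.face c) (hx' : x ∈ P.face c')
    (hp : crossProduct (P.Fnormal c) (P.Fnormal c') = 0) : P.Fnormal c = P.Fnormal c' := by
  have h := cross_par (P.Fnormal_unit c) hp
  set k := P.Fnormal c ⬝ᵥ P.Fnormal c'
  have hk : k * k = 1 := by
    have := P.Fnormal_unit c'
    rw [h] at this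
    simpa [P.Fnormal_unit c] using this
  rcases mul_self_eq_one_iff.1 hk with h1 | h1
  · rw [h, h1, one_smul]
  · exfalso
    rw [h1] at h
    rw [mem_face] at hx hx'
    -- every point of Pbar lies in the plane
    have hpl : ∀ y ∈ P.Pbar, y ⬝ᵥ P.Fnormal c = P.foffset c := by
      intro y hy
      have f1 := P.face_supp c y hy
      have f2 := P.face_supp c' y hy
      have e1 := hx'.2
      rw [h] at f2 e1
      simp only [dotProduct_smul, smul_eq_mul, hx.2] at f2 e1
      linarith
    obtain ⟨y, hy⟩ := P.int_nonempty
    have hcont : Continuous fun t : ℝ => y + t • P.Fnormal c := by fun_prop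
    have := hcont.continuousAt.preimage_mem_nhds (x := 0)
      (by simpa using mem_interior_iff_mem_nhds.1 hy)
    obtain ⟨ε, hε, hball⟩ := Metric.mem_nhds_iff.1 this
    have hm : y + (ε / 2) • P.Fnormal c ∈ P.Pbar := hball (by
      rw [Metric.mem_ball, Real.dist_eq, sub_zero, abs_of_pos (by positivity)]; linarith)
    have g1 := hpl _ hm
    have g2 := hpl _ (interior_subset hy)
    simp only [add_dotProduct, smul_dotProduct, P.Fnormal_unit c, g2, smul_eq_mul] at g1
    linarith

theorem same_face {c c' : Fin P.nf} (h : P.Fnormal c = P.Fnormal c') : P.face c = P.face c' := by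
  have ho : P.foffset c = P.foffset c' := by
    have h1 : P.vert (P.fvert c (0+1)) ∈ P.face c :=
      (P.corner_of c 0).s1 (P.corner_of c 0).va
    have h2 : P.vert (P.fvert c' (0+1)) ∈ P.face c' :=
      (P.corner_of c' 0).s1 (P.corner_of c' 0).va
    rw [mem_face] at h1 h2
    have h3 := P.face_supp c' _ h1.1
    have h4 := P.face_supp c _ h2.1
    rw [h] at h1 h4
    linarith [h1.2, h2.2]
  rw [P.face_def, P.face_def, h, ho]

theorem Chat_inter {a a' : Fin P.nv} (hne : a ≠ a') {x : V3} (hx : x ∈ P.Chat a)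
    (hx' : x ∈ P.Chat a') : ∃ c, x ∈ P.Fhat c := by
  rw [mem_Chat] at hx hx'
  by_cases hf : x ∈ frontier P.Pbar
  · rw [P.frontier_eq] at hf
    obtain ⟨c, hc⟩ := mem_iUnion.1 hf
    exact ⟨c, hc, (mem_Rall _).2 fun b => P.cleave_sub a b x hx.2 hx.1⟩
  exfalso
  have hinter : x ∈ interior P.Pbar := by
    by_contra hi
    exact hf ⟨subset_closure hx.2, hi⟩
  have hperp : ∀ v : V3, v ⬝ᵥ P.Cnormal a = 0 → v ⬝ᵥ P.Cnormal a' = 0 := by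
    intro v hv
    have hcont : Continuous fun t : ℝ => x + t • v := by fun_prop
    have := hcont.continuousAt.preimage_mem_nhds (x := 0)
      (by simpa using mem_interior_iff_mem_nhds.1 hinter)
    obtain ⟨ε, hε, hball⟩ := Metric.mem_nhds_iff.1 this
    have key : ∀ t : ℝ, |t| < ε → t * (v ⬝ᵥ P.Cnormal a') ≤ 0 := by
      intro t ht
      have hm : x + t • v ∈ P.Pbar := hball (by
        rw [Metric.mem_ball, Real.dist_eq, sub_zero]; exact ht)
      have e : ∀ q N : V3, (x + t • v - q) ⬝ᵥ N = (x - q) ⬝ᵥ N + t * (v ⬝ᵥ N) := by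
        intro q N
        simp only [sub_dotProduct, add_dotProduct, smul_dotProduct, smul_eq_mul]; ring
      have := P.cleave_sub a a' _ hm (by rw [e, hx.1, hv]; ring)
      rw [e, hx'.1] at this
      linarith
    have k1 := key (ε / 2) (by rw [abs_of_pos (by positivity)]; linarith)
    have k2 := key (-(ε / 2)) (by rw [abs_neg, abs_of_pos (by positivity)]; linarith)
    have : (ε / 2) * (v ⬝ᵥ P.Cnormal a') = 0 := by linarith
    exact (mul_eq_zero.1 this).resolve_left (by positivity)
  set k := P.Cnormal a' ⬝ᵥ P.Cnormal a with hk
  have hpar : P.Cnormal a' = k • P.Cnormal a := by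
    by_contra hcon
    have hv0 : P.Cnormal a' - k • P.Cnormal a ≠ 0 := sub_ne_zero.2 hcon
    have v1 : (P.Cnormal a' - k • P.Cnormal a) ⬝ᵥ P.Cnormal a = 0 := by
      simp only [sub_dotProduct, smul_dotProduct, P.Cnormal_unit, smul_eq_mul, ← hk]; ring
    have v2 := hperp _ v1
    have := dot_self_pos' hv0
    rw [dotProduct_sub, dotProduct_smul, v1, v2] at this
    simp at this
  have hrel : ∀ y : V3, (y - P.cpt a') ⬝ᵥ P.Cnormal a' = k * ((y - P.cpt a) ⬝ᵥ P.Cnormal a) := by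
    intro y
    have e1 : (y - P.cpt a') ⬝ᵥ P.Cnormal a' = (y - x) ⬝ᵥ P.Cnormal a' := by
      have := hx'.1
      simp only [sub_dotProduct] at this ⊢
      linarith
    have e2 : (y - P.cpt a) ⬝ᵥ P.Cnormal a = (y - x) ⬝ᵥ P.Cnormal a := by
      have := hx.1
      simp only [sub_dotProduct] at this ⊢
      linarith
    rw [e1, e2, hpar, dotProduct_smul, smul_eq_mul]
  have s1 := P.sep_vert a'
  have s2 := P.sep_other a a' hne.symm
  rw [hrel] at s1
  have hk0 : k < 0 := by
    by_contra h; push Not at h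
    nlinarith
  obtain ⟨a'', h1, h2⟩ : ∃ a'', a'' ≠ a ∧ a'' ≠ a' := by
    have hc := P.corner_of (P.vface a 0) 0
    by_contra hcon
    push Not at hcon
    generalize P.fvert (P.vface a 0) (0+1) = u0 at hc
    generalize P.fvert (P.vface a 0) 0 = u1 at hc
    generalize P.fvert (P.vface a 0) (0+2) = u2 at hc
    have q0 := hcon u0
    have q1 := hcon u1
    have q2 := hcon u2
    rcases eq_or_ne u0 a with z0 | z0
    · exact hc.h12 ((q1 (z0 ▸ hc.h1)).trans (q2 (z0 ▸ hc.h2)).symm)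
    · have z0' := q0 z0
      have z1 : u1 = a := by
        by_contra hz; exact hc.h1 ((q1 hz).trans z0'.symm)
      have z2 : u2 = a := by
        by_contra hz; exact hc.h2 ((q2 hz).trans z0'.symm)
      exact hc.h12 (z1.trans z2.symm)
  have s3 := P.sep_other a a'' h1
  have s4 := P.sep_other a' a'' h2
  rw [hrel] at s4
  nlinarith

theorem step1 {deg : (V3 → V3) → ℤ} {s : V3} {n nI : V3 → V3}
    (hn : P.MemC0Phat n) (hnI : P.MemC0Phat nI) (hinv : P.SameInv deg s n nI) :
    ∃ n1, P.MemC0Phat n1 ∧ P.HomotopicPhat n n1 ∧ ∀ c, EqOn n1 nI (P.Fhat c) := by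
  have hδ : ∀ N : V3, ∃ δ : V3 → ℝ, ∀ c, P.Fnormal c = N → ContinuousOn δ (P.Fhat c) ∧
      (∀ x ∈ P.Fhat c, nI x = rot3 (P.Fnormal c) (δ x) (n x)) ∧
      ∀ c', crossProduct (P.Fnormal c) (P.Fnormal c') ≠ 0 → ∀ x ∈ P.Fhat c, x ∈ P.Fhat c' →
        δ x = 0 := by
    intro N
    by_cases hex : ∃ c0, P.Fnormal c0 = N
    · obtain ⟨c0, rfl⟩ := hex
      obtain ⟨δ, hδ⟩ := P.face_lift hn hnI hinv c0
      refine ⟨δ, fun c hc => ?_⟩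
      have : P.Fhat c = P.Fhat c0 := by unfold Fhat; rw [P.same_face hc]
      rw [this, hc]; exact hδ
    · exact ⟨0, fun c hc => absurd ⟨c, hc⟩ hex⟩
  choose δ hδ using hδ
  obtain ⟨G, hG, hGe⟩ := glue_fin (ι := Fin P.nf) (E := ℝ × V3)
    (A := fun c => Icc (0:ℝ) 1 ×ˢ P.Fhat c)
    (h := fun c q => rot3 (P.Fnormal c) (q.1 * δ (P.Fnormal c) q.2) (n q.2))
    (fun c => isClosed_Icc.prod (P.Fhat_compact c).isClosed)
    (fun c => rot3_cont _ (continuousOn_fst.mul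
      ((hδ _ c rfl).1.comp continuousOn_snd fun q hq => hq.2))
      ((hn.1.mono (P.Fhat_sub c)).comp continuousOn_snd fun q hq => hq.2))
    (by
      intro c c' q hq hq'
      by_cases hp : crossProduct (P.Fnormal c) (P.Fnormal c') = 0
      · have := P.normals_opp hq.2.1 hq'.2.1 hp
        simp only [this]
      · have z1 := (hδ _ c rfl).2.2 c' hp _ hq.2 hq'.2
        have z2 := (hδ _ c' rfl).2.2 c (fun h0 => hp (by
          rw [← neg_cross, h0, neg_zero])) _ hq'.2 hq.2
        simp only [z1, z2, mul_zero, rot3_zero])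
  have i0 : (0:ℝ) ∈ Icc (0:ℝ) 1 := by simp
  have i1 : (1:ℝ) ∈ Icc (0:ℝ) 1 := by simp
  have hGe' : ∀ c, ∀ t ∈ Icc (0:ℝ) 1, ∀ x ∈ P.Fhat c,
      G (t, x) = rot3 (P.Fnormal c) (t * δ (P.Fnormal c) x) (n x) :=
    fun c t ht x hx => hGe c (show (t, x) ∈ Icc (0:ℝ) 1 ×ˢ P.Fhat c from ⟨ht, hx⟩)
  obtain ⟨H, hH, hHs, hHA, hH0⟩ := hepS P.Phat_compact (A := ⋃ c, P.Fhat c)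
    (isClosed_iUnion_of_finite fun c => (P.Fhat_compact c).isClosed)
    (iUnion_subset P.Fhat_sub) hn.1 hn.2.1 (h := G)
    (by rw [prod_iUnion]; exact hG)
    (by
      intro t ht x hx
      obtain ⟨c, hc⟩ := mem_iUnion.1 hx
      rw [hGe' c t ht x hc]
      exact rot3_sphere (P.Fnormal_unit c) (hn.2.2 c x hc) (hn.2.1 x (P.Fhat_sub c hc)) _)
    (by
      intro x hx
      obtain ⟨c, hc⟩ := mem_iUnion.1 hx
      rw [hGe' c 0 i0 x hc, zero_mul, rot3_zero])
  have hm : ∀ t ∈ Icc (0:ℝ) 1, P.MemC0Phat fun x => H (t, x) := by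
    intro t ht
    refine ⟨hH.comp (by fun_prop) fun x hx => ⟨ht, hx⟩, hHs t ht, fun c x hx => ?_⟩
    change H (t, x) ⬝ᵥ _ = 0
    rw [hHA t ht x (mem_iUnion.2 ⟨c, hx⟩), hGe' c t ht x hx]
    exact rot3_perp (hn.2.2 c x hx) _
  refine ⟨fun x => H (1, x), hm 1 i1, ⟨fun t x => H (t, x), hH, hm, hH0, fun x _ => rfl⟩, ?_⟩
  intro c x hx
  change H (1, x) = nI x
  rw [hHA 1 i1 x (mem_iUnion.2 ⟨c, hx⟩), hGe' c 1 i1 x hx, one_mul, (hδ _ c rfl).2.1 x hx]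

theorem final {deg : (V3 → V3) → ℤ} (hdeg : DegreeTheory deg)
    {s : V3} (hs : P.AdmissibleS s) {n nI : V3 → V3}
    (hn : P.MemC0Phat n) (hnI : P.MemC0Phat nI) (hinv : P.SameInv deg s n nI) :
    ∃ n' : V3 → V3, P.MemC0Phat n' ∧ P.HomotopicPhat n n' ∧ Set.EqOn n' nI P.bdPhat := by
  obtain ⟨n1, hn1, hom, heq⟩ := P.step1 hn hnI hinv
  have hcl := fun a => P.cleaved_homotopy hdeg hs hn1 hnI hom heq a (hinv.2.2 a)
  choose h hc hsph h0 h1 hb using hcl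
  have i0 : (0:ℝ) ∈ Icc (0:ℝ) 1 := by simp
  have i1 : (1:ℝ) ∈ Icc (0:ℝ) 1 := by simp
  have hFC : ∀ a c x, x ∈ P.Chat a → x ∈ P.Fhat c → x ∈ P.bdChat a := fun a c x hx hx' =>
    mem_iUnion.2 ⟨c, hx, hx'⟩
  obtain ⟨G, hG, hGe⟩ := glue_fin (ι := Fin P.nv ⊕ Fin P.nf) (E := ℝ × V3)
    (A := fun i => Icc (0:ℝ) 1 ×ˢ Sum.elim P.Chat P.Fhat i)
    (h := Sum.elim h (fun _ q => n1 q.2))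
    (by
      rintro (a | c)
      · exact isClosed_Icc.prod (P.Chat_compact a).isClosed
      · exact isClosed_Icc.prod (P.Fhat_compact c).isClosed)
    (by
      rintro (a | c)
      · exact hc a
      · exact (hn1.1.mono (P.Fhat_sub c)).comp continuousOn_snd fun q hq => hq.2)
    (by
      rintro (a | c) (a' | c') ⟨t, x⟩ ⟨ht, hx⟩ ⟨_, hx'⟩
      · change h a (t, x) = h a' (t, x)
        by_cases haa : a = a'
        · rw [haa]
        · obtain ⟨c, hxc⟩ := P.Chat_inter haa hx hx'
          rw [hb a t ht x (hFC a c x hx hxc), hb a' t ht x (hFC a' c x hx' hxc)]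
      · exact hb a t ht x (hFC a c' x hx hx')
      · exact (hb a' t ht x (hFC a' c x hx' hx)).symm
      · rfl)
  have gC : ∀ a, ∀ t ∈ Icc (0:ℝ) 1, ∀ x ∈ P.Chat a, G (t, x) = h a (t, x) :=
    fun a t ht x hx => hGe (Sum.inl a)
      (show (t, x) ∈ Icc (0:ℝ) 1 ×ˢ P.Chat a from ⟨ht, hx⟩)
  have gF : ∀ c, ∀ t ∈ Icc (0:ℝ) 1, ∀ x ∈ P.Fhat c, G (t, x) = n1 x :=
    fun c t ht x hx => hGe (Sum.inr c)
      (show (t, x) ∈ Icc (0:ℝ) 1 ×ˢ P.Fhat c from ⟨ht, hx⟩)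
  have hbd : ∀ {x}, x ∈ P.bdPhat → (∃ a, x ∈ P.Chat a) ∨ ∃ c, x ∈ P.Fhat c := by
    intro x hx
    rcases hx with hx | hx
    · exact Or.inl (mem_iUnion.1 hx)
    · exact Or.inr (mem_iUnion.1 hx)
  obtain ⟨H, hH, hHs, hHA, hH0⟩ := hepS P.Phat_compact (A := P.bdPhat)
    ((isClosed_iUnion_of_finite fun a => (P.Chat_compact a).isClosed).union
      (isClosed_iUnion_of_finite fun c => (P.Fhat_compact c).isClosed))
    (union_subset (iUnion_subset P.Chat_sub) (iUnion_subset P.Fhat_sub)) hn1.1 hn1.2.1 (h := G)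
    (by
      refine hG.mono ?_
      rintro ⟨t, x⟩ ⟨ht, hx⟩
      rcases hbd hx with ⟨a, hx⟩ | ⟨c, hx⟩
      · exact mem_iUnion.2 ⟨Sum.inl a, ht, hx⟩
      · exact mem_iUnion.2 ⟨Sum.inr c, ht, hx⟩)
    (by
      intro t ht x hx
      rcases hbd hx with ⟨a, hx⟩ | ⟨c, hx⟩
      · rw [gC a t ht x hx]; exact hsph a t ht x hx
      · rw [gF c t ht x hx]; exact hn1.2.1 x (P.Fhat_sub c hx))
    (by
      intro x hx
      rcases hbd hx with ⟨a, hx⟩ | ⟨c, hx⟩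
      · rw [gC a 0 i0 x hx]; exact h0 a x hx
      · rw [gF c 0 i0 x hx])
  have hm : ∀ t ∈ Icc (0:ℝ) 1, P.MemC0Phat fun x => H (t, x) := by
    intro t ht
    refine ⟨hH.comp (by fun_prop) fun x hx => ⟨ht, hx⟩, hHs t ht, fun c x hx => ?_⟩
    change H (t, x) ⬝ᵥ _ = 0
    rw [hHA t ht x (Or.inr (mem_iUnion.2 ⟨c, hx⟩)), gF c t ht x hx]
    exact hn1.2.2 c x hx
  refine ⟨fun x => H (1, x), hm 1 i1,
    HomotopicPhat.trans P hom ⟨fun t x => H (t, x), hH, hm, hH0, fun x _ => rfl⟩, ?_⟩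
  intro x hx
  change H (1, x) = nI x
  rw [hHA 1 i1 x hx]
  rcases hbd hx with ⟨a, hx⟩ | ⟨c, hx⟩
  · rw [gC a 1 i1 x hx, h1 a x hx]
  · rw [gF c 1 i1 x hx, heq c hx]

end PolyCtx
end

/-- A field `n̂ ∈ C⁰(P̂)` is homotopic in `C⁰(P̂)` to a map which agrees
with the representative `n̂_I` (any map in `C⁰(P̂)` with the same invariants) at every
point of the boundary `∂P̂`. -/
theorem stmt_5 (P : PolyCtx) (deg : (V3 → V3) → ℤ) (hdeg : DegreeTheory deg)
    (s : V3) (hs : P.AdmissibleS s) (n nI : V3 → V3)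
    (hn : P.MemC0Phat n) (hnI : P.MemC0Phat nI)
    (hinv : P.SameInv deg s n nI) :
    ∃ n' : V3 → V3, P.MemC0Phat n' ∧ P.HomotopicPhat n n' ∧
      Set.EqOn n' nI P.bdPhat := by
  exact P.final hdeg hs hn hnI hinv
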